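/- For every integer n with n ≡ 2 (mod 8) and n ≥ 306 there exists a cyclically 6-connected strictly critical snark of order n. -/

import Mathlib

/-- The colour set `K = (ℤ₂ × ℤ₂) ∖ {(0,0)}`. -/
abbrev Kol : Type := {x : ZMod 2 × ZMod 2 // x ≠ 0}

/-- A proper edge colouring: distinct edges sharing a vertex get distinct colours. -/
def IsProperEdgeColoring {V C : Type*} (G : SimpleGraph V) (f : Sym2 V → C) : Prop :=
  ∀ e₁ ∈ G.edgeSet, ∀ e₂ ∈ G.edgeSet, e₁ ≠ e₂ → (∃ v : V, v ∈ e₁ ∧ v ∈ e₂) → f e₁ ≠ f e₂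

/-- A graph is 3-edge-colourable if it has a proper edge colouring with three colours. -/
def ThreeEdgeColorable {V : Type*} (G : SimpleGraph V) : Prop :=
  ∃ f : Sym2 V → Kol, IsProperEdgeColoring G f

/-- A graph is cubic if every vertex has degree 3. -/
def IsCubic {V : Type*} (G : SimpleGraph V) : Prop :=
  ∀ v : V, (G.neighborSet v).ncard = 3

/-- A snark: a connected cubic simple graph which is not 3-edge-colourable. -/
def IsSnark {V : Type*} (G : SimpleGraph V) : Prop :=
  G.Connected ∧ IsCubic G ∧ ¬ ThreeEdgeColorable G

/-- A snark is critical if removing any two distinct adjacent vertices yields a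
3-edge-colourable graph. -/
def Critical {V : Type*} (G : SimpleGraph V) : Prop :=
  ∀ u v : V, G.Adj u v → ThreeEdgeColorable (G.induce ({u, v}ᶜ : Set V))

/-- A snark is bicritical if removing any two distinct vertices yields a
3-edge-colourable graph. -/
def Bicritical {V : Type*} (G : SimpleGraph V) : Prop :=
  ∀ u v : V, u ≠ v → ThreeEdgeColorable (G.induce ({u, v}ᶜ : Set V))

/-- Strictly critical: critical but not bicritical. -/
def StrictlyCritical {V : Type*} (G : SimpleGraph V) : Prop :=
  Critical G ∧ ¬ Bicritical G

/-- A cubic graph is cyclically `k`-connected if no set of fewer than `k` edges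
separates two cycles, i.e. there is no set `F` of fewer than `k` edges whose deletion
leaves a graph in which two connected components contain a cycle. -/
def CyclicallyConnected {V : Type*} (G : SimpleGraph V) (k : ℕ) : Prop :=
  ¬ ∃ F : Set (Sym2 V), F ⊆ G.edgeSet ∧ F.ncard < k ∧
    ∃ a b : V, (∃ w : (G.deleteEdges F).Walk a a, w.IsCycle) ∧
               (∃ w : (G.deleteEdges F).Walk b b, w.IsCycle) ∧
               ¬ (G.deleteEdges F).Reachable a b

/-- The cyclic connectivity of a cubic graph: the largest `k` (at most the number of
edges) such that the graph is cyclically `k`-connected. -/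
noncomputable def cyclicConnectivity {V : Type*} (G : SimpleGraph V) : ℕ :=
  sSup {k | k ≤ G.edgeSet.ncard ∧ CyclicallyConnected G k}

namespace ChainSnark

/-- The end vertices of the edges `0, …, 437`, which lie inside the fixed part. -/
def coreEnds : List (ℕ × ℕ) := [
  (0, 3), (0, 5), (2, 5), (1, 7), (3, 7), (5, 8), (1, 9), (2, 10), (7, 11), (11, 12), (11, 13),
  (6, 15), (12, 15), (14, 15), (6, 16), (12, 17), (14, 18), (14, 19), (17, 20), (19, 20),
  (17, 21), (18, 21), (16, 22), (19, 22), (16, 23), (18, 23), (23, 24), (13, 25), (20, 25),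
  (24, 25), (10, 26), (24, 26), (22, 27), (26, 27), (27, 28), (21, 29), (13, 30), (10, 31),
  (30, 32), (30, 33), (33, 34), (29, 35), (33, 35), (29, 36), (35, 37), (36, 38), (36, 39),
  (34, 40), (37, 41), (38, 41), (40, 41), (37, 42), (39, 42), (34, 43), (42, 43), (32, 44),
  (43, 44), (38, 45), (44, 45), (28, 46), (45, 46), (39, 47), (46, 47), (47, 48), (28, 49),
  (8, 50), (48, 50), (31, 51), (49, 51), (50, 51), (48, 52), (32, 53), (40, 54), (54, 55),
  (54, 56), (55, 57), (55, 58), (52, 59), (57, 59), (52, 60), (58, 60), (58, 61), (57, 62),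
  (56, 63), (61, 63), (62, 63), (53, 64), (56, 64), (64, 65), (60, 66), (62, 67), (65, 67),
  (66, 67), (61, 68), (65, 68), (53, 69), (66, 69), (68, 70), (31, 71), (59, 72), (8, 73),
  (49, 74), (9, 75), (9, 76), (4, 77), (4, 78), (76, 79), (78, 79), (75, 80), (78, 80), (79, 81),
  (80, 82), (77, 83), (81, 83), (82, 83), (73, 84), (82, 84), (84, 85), (77, 86), (85, 86),
  (75, 87), (86, 87), (81, 88), (85, 88), (73, 89), (87, 89), (89, 90), (69, 91), (76, 92),
  (70, 93), (70, 94), (91, 96), (94, 96), (95, 96), (91, 97), (94, 98), (95, 99), (95, 100),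
  (93, 101), (98, 102), (99, 102), (101, 102), (93, 103), (98, 104), (100, 104), (103, 104),
  (97, 105), (99, 105), (103, 106), (105, 106), (101, 107), (72, 108), (106, 108), (107, 108),
  (72, 109), (107, 110), (97, 111), (100, 112), (71, 113), (74, 114), (110, 114), (113, 114),
  (109, 115), (113, 115), (110, 116), (115, 117), (116, 118), (117, 118), (118, 119), (116, 120),
  (120, 121), (112, 122), (119, 122), (121, 122), (119, 123), (112, 124), (121, 125), (123, 126),
  (124, 126), (125, 126), (120, 127), (111, 128), (124, 128), (123, 129), (127, 129), (128, 130),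
  (129, 130), (111, 131), (127, 131), (125, 132), (130, 132), (74, 133), (117, 134), (131, 135),
  (132, 136), (109, 137), (134, 138), (134, 139), (136, 140), (136, 141), (138, 143), (141, 143),
  (142, 143), (139, 144), (141, 144), (144, 145), (140, 146), (142, 146), (145, 146), (135, 147),
  (140, 147), (138, 148), (145, 149), (148, 149), (135, 150), (148, 150), (147, 151), (149, 151),
  (142, 152), (151, 152), (139, 153), (150, 154), (152, 155), (153, 156), (156, 157), (133, 158),
  (156, 158), (158, 159), (155, 160), (159, 160), (155, 161), (157, 162), (160, 162), (159, 163),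
  (162, 164), (161, 165), (163, 165), (164, 165), (163, 166), (154, 167), (161, 167), (157, 168),
  (166, 168), (166, 169), (167, 169), (164, 170), (169, 170), (154, 171), (168, 171), (171, 172),
  (133, 173), (153, 174), (71, 175), (174, 176), (137, 177), (175, 177), (176, 177), (175, 178),
  (90, 179), (174, 179), (178, 179), (170, 180), (178, 181), (173, 182), (181, 182), (173, 183),
  (182, 184), (184, 185), (180, 186), (184, 186), (183, 187), (186, 187), (180, 188), (183, 189),
  (187, 190), (185, 191), (188, 191), (190, 191), (185, 192), (189, 192), (192, 193), (172, 194),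
  (188, 194), (193, 194), (190, 195), (193, 195), (172, 196), (189, 196), (176, 197), (196, 198),
  (90, 199), (137, 200), (181, 201), (88, 202), (202, 203), (202, 204), (203, 205), (203, 206),
  (205, 207), (92, 208), (205, 208), (92, 209), (206, 209), (208, 210), (206, 211), (204, 212),
  (207, 212), (211, 212), (204, 213), (210, 213), (199, 214), (207, 214), (213, 215), (214, 215),
  (199, 216), (210, 216), (211, 217), (215, 217), (217, 218), (209, 219), (216, 220), (219, 221),
  (219, 222), (222, 223), (222, 224), (221, 225), (218, 226), (223, 226), (225, 226), (225, 227),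
  (218, 228), (223, 229), (227, 230), (228, 230), (229, 230), (227, 231), (224, 232), (228, 232),
  (229, 233), (231, 234), (232, 234), (233, 234), (224, 235), (220, 236), (233, 236), (235, 236),
  (220, 237), (197, 238), (235, 238), (197, 239), (200, 239), (237, 239), (195, 240), (237, 241),
  (201, 242), (201, 243), (241, 243), (243, 244), (244, 245), (240, 246), (244, 246), (242, 247),
  (246, 247), (247, 248), (240, 249), (245, 250), (248, 250), (249, 250), (245, 251), (198, 252),
  (249, 252), (198, 253), (242, 254), (251, 254), (253, 254), (251, 255), (252, 255), (248, 256),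
  (255, 256), (238, 257), (200, 258), (221, 259), (231, 260), (257, 261), (257, 262), (258, 262),
  (262, 263), (259, 265), (263, 265), (264, 265), (263, 266), (261, 267), (266, 267), (260, 268),
  (266, 268), (268, 269), (261, 270), (264, 270), (269, 270), (260, 271), (264, 271), (271, 272),
  (267, 273), (269, 274), (272, 274), (273, 274), (241, 275), (259, 276), (272, 276), (258, 278),
  (275, 278), (277, 278), (253, 279), (275, 280), (276, 281), (279, 281), (256, 282), (280, 283),
  (281, 283), (280, 284), (277, 285), (282, 285), (284, 285), (283, 286), (277, 287), (286, 287),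
  (279, 288), (287, 289), (282, 290), (288, 290), (289, 290), (284, 291), (289, 291), (273, 292),
  (291, 292), (286, 293), (288, 293), (292, 293)]

/-- The labels of the three edges at each vertex of the fixed part. -/
def coreIncidence : List (List ℕ) := [
  [442, 0, 1], [6, 438, 3], [443, 7, 2], [0, 440, 4], [441, 104, 105], [5, 2, 1], [11, 439, 14],
  [3, 8, 4], [100, 5, 65], [103, 6, 102], [7, 30, 37], [8, 9, 10], [9, 12, 15], [10, 36, 27],
  [13, 16, 17], [12, 11, 13], [14, 24, 22], [15, 20, 18], [21, 25, 16], [19, 23, 17],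
  [28, 19, 18], [35, 21, 20], [23, 32, 22], [25, 26, 24], [26, 29, 31], [29, 28, 27],
  [30, 33, 31], [32, 34, 33], [34, 59, 64], [41, 35, 43], [36, 39, 38], [37, 67, 98],
  [38, 71, 55], [39, 42, 40], [40, 47, 53], [42, 41, 44], [43, 45, 46], [44, 48, 51],
  [49, 57, 45], [52, 61, 46], [72, 50, 47], [50, 49, 48], [54, 52, 51], [56, 54, 53],
  [58, 56, 55], [57, 58, 60], [59, 62, 60], [61, 63, 62], [63, 70, 66], [64, 68, 101],
  [65, 66, 69], [67, 68, 69], [70, 77, 79], [71, 86, 95], [74, 72, 73], [73, 76, 75],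
  [87, 74, 83], [82, 78, 75], [81, 80, 76], [78, 99, 77], [80, 89, 79], [93, 81, 84],
  [90, 82, 85], [83, 84, 85], [86, 87, 88], [88, 94, 91], [89, 92, 96], [92, 90, 91],
  [97, 93, 94], [95, 127, 96], [130, 97, 129], [98, 158, 252], [99, 151, 154], [115, 100, 124],
  [101, 159, 191], [120, 108, 102], [128, 106, 103], [104, 118, 112], [107, 105, 109],
  [106, 110, 107], [108, 111, 109], [110, 122, 113], [111, 116, 114], [113, 112, 114],
  [116, 115, 117], [123, 119, 117], [118, 121, 119], [121, 120, 125], [122, 293, 123],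
  [126, 124, 125], [290, 126, 258], [127, 131, 134], [301, 128, 299], [129, 142, 138],
  [132, 130, 135], [133, 137, 136], [131, 132, 133], [134, 156, 146], [135, 143, 139],
  [147, 140, 136], [157, 144, 137], [141, 150, 138], [140, 141, 139], [145, 148, 142],
  [144, 145, 143], [149, 147, 146], [148, 149, 152], [150, 155, 153], [151, 153, 152],
  [154, 162, 195], [155, 164, 160], [156, 181, 187], [175, 157, 171], [158, 161, 163],
  [159, 160, 161], [162, 163, 165], [164, 166, 169], [167, 192, 165], [168, 167, 166],
  [174, 168, 172], [170, 180, 169], [176, 170, 173], [171, 173, 172], [183, 174, 177],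
  [182, 175, 178], [189, 176, 179], [178, 179, 177], [180, 184, 188], [181, 182, 185],
  [184, 183, 186], [185, 190, 186], [187, 193, 188], [194, 189, 190], [225, 250, 191],
  [192, 197, 196], [193, 209, 214], [198, 194, 199], [195, 254, 291], [200, 211, 196],
  [203, 220, 197], [210, 198, 206], [199, 201, 204], [218, 202, 207], [202, 200, 201],
  [205, 203, 204], [212, 205, 208], [206, 207, 208], [209, 210, 216], [211, 213, 215],
  [213, 212, 217], [214, 221, 215], [216, 219, 217], [222, 218, 219], [220, 223, 251],
  [221, 239, 247], [230, 222, 228], [223, 226, 224], [231, 241, 224], [227, 225, 226],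
  [233, 227, 229], [228, 232, 229], [240, 230, 235], [234, 231, 232], [238, 233, 236],
  [245, 234, 237], [235, 237, 236], [242, 238, 243], [239, 240, 244], [241, 242, 248],
  [244, 246, 243], [261, 245, 246], [247, 249, 248], [249, 281, 286], [250, 263, 265],
  [251, 253, 259], [252, 255, 257], [253, 256, 288], [254, 255, 256], [257, 260, 262],
  [258, 259, 260], [272, 261, 268], [264, 292, 262], [266, 264, 263], [270, 273, 265],
  [267, 266, 269], [278, 267, 275], [268, 271, 269], [274, 270, 271], [282, 272, 276],
  [273, 279, 287], [284, 274, 277], [276, 277, 275], [279, 278, 280], [283, 285, 280],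
  [281, 282, 283], [352, 284, 285], [286, 289, 287], [288, 347, 349], [289, 369, 371],
  [310, 290, 314], [291, 350, 380], [292, 355, 354], [293, 295, 294], [297, 294, 296],
  [295, 308, 305], [300, 298, 296], [302, 304, 297], [298, 311, 306], [303, 300, 299],
  [319, 302, 301], [309, 303, 315], [304, 316, 307], [307, 305, 306], [308, 309, 312],
  [311, 310, 313], [317, 312, 313], [320, 314, 315], [316, 318, 317], [318, 330, 326],
  [321, 319, 322], [343, 320, 346], [381, 325, 321], [324, 323, 322], [323, 331, 327],
  [336, 324, 342], [325, 329, 328], [328, 326, 327], [329, 335, 332], [330, 337, 333],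
  [331, 338, 334], [332, 333, 334], [335, 382, 339], [337, 336, 340], [338, 344, 341],
  [339, 340, 341], [348, 345, 342], [344, 343, 345], [346, 351, 353], [379, 348, 347],
  [349, 350, 351], [364, 352, 359], [356, 406, 353], [361, 372, 354], [357, 356, 355],
  [358, 357, 360], [368, 358, 365], [359, 362, 360], [363, 361, 362], [377, 363, 366],
  [370, 364, 367], [367, 366, 365], [373, 368, 375], [369, 370, 376], [371, 412, 374],
  [372, 373, 374], [376, 378, 375], [416, 377, 378], [383, 379, 384], [409, 385, 380],
  [407, 381, 387], [382, 393, 399], [396, 383, 391], [385, 384, 386], [390, 388, 386],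
  [389, 397, 400], [388, 389, 387], [394, 390, 392], [402, 392, 391], [393, 394, 395],
  [403, 395, 398], [397, 396, 398], [401, 399, 400], [408, 404, 401], [405, 433, 402],
  [404, 405, 403], [406, 410, 413], [414, 408, 407], [424, 411, 420], [411, 409, 410],
  [412, 426, 415], [419, 417, 413], [415, 414, 418], [428, 416, 421], [417, 423, 418],
  [431, 419, 422], [421, 422, 420], [423, 425, 435], [425, 424, 427], [426, 429, 436],
  [430, 432, 427], [429, 428, 430], [434, 431, 432], [433, 434, 437], [436, 437, 435]]

/-- One row per superedge: the base vertex before it, the labels of its two dangling strand edges,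
the six vertices of its two incomplete tiles, and, unless its complete tiles form the variable chain,
the twelve vertices of its three complete tiles. -/
def superedges : List (List ℕ) := [
  [153, 222, 261, 158, 157, 156, 154, 168, 171, 167, 170, 166, 169, 161, 164, 163, 165, 155, 162, 159, 160],
  [133, 261, 352, 182, 183, 173, 172, 189, 196, 194, 195, 192, 193, 188, 190, 185, 191, 180, 187, 184, 186],
  [181, 352, 416, 243, 242, 201, 198, 254, 253, 252, 256, 251, 255, 249, 248, 245, 250, 240, 247, 244, 246],
  [241, 416, 433, 278, 280, 275, 279, 283, 281, 288, 292, 286, 293, 290, 291, 287, 289, 282, 284, 277, 285],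
  [258, 433, 382, 257, 263, 262, 276, 265, 259, 272, 260, 264, 271, 274, 268, 270, 269, 273, 266, 261, 267],
  [238, 382, 318, 236, 224, 235, 221, 222, 219, 225, 218, 223, 226, 227, 228, 229, 230, 231, 232, 233, 234],
  [220, 318, 293, 199, 210, 216, 209, 208, 92, 206, 202, 205, 203, 211, 204, 207, 212, 217, 213, 214, 215],
  [90, 293, 441, 73, 87, 89, 76, 75, 9, 79, 4, 80, 78, 81, 77, 82, 83, 88, 86, 84, 85],
  [8, 441, 439, 2, 0, 5, 1, 3, 7],
  [10, 439, 35, 27, 24, 26, 11, 25, 13, 12, 21, 20, 17, 15, 18, 19, 14, 6, 23, 22, 16],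
  [28, 35, 72, 47, 45, 46, 30, 44, 32, 33, 40, 43, 34, 35, 41, 42, 37, 29, 38, 39, 36],
  [48, 72, 97, 59, 60, 52, 53, 66, 69, 64, 68, 67, 65, 56, 61, 62, 63, 54, 58, 57, 55],
  [72, 97, 157, 107, 106, 108, 91, 105, 97, 96, 100, 99, 95, 94, 104, 102, 98, 70, 103, 101, 93],
  [110, 157, 194, 118, 120, 116, 111, 127, 131, 128, 132, 129, 130, 124, 125, 123, 126, 112, 121, 119, 122],
  [117, 194, 222, 139, 138, 134, 135, 148, 150, 147, 152, 149, 151, 140, 142, 145, 146, 136, 143, 144, 141]]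

/-- The labels of the edges of the base graph; `1000 + i` stands for the `i`-th superedge. -/
def baseEdges : List ℕ := [
  1004, 1005, 347, 1003, 380, 288, 349, 350, 351, 291, 1006, 346, 353, 1002, 1001, 262, 257, 260,
  1007, 258, 259, 251, 253, 256, 254, 255, 252, 1008, 65, 1009, 37, 67, 98, 158, 68, 69, 66, 64,
  101, 1010, 1011, 1000, 191, 1014, 1013, 165, 161, 163, 162, 154, 195, 1012, 160, 159]

/-- The vertices of the base graph, in the order in which the search visits them. -/
def baseVertices : List (ℕ × ℕ × ℕ × ℕ) := [
  (1005, 0, 1, 2), (1004, 0, 3, 4), (197, 2, 5, 6), (239, 6, 7, 8), (200, 4, 7, 9),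
  (1006, 1, 10, 11), (237, 8, 11, 12), (1003, 3, 12, 13), (1002, 13, 14, 15), (178, 15, 16, 17),
  (1007, 10, 18, 19), (179, 17, 19, 20), (174, 20, 21, 22), (176, 5, 22, 23), (177, 23, 24, 25),
  (175, 16, 25, 26), (1008, 18, 27, 28), (1009, 27, 29, 30), (31, 30, 31, 32), (71, 26, 32, 33),
  (51, 31, 34, 35), (50, 28, 35, 36), (49, 34, 37, 38), (1010, 29, 37, 39), (1011, 36, 39, 40),
  (1001, 14, 41, 42), (1000, 21, 41, 43), (1014, 43, 44, 45), (113, 33, 46, 47),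
  (115, 45, 47, 48), (109, 48, 49, 50), (1012, 40, 49, 51), (1013, 44, 51, 52), (114, 46, 52, 53)]

/-- The neighbours in the fixed part of the leaves of the first tile of the chain. -/
def leftAnchor (k : ℕ) : ℕ := if k = 0 then 1 else if k = 1 then 6 else 3

/-- The neighbours in the fixed part of the leaves of the last tile of the chain. -/
def rightAnchor (k : ℕ) : ℕ := if k = 0 then 4 else if k = 1 then 0 else 2

/-- The edge with a given label: the labels `441, 442, 443` stand for the last three edges. -/
def edgeOfLabel (T e : ℕ) : ℕ := if e < 441 then e else e + 6 * T - 3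

/-- The label of the `k`-th edge at the vertex `v` of the fixed part. -/
def coreInc (v k : ℕ) : ℕ := (coreIncidence.getD v []).getD k 0

/-- The `k`-th edge at the vertex `v` of the graph with `T` tiles. -/
def inc (T v k : ℕ) : ℕ :=
  if v < 294 then edgeOfLabel T (coreInc v k)
  else if (v - 294) % 4 = 3 then 441 + 6 * ((v - 294) / 4) + k
  else if k = 0 then 438 + 6 * ((v - 294) / 4) + (v - 294) % 4
  else if k = 1 then 444 + 6 * ((v - 294) / 4) + (v - 294) % 4
  else 441 + 6 * ((v - 294) / 4) + (v - 294) % 4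

/-- The end vertices of the edge `e` of the graph with `T` tiles. -/
def ends (T e : ℕ) : ℕ × ℕ :=
  if e < 438 then coreEnds.getD e (0, 0)
  else if (e - 438) % 6 < 3 then
    (if (e - 438) / 6 = 0 then leftAnchor ((e - 438) % 6)
      else 290 + 4 * ((e - 438) / 6) + (e - 438) % 6,
     if (e - 438) / 6 = T then rightAnchor ((e - 438) % 6)
      else 294 + 4 * ((e - 438) / 6) + (e - 438) % 6)
  else (291 + 4 * ((e - 438) / 6) + (e - 438) % 6, 297 + 4 * ((e - 438) / 6))

/-- The vertex `v` is an end of the edge `e`. -/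
def IsEnd (T e v : ℕ) : Prop := (ends T e).1 = v ∨ (ends T e).2 = v

/-- The graph with `T` tiles. -/
def graph (T : ℕ) : SimpleGraph (Fin (294 + 4 * T)) :=
  SimpleGraph.fromRel fun u v => ∃ e < 441 + 6 * T, ends T e = (u.1, v.1)

theorem coreEnds_lt : ∀ e < 438,
    (coreEnds.getD e (0, 0)).1 < (coreEnds.getD e (0, 0)).2 ∧
      (coreEnds.getD e (0, 0)).2 < 294 := by
  decide +kernel

theorem coreEnds_sorted : (coreEnds.map fun p => 294 * p.2 + p.1).SortedLT := by
  decide +kernel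

theorem coreInc_spec : ∀ v < 294, ∀ k < 3, coreInc v k < 444 ∧
    (coreInc v k < 438 → (coreEnds.getD (coreInc v k) (0, 0)).1 = v ∨
      (coreEnds.getD (coreInc v k) (0, 0)).2 = v) ∧
    (438 ≤ coreInc v k → coreInc v k < 441 → leftAnchor (coreInc v k - 438) = v) ∧
    (441 ≤ coreInc v k → rightAnchor (coreInc v k - 441) = v) := by
  decide +kernel

theorem coreInc_ne : ∀ v < 294, coreInc v 0 ≠ coreInc v 1 ∧ coreInc v 0 ≠ coreInc v 2 ∧
    coreInc v 1 ≠ coreInc v 2 := by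
  decide +kernel

theorem exists_coreInc_eq : ∀ e < 438,
    (∃ k < 3, coreInc (coreEnds.getD e (0, 0)).1 k = e) ∧
      ∃ k < 3, coreInc (coreEnds.getD e (0, 0)).2 k = e := by
  decide +kernel

theorem exists_coreInc_anchor : ∀ k < 3, (∃ i < 3, coreInc (leftAnchor k) i = 438 + k) ∧
    ∃ i < 3, coreInc (rightAnchor k) i = 441 + k := by
  decide +kernel

theorem anchor_lt (k : ℕ) : leftAnchor k < 294 ∧ rightAnchor k < 294 := by
  unfold leftAnchor rightAnchor; split_ifs <;> omega

theorem exists_chain_index {e : ℕ} (he : 438 ≤ e) :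
    ∃ t k, k < 3 ∧ (e = 438 + 6 * t + k ∨ e = 441 + 6 * t + k) := by
  refine ⟨(e - 438) / 6, (e - 438) % 6 % 3, ?_, ?_⟩ <;> omega

theorem exists_tile_index {v : ℕ} (hv : 294 ≤ v) :
    ∃ t, v = 297 + 4 * t ∨ ∃ k < 3, v = 294 + 4 * t + k := by
  refine ⟨(v - 294) / 4, ?_⟩
  by_cases h : (v - 294) % 4 = 3
  · left; omega
  · right; exact ⟨(v - 294) % 4, by omega, by omega⟩

theorem ends_core {T e : ℕ} (he : e < 438) : ends T e = coreEnds.getD e (0, 0) := by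
  simp [ends, he]

theorem ends_strand {T t k : ℕ} (hk : k < 3) : ends T (438 + 6 * t + k) =
    (if t = 0 then leftAnchor k else 290 + 4 * t + k,
      if t = T then rightAnchor k else 294 + 4 * t + k) := by
  have h1 : ¬ 438 + 6 * t + k < 438 := by omega
  have h2 : (438 + 6 * t + k - 438) % 6 = k := by omega
  have h3 : (438 + 6 * t + k - 438) / 6 = t := by omega
  simp only [ends, h1, h2, h3, hk, if_true, if_false]

theorem ends_centre {T t k : ℕ} (hk : k < 3) :
    ends T (441 + 6 * t + k) = (294 + 4 * t + k, 297 + 4 * t) := by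
  have h1 : ¬ 441 + 6 * t + k < 438 := by omega
  have h2 : (441 + 6 * t + k - 438) % 6 = 3 + k := by omega
  have h3 : (441 + 6 * t + k - 438) / 6 = t := by omega
  have h4 : ¬ 3 + k < 3 := by omega
  simp only [ends, h1, h2, h3, h4, if_false, Prod.mk.injEq, and_true]
  omega

theorem inc_core {T v k : ℕ} (hv : v < 294) : inc T v k = edgeOfLabel T (coreInc v k) := by
  simp [inc, hv]

theorem inc_centre {T t k : ℕ} : inc T (297 + 4 * t) k = 441 + 6 * t + k := by
  have h1 : ¬ 297 + 4 * t < 294 := by omega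
  have h2 : (297 + 4 * t - 294) % 4 = 3 := by omega
  have h3 : (297 + 4 * t - 294) / 4 = t := by omega
  simp [inc, h1, h2, h3]

theorem inc_leaf {T t j : ℕ} (hj : j < 3) : inc T (294 + 4 * t + j) 0 = 438 + 6 * t + j ∧
    inc T (294 + 4 * t + j) 1 = 444 + 6 * t + j ∧
    inc T (294 + 4 * t + j) 2 = 441 + 6 * t + j := by
  have h1 : ¬ 294 + 4 * t + j < 294 := by omega
  have h2 : (294 + 4 * t + j - 294) % 4 = j := by omega
  have h3 : (294 + 4 * t + j - 294) / 4 = t := by omega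
  have h4 : j ≠ 3 := by omega
  simp [inc, h1, h2, h3, h4]

theorem edgeOfLabel_lt {T e : ℕ} (he : e < 444) : edgeOfLabel T e < 441 + 6 * T := by
  unfold edgeOfLabel; split_ifs <;> omega

theorem edgeOfLabel_injective {T a b : ℕ} (hT : 0 < T)
    (h : edgeOfLabel T a = edgeOfLabel T b) : a = b := by
  unfold edgeOfLabel at h; split_ifs at h <;> omega

theorem inc_lt {T v k : ℕ} (hv : v < 294 + 4 * T) (hk : k < 3) :
    inc T v k < 441 + 6 * T := by
  rcases lt_or_ge v 294 with h | h
  · rw [inc_core h]; exact edgeOfLabel_lt (coreInc_spec v h k hk).1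
  · obtain ⟨t, rfl | ⟨j, hj, rfl⟩⟩ := exists_tile_index h
    · rw [inc_centre]; omega
    · obtain ⟨h0, h1, h2⟩ := inc_leaf (T := T) (t := t) hj
      interval_cases k <;> omega

theorem isEnd_inc {T v k : ℕ} (hv : v < 294 + 4 * T) (hk : k < 3) :
    IsEnd T (inc T v k) v := by
  unfold IsEnd
  rcases lt_or_ge v 294 with h | h
  · obtain ⟨h1, h2, h3, h4⟩ := coreInc_spec v h k hk
    rw [inc_core h]
    rcases lt_or_ge (coreInc v k) 441 with h5 | h5
    · simp only [edgeOfLabel, h5, if_true]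
      rcases lt_or_ge (coreInc v k) 438 with h6 | h6
      · rw [ends_core h6]; exact h2 h6
      · left
        have := ends_strand (T := T) (t := 0) (k := coreInc v k - 438) (by omega)
        rw [show 438 + 6 * 0 + (coreInc v k - 438) = coreInc v k by omega] at this
        rw [this]; simpa using h3 h6 h5
    · simp only [edgeOfLabel, not_lt.2 h5, if_false]
      right
      have := ends_strand (T := T) (t := T) (k := coreInc v k - 441) (by omega)
      rw [show 438 + 6 * T + (coreInc v k - 441) = coreInc v k + 6 * T - 3 by omega] at this
      rw [this]; simpa using h4 h5
  · obtain ⟨t, rfl | ⟨j, hj, rfl⟩⟩ := exists_tile_index h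
    · rw [inc_centre, ends_centre hk]; simp
    · obtain ⟨h0, h1, h2⟩ := inc_leaf (T := T) (t := t) hj
      obtain rfl | rfl | rfl : k = 0 ∨ k = 1 ∨ k = 2 := by omega
      · rw [h0, ends_strand hj]
        exact Or.inr (if_neg (by omega))
      · rw [h1, show 444 + 6 * t + j = 438 + 6 * (t + 1) + j by ring, ends_strand hj]
        left
        change (if t + 1 = 0 then leftAnchor j else 290 + 4 * (t + 1) + j) = 294 + 4 * t + j
        rw [if_neg t.succ_ne_zero]; ring
      · rw [h2, ends_centre hj]; left; rfl

theorem inc_ne {T v : ℕ} (hT : 0 < T) (hv : v < 294 + 4 * T) : inc T v 0 ≠ inc T v 1 ∧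
    inc T v 0 ≠ inc T v 2 ∧ inc T v 1 ≠ inc T v 2 := by
  rcases lt_or_ge v 294 with h | h
  · obtain ⟨h1, h2, h3⟩ := coreInc_ne v h
    simp only [inc_core h]
    exact ⟨fun e => h1 (edgeOfLabel_injective hT e), fun e => h2 (edgeOfLabel_injective hT e),
      fun e => h3 (edgeOfLabel_injective hT e)⟩
  · obtain ⟨t, rfl | ⟨j, hj, rfl⟩⟩ := exists_tile_index h
    · simp only [inc_centre]; omega
    · obtain ⟨h0, h1, h2⟩ := inc_leaf (T := T) (t := t) hj
      omega

theorem exists_inc_eq {T e v : ℕ} (he : e < 441 + 6 * T) (h : IsEnd T e v) :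
    v < 294 + 4 * T ∧ ∃ k < 3, inc T v k = e := by
  unfold IsEnd at h
  rcases lt_or_ge e 438 with h1 | h1
  · rw [ends_core h1] at h
    obtain ⟨h2, h3⟩ := coreEnds_lt e h1
    obtain ⟨⟨i, hi, hi'⟩, ⟨j, hj, hj'⟩⟩ := exists_coreInc_eq e h1
    rcases h with rfl | rfl
    · refine ⟨by omega, i, hi, ?_⟩
      rw [inc_core (by omega), hi', edgeOfLabel, if_pos (by omega)]
    · refine ⟨by omega, j, hj, ?_⟩
      rw [inc_core (by omega), hj', edgeOfLabel, if_pos (by omega)]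
  · obtain ⟨t, k, hk, rfl | rfl⟩ := exists_chain_index h1
    · rw [ends_strand hk] at h
      obtain ⟨⟨i, hi, hi'⟩, ⟨j, hj, hj'⟩⟩ := exists_coreInc_anchor k hk
      obtain ⟨ha, hb⟩ := anchor_lt k
      rcases h with rfl | rfl
      · simp only []
        split_ifs with h2
        · subst h2
          refine ⟨by omega, i, hi, ?_⟩
          rw [inc_core ha, hi', edgeOfLabel, if_pos (by omega)]
        · obtain ⟨s, rfl⟩ := Nat.exists_eq_succ_of_ne_zero h2
          refine ⟨by omega, 1, by omega, ?_⟩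
          rw [show 290 + 4 * s.succ + k = 294 + 4 * s + k by omega, (inc_leaf hk).2.1]; omega
      · simp only []
        split_ifs with h2
        · subst h2
          refine ⟨by omega, j, hj, ?_⟩
          rw [inc_core hb, hj', edgeOfLabel, if_neg (by omega)]
          omega
        · exact ⟨by omega, 0, by omega, (inc_leaf hk).1⟩
    · rw [ends_centre hk] at h
      rcases h with rfl | rfl
      · exact ⟨by simp only []; omega, 2, by omega, (inc_leaf hk).2.2⟩
      · exact ⟨by simp only []; omega, k, hk, inc_centre⟩

theorem coreEnds_injective {e e' : ℕ} (he : e < 438) (he' : e' < 438)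
    (h : coreEnds.getD e (0, 0) = coreEnds.getD e' (0, 0)) : e = e' := by
  have hl : (coreEnds.map fun p => 294 * p.2 + p.1).length = 438 := by
    rw [List.length_map]; decide +kernel
  have hl' : coreEnds.length = 438 := by simpa using hl
  have := coreEnds_sorted.nodup
  refine (List.Nodup.getElem_inj_iff this (hi := by omega) (hj := by omega)).1 ?_
  rw [List.getD_eq_getElem _ _ (by omega), List.getD_eq_getElem _ _ (by omega)] at h
  rw [List.getElem_map, List.getElem_map, h]

theorem ends_fst_ne_snd {T e : ℕ} (hT : 0 < T) (he : e < 441 + 6 * T) :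
    (ends T e).1 ≠ (ends T e).2 := by
  rcases lt_or_ge e 438 with h1 | h1
  · rw [ends_core h1]; exact (coreEnds_lt e h1).1.ne
  · obtain ⟨t, k, hk, rfl | rfl⟩ := exists_chain_index h1
    · rw [ends_strand hk]
      obtain ⟨ha, hb⟩ := anchor_lt k
      dsimp only
      by_cases t0 : t = 0 <;> by_cases tT : t = T <;>
        simp only [t0, tT, hT.ne, hT.ne', if_true, if_false]
      all_goals omega
    · rw [ends_centre hk]; dsimp only; omega

theorem anchor_injective : ∀ j < 3, ∀ k < 3,
    (leftAnchor j = leftAnchor k → j = k) ∧ (rightAnchor j = rightAnchor k → j = k) := by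
  decide

theorem leftAnchor_ne_rightAnchor (j k : ℕ) : leftAnchor j ≠ rightAnchor k := by
  unfold leftAnchor rightAnchor; split_ifs <;> omega

theorem eq_of_isEnd {T e e' u v : ℕ} (hT : 0 < T) (he : e < 441 + 6 * T) (he' : e' < 441 + 6 * T)
    (huv : u ≠ v) (h1 : IsEnd T e u) (h2 : IsEnd T e v) (h3 : IsEnd T e' u)
    (h4 : IsEnd T e' v) : e = e' := by
  unfold IsEnd at h1 h2 h3 h4
  rcases lt_or_ge e 438 with g | g <;> rcases lt_or_ge e' 438 with g' | g'
  · apply coreEnds_injective g g'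
    have := (coreEnds_lt e g).1
    have := (coreEnds_lt e' g').1
    rw [ends_core g] at h1 h2
    rw [ends_core g'] at h3 h4
    ext <;> omega
  · obtain ⟨t, k, hk, rfl | rfl⟩ := exists_chain_index g'
    · rw [ends_strand hk] at h3 h4
      have := coreEnds_lt e g
      rw [ends_core g] at h1 h2
      split_ifs at h3 h4 <;> simp only [] at h3 h4 <;> omega
    · rw [ends_centre hk] at h3 h4
      have := coreEnds_lt e g
      rw [ends_core g] at h1 h2
      simp only [] at h3 h4; omega
  · obtain ⟨t, k, hk, rfl | rfl⟩ := exists_chain_index g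
    · rw [ends_strand hk] at h1 h2
      have := coreEnds_lt e' g'
      rw [ends_core g'] at h3 h4
      split_ifs at h1 h2 <;> simp only [] at h1 h2 <;> omega
    · rw [ends_centre hk] at h1 h2
      have := coreEnds_lt e' g'
      rw [ends_core g'] at h3 h4
      simp only [] at h1 h2; omega
  · obtain ⟨t, k, hk, h⟩ := exists_chain_index g
    obtain ⟨t', k', hk', h'⟩ := exists_chain_index g'
    have hi := anchor_injective k hk k' hk'
    have hi' := leftAnchor_ne_rightAnchor k k'
    have hi'' := leftAnchor_ne_rightAnchor k' k
    have := anchor_lt k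
    have := anchor_lt k'
    rcases h with rfl | rfl <;> rcases h' with rfl | rfl <;>
      simp only [ends_strand, ends_centre, hk, hk'] at h1 h2 h3 h4
    · by_cases t0 : t = 0 <;> by_cases tT : t = T <;>
        by_cases t0' : t' = 0 <;> by_cases tT' : t' = T <;>
        try omega
      all_goals
        simp only [t0, tT, t0', tT', hT.ne', hT.ne, if_true, if_false] at h1 h2 h3 h4
        omega
    · split_ifs at h1 h2 <;> omega
    · split_ifs at h3 h4 <;> omega
    · omega

theorem eq_of_isEnd_of_ne {T e u v w : ℕ} (h : IsEnd T e v) (hu : IsEnd T e u) (hw : IsEnd T e w)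
    (huv : u ≠ v) (hwv : w ≠ v) : u = w := by
  unfold IsEnd at *; omega

theorem adj_iff {T : ℕ} (u v : Fin (294 + 4 * T)) : (graph T).Adj u v ↔
    u ≠ v ∧ ∃ e < 441 + 6 * T, IsEnd T e u ∧ IsEnd T e v := by
  rw [graph, SimpleGraph.fromRel_adj]
  refine and_congr_right fun huv => ⟨?_, ?_⟩
  · rintro (⟨e, he, h⟩ | ⟨e, he, h⟩)
    · exact ⟨e, he, Or.inl (by rw [h]), Or.inr (by rw [h])⟩
    · exact ⟨e, he, Or.inr (by rw [h]), Or.inl (by rw [h])⟩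
  · rintro ⟨e, he, h1, h2⟩
    have huv' : u.1 ≠ v.1 := fun h => huv (Fin.ext h)
    unfold IsEnd at h1 h2
    by_cases h : (ends T e).1 = u
    · exact Or.inl ⟨e, he, by ext <;> simp only [] <;> omega⟩
    · exact Or.inr ⟨e, he, by ext <;> simp only [] <;> omega⟩

theorem exists_otherEnd {T e v : ℕ} (hT : 0 < T) (he : e < 441 + 6 * T) (h : IsEnd T e v) :
    ∃ w : Fin (294 + 4 * T), w.1 ≠ v ∧ IsEnd T e w := by
  have hne := ends_fst_ne_snd hT he
  have h1 := (exists_inc_eq he (Or.inl rfl)).1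
  have h2 := (exists_inc_eq he (Or.inr rfl)).1
  rcases h with rfl | rfl
  · exact ⟨⟨_, h2⟩, hne.symm, Or.inr rfl⟩
  · exact ⟨⟨_, h1⟩, hne, Or.inl rfl⟩

theorem exists_neighbors {T : ℕ} (hT : 0 < T) (v : Fin (294 + 4 * T)) :
    ∃ w : ℕ → Fin (294 + 4 * T), (w 0 ≠ w 1 ∧ w 0 ≠ w 2 ∧ w 1 ≠ w 2) ∧
      (graph T).neighborSet v = {w 0, w 1, w 2} := by
  have key : ∀ k, ∃ w : Fin (294 + 4 * T), k < 3 → w.1 ≠ v ∧ IsEnd T (inc T v k) w := by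
    intro k
    by_cases hk : k < 3
    · obtain ⟨w, h⟩ := exists_otherEnd hT (inc_lt v.2 hk) (isEnd_inc v.2 hk)
      exact ⟨w, fun _ => h⟩
    · exact ⟨v, fun h => absurd h hk⟩
  choose w hw using key
  have hd : ∀ j k, j < 3 → k < 3 → inc T v j ≠ inc T v k → w j ≠ w k := by
    intro j k hj hk hjk h
    refine hjk (eq_of_isEnd hT (inc_lt v.2 hj) (inc_lt v.2 hk) (hw j hj).1 (hw j hj).2
      (isEnd_inc v.2 hj) ?_ (isEnd_inc v.2 hk))
    rw [h]; exact (hw k hk).2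
  obtain ⟨h01, h02, h12⟩ := inc_ne hT v.2
  refine ⟨w, ⟨hd 0 1 (by omega) (by omega) h01, hd 0 2 (by omega) (by omega) h02,
    hd 1 2 (by omega) (by omega) h12⟩, ?_⟩
  ext u
  rw [SimpleGraph.mem_neighborSet, adj_iff]
  constructor
  · rintro ⟨huv, e, he, h1, h2⟩
    obtain ⟨k, hk, rfl⟩ := (exists_inc_eq he h1).2
    have : u = w k := Fin.ext (eq_of_isEnd_of_ne h1 h2 (hw k hk).2
      (fun h => huv (Fin.ext h.symm)) (hw k hk).1)
    subst this
    obtain rfl | rfl | rfl : k = 0 ∨ k = 1 ∨ k = 2 := by omega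
    all_goals simp
  · intro hu
    have hu' : ∃ k < 3, u = w k := by
      rcases hu with h | h | h
      exacts [⟨0, by omega, h⟩, ⟨1, by omega, h⟩, ⟨2, by omega, h⟩]
    obtain ⟨k, hk, rfl⟩ := hu'
    exact ⟨fun h => (hw k hk).1 (by rw [← h]), _, inc_lt v.2 hk, isEnd_inc v.2 hk, (hw k hk).2⟩

theorem isCubic_graph {T : ℕ} (hT : 0 < T) : IsCubic (graph T) := by
  intro v
  obtain ⟨w, ⟨h1, h2, h3⟩, h⟩ := exists_neighbors hT v
  exact Set.ncard_eq_three.2 ⟨_, _, _, h1, h2, h3, h⟩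

/-- Colours together with the zero element. -/
abbrev Color := ZMod 2 × ZMod 2

/-- The colours at a properly coloured vertex. -/
def Tri (a b c : Color) : Prop := a ≠ 0 ∧ b ≠ 0 ∧ c ≠ 0 ∧ a + b + c = 0

instance (a b c : Color) : Decidable (Tri a b c) := by unfold Tri; infer_instance

theorem Tri.ne : ∀ {a b c : Color}, Tri a b c → a ≠ b ∧ a ≠ c ∧ b ≠ c := by
  decide

theorem tri_of_ne : ∀ a b c : Color, a ≠ 0 ∧ b ≠ 0 ∧ c ≠ 0 ∧ a ≠ b ∧ a ≠ c ∧ b ≠ c →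
    Tri a b c := by
  decide

/-- The colouring `f` is proper at all vertices that are not ends of the edge `j`. -/
def Good (T j : ℕ) (f : ℕ → Color) : Prop :=
  ∀ v < 294 + 4 * T, (∀ k < 3, inc T v k ≠ j) → Tri (f (inc T v 0)) (f (inc T v 1)) (f (inc T v 2))

open Classical in
/-- The edge with a given pair of ends. -/
noncomputable def edgeIndex (T : ℕ) (s : Sym2 (Fin (294 + 4 * T))) : ℕ :=
  if h : ∃ e < 441 + 6 * T, ∀ x ∈ s, IsEnd T e x then h.choose else 0

theorem edgeIndex_spec {T : ℕ} {s : Sym2 (Fin (294 + 4 * T))} (hs : s ∈ (graph T).edgeSet) :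
    edgeIndex T s < 441 + 6 * T ∧ ∀ x ∈ s, IsEnd T (edgeIndex T s) x := by
  have h : ∃ e < 441 + 6 * T, ∀ x ∈ s, IsEnd T e x := by
    induction s with
    | _ u v =>
      obtain ⟨-, e, he, h1, h2⟩ := (adj_iff u v).1 hs
      exact ⟨e, he, by simp [h1, h2]⟩
  rw [edgeIndex, dif_pos h]
  exact h.choose_spec

theorem edgeIndex_injOn {T : ℕ} : Set.InjOn (edgeIndex T) (graph T).edgeSet := by
  intro s hs s' hs' h
  have h1 := (edgeIndex_spec hs).2
  have h2 := (edgeIndex_spec hs').2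
  rw [← h] at h2
  generalize edgeIndex T s = e at h1 h2
  induction s with
  | _ u v =>
    induction s' with
    | _ u' v' =>
      have huv := ((adj_iff u v).1 hs).1
      have huv' := ((adj_iff u' v').1 hs').1
      have a := h1 u (by simp)
      have b := h1 v (by simp)
      have a' := h2 u' (by simp)
      have b' := h2 v' (by simp)
      unfold IsEnd at *
      rw [Ne, Fin.ext_iff] at huv huv'
      simp only [Sym2.eq_iff, Fin.ext_iff]
      omega

theorem Good.color_ne {T j : ℕ} {f : ℕ → Color} (hf : Good T j f) {e e' v : ℕ}
    (he : e < 441 + 6 * T) (he' : e' < 441 + 6 * T) (hv : IsEnd T e v) (hv' : IsEnd T e' v)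
    (hj : ¬ IsEnd T j v) : f e ≠ 0 ∧ (e ≠ e' → f e ≠ f e') := by
  obtain ⟨h, k, hk, rfl⟩ := exists_inc_eq he hv
  obtain ⟨-, k', hk', rfl⟩ := exists_inc_eq he' hv'
  have ht := hf v h fun i hi hij => hj (hij ▸ isEnd_inc h hi)
  obtain ⟨h1, h2, h3⟩ := ht.ne
  obtain ⟨g1, g2, g3, -⟩ := ht
  refine ⟨?_, fun hne => ?_⟩
  · obtain rfl | rfl | rfl : k = 0 ∨ k = 1 ∨ k = 2 := by omega
    exacts [g1, g2, g3]
  · obtain rfl | rfl | rfl : k = 0 ∨ k = 1 ∨ k = 2 := by omega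
    all_goals obtain rfl | rfl | rfl : k' = 0 ∨ k' = 1 ∨ k' = 2 := by omega
    exacts [absurd rfl hne, h1, h2, h1.symm, absurd rfl hne, h3, h2.symm, h3.symm, absurd rfl hne]

open Classical in
theorem Good.threeEdgeColorable {T j : ℕ} {f : ℕ → Color} (hf : Good T j f)
    {u v : Fin (294 + 4 * T)} (hj : ∀ w, IsEnd T j w → w = u.1 ∨ w = v.1) :
    ThreeEdgeColorable ((graph T).induce ({u, v}ᶜ : Set (Fin (294 + 4 * T)))) := by
  set S : Set (Fin (294 + 4 * T)) := {u, v}ᶜ with hS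
  set H := (graph T).induce S
  have hH : ∀ s ∈ H.edgeSet, s.map Subtype.val ∈ (graph T).edgeSet := by
    intro s hs
    induction s with
    | _ a b => simpa [H] using hs
  have hz : ((1, 0) : Color) ≠ 0 := by decide
  refine ⟨fun s => if h : f (edgeIndex T (s.map Subtype.val)) ≠ 0 then ⟨_, h⟩ else ⟨_, hz⟩, ?_⟩
  rintro s hs s' hs' hne ⟨w, hw, hw'⟩
  have e1 := edgeIndex_spec (hH s hs)
  have e2 := edgeIndex_spec (hH s' hs')
  have hwj : ¬ IsEnd T j w.1 := by
    intro h
    have h1 := w.2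
    have h2 := hj _ h
    simp only [hS, Set.mem_compl_iff, Set.mem_insert_iff, Set.mem_singleton_iff,
      Fin.ext_iff] at h1
    exact h1 h2
  have i1 := e1.2 w (Sym2.mem_map.2 ⟨w, hw, rfl⟩)
  have i2 := e2.2 w (Sym2.mem_map.2 ⟨w, hw', rfl⟩)
  have hne' : edgeIndex T (s.map Subtype.val) ≠ edgeIndex T (s'.map Subtype.val) := fun h =>
    hne (Sym2.map.injective Subtype.val_injective (edgeIndex_injOn (hH s hs) (hH s' hs') h))
  have c1 := hf.color_ne e1.1 e2.1 i1 i2 hwj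
  have c2 := hf.color_ne e2.1 e1.1 i2 i1 hwj
  simp only [dif_pos c1.1, dif_pos c2.1, ne_eq, Subtype.mk.injEq]
  exact c1.2 hne'

theorem critical_of_good {T : ℕ} (h : ∀ j < 441 + 6 * T, ∃ f, Good T j f) :
    Critical (graph T) := by
  intro u v huv
  obtain ⟨hne, e, he, hu, hv⟩ := (adj_iff u v).1 huv
  obtain ⟨f, hf⟩ := h e he
  refine hf.threeEdgeColorable fun w hw => ?_
  have : u.1 ≠ v.1 := fun h => hne (Fin.ext h)
  unfold IsEnd at *; omega

open Classical in
theorem exists_coloring_of_threeEdgeColorable {T : ℕ} {S : Set (Fin (294 + 4 * T))} (hT : 0 < T)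
    (h : ThreeEdgeColorable ((graph T).induce S)) :
    ∃ f : ℕ → Color, ∀ e < 441 + 6 * T, ∀ e' < 441 + 6 * T,
      (∀ v : Fin (294 + 4 * T), IsEnd T e v → v ∈ S) →
      (∀ v : Fin (294 + 4 * T), IsEnd T e' v → v ∈ S) →
      ∀ v : ℕ, IsEnd T e v → IsEnd T e' v → f e ≠ 0 ∧ (e ≠ e' → f e ≠ f e') := by
  obtain ⟨g, hg⟩ := h
  have key : ∀ e < 441 + 6 * T, (∀ v : Fin (294 + 4 * T), IsEnd T e v → v ∈ S) →
      ∃ s : Sym2 S, s ∈ ((graph T).induce S).edgeSet ∧ ∀ v : S, v ∈ s ↔ IsEnd T e v.1 := by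
    intro e he heS
    have h1 := (exists_inc_eq he (Or.inl rfl)).1
    have h2 := (exists_inc_eq he (Or.inr rfl)).1
    refine ⟨s(⟨⟨_, h1⟩, heS ⟨_, h1⟩ (Or.inl rfl)⟩, ⟨⟨_, h2⟩, heS ⟨_, h2⟩ (Or.inr rfl)⟩), ?_, ?_⟩
    · simp only [SimpleGraph.mem_edgeSet, SimpleGraph.comap_adj, Function.Embedding.subtype_apply]
      exact (adj_iff _ _).2 ⟨fun h => ends_fst_ne_snd hT he (Fin.ext_iff.1 h), e, he,
        Or.inl rfl, Or.inr rfl⟩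
    · rintro ⟨⟨v, hv⟩, hv'⟩
      simp only [Sym2.mem_iff, Subtype.mk.injEq, Fin.mk.injEq, IsEnd]
      omega
  choose s hs using key
  refine ⟨fun e => if h : e < 441 + 6 * T ∧ ∀ v : Fin (294 + 4 * T), IsEnd T e v → v ∈ S
    then (g (s e h.1 h.2)).1 else 0, fun e he e' he' hS hS' v hv hv' => ?_⟩
  beta_reduce
  rw [dif_pos ⟨he, hS⟩, dif_pos ⟨he', hS'⟩]
  refine ⟨(g (s e he hS)).2, fun hne => ?_⟩
  have hvn := (exists_inc_eq he hv).1
  obtain ⟨a1, a2⟩ := hs e he hS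
  obtain ⟨b1, b2⟩ := hs e' he' hS'
  let w : S := ⟨⟨v, hvn⟩, hS ⟨v, hvn⟩ hv⟩
  have := hg _ a1 _ b1 ?_ ⟨w, (a2 w).2 hv, (b2 w).2 hv'⟩
  · exact fun h => this (Subtype.ext h)
  · intro h
    obtain ⟨x, hx, hx'⟩ := exists_otherEnd hT he hv
    have hx'' : IsEnd T e' x := by
      have := (a2 ⟨x, hS x hx'⟩).2 hx'
      rw [h] at this
      exact (b2 _).1 this
    exact hne (eq_of_isEnd hT he he' hx hx' hv hx'' hv')

/-- Bit `j` of the two numbers at position `e` is the colour of edge `e` when edge `j` is damaged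
in the graph with three tiles. -/
def certificates : List (ℕ × ℕ) := [
  (1465004292253383525457445788553413272709221610875654679917209942535288718128978543557964329284702216257283412480645738669838907603895208125, 599581116761486112824502288350881370163159841768539032786876453771189380724171194245555684933184092057762154057202947974522068476421453806),
  (410285051477274595621226911887003876017238562179795947963397606942577397992408705274942158292030408545516227638347684011539909647802546147, 1453558022772928824965181591435756073983790440382485811780411744784582539298390652322586474113946664337957413495288885483259358881567997533),
  (1473682518983036332212721169589100695341582571103111009958454532981392841513523437036507865597095203292717112975596855849183466584260214524, 230027719727251922212388246925450911666875245811876748614275845516366736013336109106038523948233760624377923233252993893859168455151845763),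
  (1278839238767964494990918717543744553674175746731814710153218834571281528819320138999321901763160529227836515642622244664429625903494987775, 637209884331365528952581424603666520177986941986983085295719828888670985106870900507959799528487190634736318541854212281234854070039085397),
  (303034595204599042340081960973815580318023753488011788745419917271604474784730616457370827482287021963877813499267030478998354612289797978, 1278749207222512888645494752374017621006731303539704908112331516660742924938829800265440073849838188285457137362621958249328924353594654631),
  (1093163844254494895856082235633162001353693880092347816991131715919928284606545751632628519834449952698649947885321724955034352038742870329, 1293545672214625076512460478748059587061849327180892214518296265542949248800751132515453545661395139574547951770724385438639200934085787614),
  (582015392231434838485227206560591248851777944134890258156994574454961714724532349071658498978379005414994053098833120856269374968280664534, 1092667123272365290639050931677020312636859638188858584378347896197420886441143508126231844929928753761649076431029416118671425555469958827),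
  (1294121972130450428289073804561326312180021716023453040169019293446483134853081983694758019775057562398964950429718703247948451851498665927, 709320663058531153705605258424580896447596595730963005650302044287775970688446470536985176287359905963577065597153717173326638107678735997),
  (1395257580742242286359029638591706438720315513155428276014345104001012520508427138487385814478128013345168959357376989672329747755020845501, 1061172323160927406091954140131582431527796767848566781504932510294484614066777193170678670345250185616689832594790094285193949847171890930),
  (1238155113492516150191898223757440013212100356840794552966687603042615563107329233499732074676983343615030636161844553090523644290857433671, 718495688898907962098446666437121235339131786290587012101968176906552795943938292686719687210143297859540385294483512795435977709679824381),
  (343718720480047387139102454760120120780099143379031945931951148800270440496721521956960654568464207576683692980044722052904336224927350010, 1197463402654970455499629510540562905845586459236100981306083168642861114101762408086680186168182081060653070609992657735127800713953915663),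
  (1293849175098940817443354629971541521312165796378528135864282564049290517401585204505915879574132154214432685995777724541283723470672713799, 694850627923403530817019000034719485707081862231524725295201235911880789537686190738089332152374947514838137391327566194464839536218777597),
  (252866028596607247973996705981463330084990494397985347712296926125092840004900179675914437379547433821597636832035880524904954759212603388, 1471106433851219060470586321791759978461972288540868326970696671118116035309112119697972123048481056203954262402028686961241292905998412811),
  (1430416211019257758272678981156261721315358722598741291336404365669515166705992509762248226769895976500852965671452659749569050040920307643, 811174352940183232402424995282787108543460862602861722647085948813901699265679583508017088522719560818090888705910011660051595828588432374),
  (1395530231420059948230406343184532385707156498241055450347153303832755970101648066964324267170824051267478794584654034187392724451545640893, 889568781890138794937341914139210084114582957692266886187612926909548747901045432472008931118769797741235874878290447607898797614449496434),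
  (1486110272625682425524135387370363229415424162136474874233999326676190121000248480768432031667044787100255015505385831200329129220735631291, 787529291964678801120997328880385358911410938543799435840319007819229692859427481559386733464951210473388640802754065059080457655127319030),
  (833760673458244747260721654878331815138414640626696837734162143777976250397654507677204650998361965705735811215248021593441502063817214292, 691942507307830833046410847426743382812022743775622578251908018084218363248457937931806940032912269400290887192008659781732831742082856687),
  (712954530237303318156629681074673036258741650149816645842417346396407107008830876504625665955317622330294511612565583472747176166068035311, 1474014554466791758241194474399736081357031406996770474013989888945778461598340372504254515167943734318501512601347593373973300700134341913),
  (683197128630551311703128140044526047336181682522985599901556144570877965719402925670854686670623354893294611300718286925132345105101785327, 1456980692859664295949869295632885319981534174283025110529331002179019762516080102462933290642855517471634737734499019578008089861599887193),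
  (1301845345611705783152650167892545889590443096542307391857095547622897383640576296940068465588685448451054669605762487258597678807865194260, 232582213606453949026361569349440742581851454094026621206780870254255566707742326184404382519712758875333932680373914426794943794435771119),
  (807824013458572086462766789694377295960909168715794300777428384596830437392826487504791825385907422543333661693162146690296253944967460692, 732621429890462726619163692595995893819569900548430228543333845845649068736970309921758519615768836591859909962013180178669180754078359215),
  (1430388611391166997314388354491177939394401688254124551232863321483801829626366124544104371706440451301020810171178636322068461360822337195, 808289711752884502343378782123218506445306159272445727080777031596685065920045776428569531598401500909658860605839615958182964899146754559),
  (712334721404620008217331805042294112436208317749042698897416911585287503481604280459239207963805657865269191162464317772505968202091009895, 1439132063554858861217211611940864360426607121319035413363145942552074288259285258937877443031278513281501683165540906065394686190233321117),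
  (962331538865796722380750468142047646863330266683130737213470961824594033463070720499384412179572493755534107280938194084412873296881183227, 1270534646641560116422474273360089748773632152284457679692213096643864495806395195255419646035919071343047843217544757014989483776218740726),
  (869266461890125867242292168882440074569150197385156625668413640425855050529225546520515068588945855404135302752147912855859035617156380890, 648430569269808167535476791029192128171324934363952475362224986382275487952147202534192169573527253514145730455434911142464244466114424815),
  (712982129865394079114920307739756818179698684494433385945958390582120444088457261722769521018773147530126667112839606900247764846201796607, 1476899195654090488300240687559304683455186110327186469580298806162995094943974179583702072092261794226933540701417989075841931629508910864),
  (1394882822959285877332817840487069679963666131495664763298611824835923029494795085700793954115856561602621318634278745059650927807464230693, 851801649790907167854312838520769761086003968684115829970460063298627941216356511826184302057786516795804017342413364597451552175048077567),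
  (1301847469021800706585376270875332899573980819534728647502609077970218920185501343683337214320371607265339592660241449434756539067800749829, 296497571263993520867031914726479983549117157172363049454958156687125066187151647276565554548260220016131237647609837046230309690218117887),
  (992088940472548728834252009172194635785890234309961783154332163650123174752498671333155391464266761192534007592785490632027704358107873275, 1287568508248687578713799452126940510149129384998203043176871983410623194888655465296740870561007288189914618084393330810954694614233101750),
  (683195005220456388270402037061739037352643959530564344256042614223556429174477878927585937938937196079009688246239324748973484843957483774, 1393065335202124724109198950255846079014268471204688682281153715746150263036670781370772118614308056330837432767263096958572723966354411337),
  (729624675055604474831286489247052967655587682501668906858505571741495969357341369262478216006339063543409973458314785343086133925327666876, 976677589924174773982331801976119631063778285818191731786440860440428802001255569227788113623874059479810450642838822102520366706175527243),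
  (899053586535063558086810439560457855396204922349025667358329416784419065443204929315698651668781806855252281618748195007133315622135379931, 732264429721773931726518528332650732612242573486450262661370076799120319859450600747122123051480991410241838389589803259733452125108174774),
  (1302465154444389093091948043924924813412976428943081338802095982434016987167802892985454923580197412916079990055863752958838886776140988060, 267464704518386846050344431808312463512275739771761681857624816647959740046797439750781454656377979912333762116180601735373558295738468715),
  (1348453153124137790771933388301755749660722408524560200696148867317983489311931595365901676048454694138221033422203284465538278735153744231, 1268189395068857117981179986800496209036494154070612780465172918604349402251771723969168307048220513646830999466837639453503909418047092477),
  (326213107146278939826148884882586009638816175907613235414739006091898047632743405592721944094923457482582265021199227391380562789575669755, 1441477315127561859658505898500457900163745119532880312590186120591589381813908730224128782018977070977718526916248023626880260522660331414),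
  (738918789865066739912875172923711337357204156405335922902692149763266257093285281895182346631227690692528816634925481803393012999372425727, 1436220273071458594727487842390052172447638953554378819288872978401564389455461807593750492509405227035364517931413468678905582617580517200),
  (1331565225212957729965551591473813552358435050461494181478423629073409163430255028303780674834739749694860002858980093328096852909492273151, 1483170440795841847323368891842223683317811396966790744151942530513912343823563838580832803007133263460098980241663770034399617866365159920),
  (953384767528750920569670023300887292876905614850132827885458990655919419902054540986842307942178938594508364611232776224723142630344509947, 1291133161732099896002093256708566045201140131826100037476240951115693751422775854179305253812341599093495772259273725539910723456951367478),
  (530357095730620669603107688946297071874751362732784362888294873949245606674262931297543658453923659747236163354172925609186726459067072200, 1110242854151991116885502974117832782270979099672846396583433939547211797618137677085410882163278116057190611004795872297293011391491323711),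
  (1115209093771227424121371036689155948479328600180976230546265352821243754007959934342754210434912155094787122286113245878474148696087855415, 383718119766972859481158451149210107123724516735617634177607385782774382670776378277834858553164185019593697252806622484065099012949147343),
  (1453630567576496069284532754976363437354542950282173696188847031160981613280890589195207734058045779027761934744938843172543946912560054235, 1477840793143412776244745430545172495760976921388046442186008046358557044021523317031671682791417207531210222341781936508581394884411242428),
  (1104725296379613304936667885222494934954134567837405073166488541586631009095149628512830759580997533002910675032058836662219232705372993363, 1185648898016796702822218148705275630715183363009314576715999830819296893324460789359451661418538087583620027106571606879405764494074314415),
  (408291753367082330284126525443747186878643462912104848177871471861673156823627370406116599230617630414334231468214175764739637609960046316, 1115572501804420187964126435414883969827813575251590698549368423702567097420178198634572002378994171986079368904677705823111234373445241203),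
  (1133487328470125778840487258963060300401176289132513778843803164494001257924042983536065437511350340841443796832281946350145493595536228012, 355262243626550526140324326013938769549692696811561378908111046623037241332555296990876389795632249917898743461281189257446381090431322623),
  (1464114364968110188469235906443024450879736982625744853568623842395594358193700895025131184911960401119638381998993252388798868950588869055, 675910014893588932903685732989106972169518075114349499647615601322034533367838905950054879926043304967183892488016952113240694218913986524),
  (1114739204367817725044970344524928773347094666554208431701153053508337353949995857727143456542762863729865927300570878325821443465753395031, 1278854346325925462522364495287128895774793363890551356480127214684524036527946471755999357850277292287895169019166207004400335879508309736),
  (728904881876862319804572713621277498964244057688532564368027637841559912238439052680869649669462359965573564366413440139790835189981118971, 1343014824762329835027341495808198907388028952673142039524745594536337246251976125197202796077666022331089376018818868553910993708679954199),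
  (546652715098234689162954256167482184296370241837554611626965173146511113607654863574391474414023741012807772348056817879078539848274935908, 965217681451426210288160255738209841804253081083675084590850177138000626032884833777271654970663738448743037269488046220560624700861972443),
  (876382504644222581888785025007564884244301797591860989533428111681017891010817880618394187773984327814096241066365030258149818116945739604, 1394308772663526013191330478644429772644366087435877813126782362164036701894520125200537546520530975750786390041769898348725851407903639787),
  (623859481140684593418174837297306934237020070124403349171418303592032704830814371285320133946434707796743591975261930749229344039205077163, 1052412771110728031564350589663373311976241050541751351311093140718364843719868324167938737948141973869261459387770007995321064539249704791),
  (1476889428929898648383070454804394754231193145658990436208137440570847928270845642040364222003156528926043455457639303808377158739771260927, 530409870940551778934349248801463488091907875397625610475108352961496978498089444575602259254902614916835439069726358471710812323652286396),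
  (636634545102473053332009385658677237588476233157648931810931901767286274907959118300553171037630835603148665433907982168807088470620092139, 906912627157690877595014105475729827898630850825027462138585892357827288850118862793486117277001283818913005969479414353791182643988004663),
  (853308218603465089779776188396817707315467727137112053106632064927077296916964534732602960649725581828307040232933752230531646322137628572, 743013500674470069059146770676770073895159679891457930234791715418378966057138772767311741652193577694919805460893607006353289263993342191),
  (976848132040075065242543305965420951061601821255526467097171651536405797223932441174479335251506044496313581406270603764144390546225364927, 534072940119966837157124630825884235147285010903533248136125632347340854058069743135135205961494618556930028887996282086615427210555705447),
  (1487188651008867680578244743053771627808571053080493789995419889149534952287554240910922412036219147105427582832424530416407734478979484023, 1327205286882644877035869440956766670918724482658769382539606248067692269205220258383280684794380703023050477068893243455604249163569543128),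
  (1442013588088595629055282011321628832933231755797446511092540060315990240772365621332207883050357099382824987808738979049203408256146341751, 448368610320069985601853220168319934009850956370582000066074795154103944416887811816420933875115126608103357066125682479540690642419075580),
  (513094631665863077869242268090073993842342139039234517820392315157957774600991211858676796435850372935142124260571130635304682437402932936, 1115853187712194109497036245326615666646505519812952144237251975428865400849187892425662652967700242956902782542376739273538051896680382399),
  (1238532729206303505226885135287030865128400276696642994040412498743528465331667664931614953234377993010273769223433455740563423712096813052, 645864297278152329603315232158764364961480598942952067121763500441009643864663098020140447925156298379726660092330049816036327852047616447),
  (1022023194960347116765506037697563745936941118538573746000051480369950508739121060753193864237368092218916176429956155131645954344464959935, 1412909616682541728591140851614330972056158537191720630609657085260929178846402189701994956880760194971877148890763843062606928137668245059),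
  (1162393976946461889688901906904152226398606001994346035537243902324199063482337930101166524640072031325901695277420687908903575361129807804, 1454293957057559121531680527638668135687337669968465918428668321595240171422294443468172467293660147746541897512565868575347980414398496875),
  (716575490548155201697639144124671961647173618140038034872519876730419550041689168259269726251829479307693342845876653942539543897712866883, 918357500754111765495574233336171235694875877240582077181563270141959701401412606221943138917659071185279479516172371936538011528786345980),
  (1394918314234478414105681415091171366432803228549610157438324153075261314957074306530605933404387622743002683899919072447736656537017384551, 891103089278005919603542050624297591429326380810654805153446545889182311803362995979564005993715964510874107019553789255493304560643979256),
  (1098161947220188732303489266080442384666735393240870704503220076789279910588450795583642292831674053903288250375968922959126462241232144895, 604479956903134936662775556134427201330301466166206779302752264106698651288770844253962937512256345605061911470528024302718814823013941143),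
  (484051153260138677280859635937652821612976391584773912971439625979357298566952791829830317487513887890592354223378269397365394446487631768, 1481548368533664967423712710350541779952887166398393190456785045848017561020344053710551600217603254420947270009184451252933922868720322671),
  (1488524330622064994174979525322528336675092835473295503961000947427801412997396558250190074988580075728399328200646349534496794963292997703, 81360142529684842499843890970140536861432223873908543894129413657068970876274720251777294410938345812622864070452372575483077681720852477),
  (491981343444760964168804201538947833698536728075577228882594521091528757804739044037829423339269960129208939035172227110972307070387205839, 1371815063298985796379878110486358745306016504720573999253694617746109600745391494128625004867024650730668192343713489476738543036292680177),
  (1395347013202020574359501602877061581079976730636420448962728015879073351058806844229303712042207806731669049926464435361950454839980851063, 357558768086401257720503238798033750836873643009041408554306219865371695386494798659551881965510747170295600434231177216546089759726876606),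
  (1488524330600197242070625465092954287362858770382656402487407489928722648548281426446955813223162074752275266808967571126661813761854125639, 267430766273746003292387086619921188577022114283813969079401435166972423660433456167104191677004065586007964336456103799753224194218805757),
  (398804026046584296457680339323055127415654688329341275357915047041879460315264461820177322158315692108602722152669091825876294064962273279, 1461943065111641050807994262664471307565868033445801438728599402444508872471452836621072695155531332314955828441488560901283048641169176498),
  (1089803058068024285161724512693257157934001554663257097067661318873296415248932005676945408342097797676005299537629602896237288571724122552, 1247757583329418769589648967824874076569624865645639367104983018232417227980591601155901656891040166635919495721321598048686119179947867727),
  (1097733248252646572049669078294552170019561891154060412978816213985467874486718257884944514193853869914621884349423561320043848033441433839, 1138024278094739598545814367960691041922754203967820175901892590130509267705639041573975061540461562945640418055850633966647730133826273233),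
  (1004760730895589525031640616841340667904531894845023900932148921578662676665849341314327002219294805406822137336354357796220381192666481087, 1418519950242744721202674122823113856431684957331826378263475121142582782077452405042246727685182321871589320428344710038924026236895231683),
  (953589270686672486144005606137389634184951625878709727077881242126539482233977388329322847306395294598032060693570147850669497714823135131, 1481503862322827834467520812569593242816354056893954079847025325744400919581503615591204629498009211171304812160051850678753325507000944743),
  (1282122907799663010416814036938602202608073545198325371830069231336607231711202230433194279220566205858397335044491582869439588911697381607, 696105366509968892060846774853519015963636361223335441812433179382566243550965780788874105928086567527329878951864945032456152110749169624),
  (741419236228470327129210674033274735919489842298219676005033382380751810167298275181561417196614064080453892761204529373282158774639900540, 799522185882009097161662729686154313932524595257965253253525350716931360980008497563999808297479785838248597387349469104548250653055516607),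
  (674300224174901644780573074451559512450476851113223736754051868665598388882371560283685568467998571444343802741894208065307014395615754072, 824458300122864897209930093723967124129120989557621901317756256595213856878774824832802264345136418060120955394142734557352260690786647999),
  (1020708282740241168492643205719104857653964617063705666328862755841692903518904103227198696035010787234142150712880369988948501831297793983, 1456567748081972034419253448531780432619757662594297431782794419866118423682737288322402173450352578949432454153258566336483383990688958567),
  (604704777818051946722343629405001892939193637471057099392654484482247481165451411392921787390542280320484897032654554107702382685287593817, 1101842032682760201326236612301367577408464983033690951461455060250840786578927830119763104955744733870027398175027830252005365252102291390),
  (1280942122572509509760843947490200747058549753683045408604803389289861756564602284716671319159397244301023975973810477539471332124001323239, 719388496341102973983081180687700884478481985021312317152656208590822153364298121482937878539338187033295441820941201866177506779731048445),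
  (1274693388644107304918017609409712509753759484750137262541513157376183168460308224666212242139179414301776507117188906147240377412722098102, 737265103937306023817979336847207953381295826373743647549636205462548469827911022250340377227369267721215472268387800597104632884877066351),
  (726834190208099234728505972313298801103718508343263969892545614186990485852078556803623809587626111717583390321058342586673631477691823997, 790549925057371628071033947490869645540663105651367132945011933815414946290533454145348143679700420137984634087155373223447914004558643098),
  (1229588941766465420468881139076862913954831887968285138691575485815215134741495233913256038100938665585157747465326267756452254418317887682, 730013741575462161199742921086616494552094245129590210185177502162365154139207151476328226593522565449466200258852325255826430275558029309),
  (1021889067967394669148613295167506313203488408578985629554128597888438378665504048943721656096179748791515509783566754924644606882342764479, 1433284618250837952497019042697598564104912038796320556442571390657862513869404947628338400839100959443466891284182252834364234885964515394),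
  (1255973372661361380951203536192136592024382572919842569975538105544175681670943192171309320601195822213671934830527616869641334304758824947, 736927602150572826079635739697518356481198244113496471466110991626696244930038224786688118985849524165886706972510474066998720826110396492),
  (1003263154439068141928523377683960969612062551639690795069972119676672183687652644270087269179469510848626443686922398810060780263861892927, 1415699362762475184231134419672354021559527992241620306750042160362393818232172519815219003813603810773215897161227599092802888592472932339),
  (717894887614376300810303403233169011076069888815721409867473630623050658753882057502681953942910231474584909981787234916384862601991964876, 824504449801757813379260157739394194671788777020137996696830703854808460950267149342171420924122229597780684365528191655956118852222302143),
  (1255929560299528362598178842787721834589829001326633760370638821553938218818475272192469751629047990195315080934200832948369199401868984181, 728291958107242251245760014362597841807241463762409065877464833253434338768787137516128264434429881552217241366371074663122173121947238334),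
  (979738805824974115609616106883855244768642598157192528932412367918971032274236426591207805925765678242757460907679170781722059213790791823, 1440681626682223900448731847725593902298792174003793050193347513500270918202431171593390616440246254532747984139096836634389411722914936819),
  (741463048590303345482235367437689493354043413891428485609932666370989273019766195160400986168761896098810746657927859852853823525414221818, 808157829925339671995538455021074828606481375609052658842171509090193267141259584834559662848899428451918062993334126003514125822856284237),
  (975603835862599284043506735386255261855037020281853542478925084280724869800091112474242491996770038517523391061639799490215831461603330251, 1449316385720128171801017032771188973790556081350143994418335716565935107994033417548390022816505876677683182142481524178460957218946678773),
  (1237347459133034853731113618708591248432956715980547735491381627332409486693091787497674933684485584270782868732717856264949005161861199731, 719342346662210057813751116672273813935814197558796221773581761331227549292805796973568721960352375495635712849546148918880457499221164029),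
  (1023302796271242011987249581420734771214384115115634187649060775425093518275093111705865376875455657394220421108439043439014143136611977421, 1427511232130561810749267093605086915358000603309717812646058585147799667226801911867433909234811603709723186900092509054728074510102167478),
  (716481159310528957971667116979940553065174182279072851772541453086395519144292994740538233163634322871879998651919664915367678597836832702, 830277835922033955127012106831905843418700212506740740493343509364871307592870185103075912528411585331524388747151726763578435711684051019),
  (744279318509272261292625800348442689145620573767278841151436250352011205683330015760735236443167388103099097356938043525002340596264730621, 831418310376868478259152976350296056600892776004044257977764193319139551741098222652531313316449188314201191059340614212334656870798084110),
  (1212365569853260466220545368250842308144087484368192101653990414047815732817618587077812180679358011043852120750540007083706430526091951927, 741462352658904340945224768483104828748033034456484303424753761605905589744416397242084971639864532375242038565606578480740669003625641979),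
  (716441123519687936060210857480204070218154117203597113610196112711297628628153280437281789875232768934746070189174361705308073711856778954, 830319506364818851241596179923554874473588592281019330772043901447881403266238351385703551603963361113076726704395737608800856377600770429),
  (1285046419541677581674856464743070757792303810814328380661517318476778135168093786729297818563171203147479898869267753061937386767056353141, 697537193072643696762001177506171755503258719518370040001304629913092108525574291292612608378658102527675717441273168530906617953894006718),
  (1020486526352273096176859148509981575422806955239783832107557191444071585611529291105531126601050165389932070579955100178426758933115830474, 1404250751679033004485652572275865687363589202914726213510465900918853382626963274049462258767261843847440058814897950236984149201223942133),
  (535222316585857661049734828715424992472750628142465544540117375259256455662141926510280422558234551190099657395978567373856169525667430332, 1418567486708959924395549973780779338934352767265340768357341469561232349029268583597669098234229899857379551903536435476093780619635457739),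
  (1091484514324244367206842740214063932714771622221152266915525982071789286382424197834485437173636039915374416126626986629881069695808831422, 1155900885690942648380712524120198110825568045320251506298872587002235584169251942341377560228492643633560447235646632469345454742269085763),
  (1391986227015549963665143879937156737660284405207329729039257618832441481701193098273620600549855651709024402846422913014873958805797863382, 311770679201194950797691727874848240344649181473788561140992972554839674566335267299999993195155774231667144384828389900379984300427163183),
  (1089803058046156533057370452463683108621767489572617995594067861374217650799816873873711146576679796699881240681252024188544603341600044984, 1433828207073479930382192163474654728285214756055544792290255039742320680764750337071228554157105886409304595987325331338991601947915601999),
  (1115928711423844589360841818891835950476142579410307528933414422128187266745521060919473887503246872278131847020739549754757593149653122793, 454045772465924908412309797735945461975463862184871839183721718967580143840520869972715390358364223856723070718231793700629334743781998974),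
  (1279187311059526395843961291656839373384594489830056987822574859260749542642424483952946157241949686843757373167886391465977942192433379199, 1430418518976515624638669587696300798100191513001524351350914240678897493830813515845131308435282586918511141350005054996456967971553673173),
  (195517736550849939829654873997741916935180607049111466473855981029970882495022930475041625588817621185128043506294588073423173676445972472, 1479298267374067917411285234922718044356584964044429888786555960162546138137920062540915440705113459197043690845609925850575438552315723775),
  (1479660999710433058149030532136664196816259664318372884115166550479006024462683251132140583274287699476818831521309145530549616223648218999, 1092985137374284583632092964751660981660783234277872596842786388132432693760525292561730124759750209653206536240906005636389458544112453770),
  (639526416764751827728261519265842078092457762127644562474540994559807399026233992549559464150520943278538763874344757470930027898501876119, 1081631053960459360321814756991478668699044766737145463681997672174421787167644517357171406637081434647207111172206615266442423821246903914),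
  (1416242025836650249819664995202938949456313564765881918507376730061000503021338292844038566902727587699414894131964991905814877101122107390, 453546380831441016713083415960769155516505065266194528519284158406645160827913527053460802258413112415026807419522249449822379447620206581),
  (1407703612389814439694292926072637403621871088424512776495357804061052689315052023539834790057359484684595749884648231699442777860062838774, 1104752260021194752679420338976478046126154134074292920136797441915384707388769805561080769391608192453989319854337220315561909518321319567),
  (81228389167722515721334789769663426439941784290999972290440575303891996628456349967899393546560277360650414707195480749551040730589317257, 1430599896509080223344853936396836435535226713831187649550913309304820669524039074328887616705412242468649944838838009729545890279072970623),
  (921362972113403746142103802640485545163743686481728293931066131223090622064905608550480512670327033558930847437532734539238260106258808425, 1441953979922905446655132144157018748496965181371914782711702025262831576116919849533446334828081017474646773759108132685678659753773910431),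
  (1488199413157268868274402601266965742650702140659742026127185476478953838168969520436344360119655802491639395537298161353851391772297508735, 441779258184530847665756041735952091051134165469774205225273104623693147199669014054110157626555129614243374768983717917196362161370188272),
  (1293188006148099746109876250317835248659862492011552174648508830344446303159327688490986739779176143285675825464272940639902924437293366831, 232447121357296335092656087843286851730887377929448708475907600581175183831335269545221507905085465632058254076167287796755978679524280788),
  (651152697689715175672346923130202689297243515618748324145105206003998674486728280736250693643547294325272771937190355653132204406952952310, 1265062532420353842670592711953975232751271518387687212345346448811092864514041540481117378117348630560850708416144694671190302365155590139),
  (1032790710876990901907807143661228634755409005744954276119369819495453546466421924716841110300852126925971037175812712316122312900863852505, 1479621760937155645926781517312004488230356117058118854091729806451630475767101083917739657701141468343943172225803073382040264248150439471),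
  (1476933180209243905337005354666313387034744012395524010655087447617546223117974596364138483864027999837254098953652991744394864854655022971, 1273283673586391677109239382715898045208272790281229650463471244152807036205821604586267235847392590184140115974728356976855481675774183925),
  (456141290680546053507820572181072195306403866970558472666428559869491139477086448790893073303067635119213144372282240628055922889858238630, 1055730395593119330097492758061309993431024730847361715595980944768574901145707795972228728395878966578691549207620938688892571364955783135),
  (1044056943825015864845204390261880990371367134009172291591467848356861161517416848789046986556479929580457583548199311064335184496926130141, 648117345535294816483298176332058534073217492246663408853531666922516586760948493385582579480304007773719316317970740181783723465005577770),
  (1488425672015856137750499192793689407117471914314591133790619044469481338458127274978050178355581800066416939106913103549956536365716883927, 1265386025983441571186088994343261676625042671401376177650520295100177202143222561857941595113376639707106344985879523576717346516167013931),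
  (450458204414436137139548646396015934916262211468802950760525687473045535419490167843452611281418122361598447064435804263515855719812282174, 1063587851235927680734194110824905174516291910247920298968321076891031557875138063644141639425527839179295691852671008166594860086775007733),
  (453499090901146794634895572144793218614501345540434469484211629654658568051904809484769866162969207575485249178819458574105553464203411743, 1418333382227686162598300180396843064610897017116090015592464694960933672883187218410282383973603148226170238748385132120277705723035516913),
  (1038247538284513548799982477919561230678780887591860690361839123901371650234860451122575754086575642107206367333186212161155577359926034153, 648157537495436571769747211941099721571180431725958298294142483852689764094117268441995309184671085650481251660715733072445521667863609310),
  (1404615744911686901875579591338578338251527811274778156836812518616809227560844004657347337409701236647371843660905947080121963885048627103, 270114902371546534364305460998272591464278313615652779855935381769974083481516503929514830778145916501385806324013437458888766151876130404),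
  (1482616266475353821705277280451369647424885667897279532560990320013991827175570877311578945885677512606291849350276048891702023948985190627, 1265426217943583326472538029952302864123005610880671067091131112030350379476391336914354324817743717583868280328624516467379144719025045471),
  (108212007490011954687881082505796448017486595772401035218638789393910819293310199306319459309691913011830894989230135173692172107501291693, 1392077061927219195783099206518520287159593041620236563308519639136251813340321022057811314681027200078540732274592210005600436365633257434),
  (1485384785529145480255152267044912123419232780242959615066933102287868305825712633336732923474030714900714651839732649632129844556488245238, 910640494991683089321982924771323786530437564533206461026376677030275087135173407091800850565301330575161206359930783757190849021964451887),
  (1383534621695648388746996967558558001275795637359894124627411964162119398993455061301026160939852936645605389602862133976396624571301607259, 674413857795903538584948185819422499022484407221811750578087539677371623636983464794466378477247033883181349864743271052966442883207921653),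
  (975643871653440305954962994885991744702057085357329280641270424655822760316230826777498935285171592284516136099197162088221470466324318655, 1449274715277343275686432959679539942735667701575865404139635324482925012320665251265762383740954100896130844195141033647521578752222953155),
  (1058417686890527600117807506186585121235462761417553224615868002023341582443819417441572922331104934074304875806939868847992058510732951272, 465081841777830838729545972421487105913278733636584959880071942990579243114019860741775828651211542971165015694644990901187912530753767871),
  (508782249289398525946504055661357658895333052892728170678093360897171704269957753097969143597043040790776101566330311840031084205473529783, 1014853437750898136216189540237494043023198380592470916539742570007998916563233390486163294112436211555808608812228891253977427073795358794),
  (1447862639073134201566667112937927338394375005242742772127333303502655234230990849740578273525482360397869318037067958606076204909913440125, 558027225284874682988188204595906842325727429868057644862775384917046224922281229408452990843877507772505153188385569471297722268713484223),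
  (1295226603181983227481230335263543924597162682501700294515151195145820213742917816589816314603799730195395101533764436293567078882581919615, 649926412110108157560363533983971398147135915082350155721933922128662853979126463486210306912800357371634237001904994051320996890190806972),
  (603588576585015121993015445696821379294220607286098021896870793478024081309321523091508645947657846936147510184941930384217552915594758342, 1071229650075681721740514042073569055598669465055988984316983420619215089687141679325149778284052311703395995169517315481234318956680951675),
  (1078316234947807474215784536148901268821131723587456458500961867220054229060238554262753583172117984683081741413052190430976237018483261369, 1255975352529015944389152741051726118966709633236915634874066513096020580446209751132718458526722884572817314857813124455214974607351105735),
  (706260939879382290253836986959730903413295245516225199756562236042255550053329250576763293834604261282925781899327852114634498816803339968, 877930287327354390443233823445755231829711396717039215051414609232310657812686179192105853069821062712975241422096913804965401362060804479),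
  (925680199056656500130347758474517855023919400846413980888779758863219208572165521111991624250435407564656764576148968404905870346992727995, 1347874539354249418961328070439790674788118118451208145733225050307637209503054985210475774595645745060982140141363379863225687045411195076),
  (1203281493506642810691672696780721431726332870148878049056133163692217491688823971395473996255722964305635586482599181702968295408873223759, 741871512243306665861799139447722163620258655131627028149169849684957147871798339227606290473370252172945873933532103341703961199123628030),
  (695533686260355538782573084179643872165050419638920267355888824931626803363415368285850964295734517546844287373337415229926255494204246518, 979284549942483213439078436609818290125546725006712111889747493062920795794469803583753794723482427791120099707921037018838792464330897209),
  (1096623507520011966247620591668419853157785459138299651843732314851592420003318726891871810874329065954768700945201611641368383763219742410, 674322663280810094504278386098705246432111494679216202945716551618187507617696402368215195512920495320359255312288191579701970689383727029),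
  (1447857981036447828530338137123649506157931600830856620327452221924149267052707815263393134985041334990897619443016227753577798539874926276, 185798137675797829924182026781093520551608017781565089468922770549296665917798011696157934642097990777213790882430168527241394002906298239),
  (1114067023155607814755175451151215890135063907347710867896042553337340573420101168441283322610904828892863207137961180413552306119906445819, 1310851663558554883969461523219180825650268581438027889555626970836501718722149956928491078314591509889916381453806160838267232667496873909),
  (415206410522750180404516728834401176419519505196687286689489080582408683639668910239402086127625916161685191508422991692647522304538949439, 1480481613480453109796386767108992226510638414155661795888434114458100139472529925319429530766884670073178207999083589467857061077808335050),
  (1371725657905395331495905669779489060659396501344226952391158180095134399839201413954237589252208685209059125444410065695077627125376745853, 1287955313683097592969562390773067283257205138103567655427524734217712099931548101089700054098207705926986691379424560269443576599800709119),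
  (603593234621701495029344421511099211530664011697984173696751875056530048487604557568693784488110712808358589753768332819556155092319095167, 1443458737684758574804520219888382377372788877142481539710836034986964648691624897037444834485808047044627986928138188100726455805725900731),
  (1078356091383174758700300421960046252790084666287613368121147842444311140024435390194252429311293307194839483651367979183506607028131837949, 1302492720344262373990738688734273071742383468314023589974827761972926516183005487511160013862317244036788214657704245671820200552425343174),
  (1295182088709929569960385473638121108391766335389657233095084138343057335600437946181132329924182694906284480405700720671831290331107688066, 231179956685784874894771408486611123597342667918749645227320058884007359237847509395473695375450273455467086913423831043211071912654387069),
  (1115561159488767418501199856812536704106746880061194545103558523540294055362132756759161273836182299222258815749016754016211650136428792319, 1355915065133580643153606293781074539846314916149984470017706233689855498724624868966367278889134101632266312321553967228271289431897407414),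
  (659782898052555198243182169177329250851118235878665857960808138814340459003552754107321224856770846285657089817766609559347482905234374580, 924408238912944273858769654442363583441987776805599857208187035322439657518529597787981174935613802474021033111928000635786534404185129035),
  (310223668099480922233739173691656403661352176641370589426741537405706788672838533808708624546877549175059886580959362322599895843613966335, 1457996144345923355825696517849588165857967207352937474258139062742179064943082283458904794249817231801036122402280962770876162131573622914),
  (1201787357173483206945648291119400617754649897435394371848617193489264009746792383077596045031068433932937995395313615605651562459262072395, 696808110668280906677654368885828449424212320419670447687090586831603367869323427189730089897400412737889983184726010982250409298340347901),
  (1465301496672043677037892996606445543135210049040267836379762460409897420469490256812804646723045390969129266639793841982005246424889969141, 822327137953542619389365163901569099769765104540376776078833189767610877022251566256433817443770399143345825187894483768198696503613568895),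
  (676555352113009252124493893878753072109055103184329567028052321289886706030059191274693971964430888741846557679913028437899999174660699851, 1463807685654501616981222572305442155616617097367932642054544060780783318452608398683476508140350731818368978047901834995176917666361245693),
  (1465120389441841694510642852298209551296512939298489813637625124948927725692846977057773874140277402581238056969024714502070663206494292404, 822327159700601561186679430373849957430335485602646852967754206270116091300072183295443659576357919997957182912259291062631156840891660159),
  (835455673159954877054893570932303949306946970892435394247306409605084092389571725611610697598885805515915235515512518303494133980292185983, 690996569359702645522128314429974459665562430404675279890685588792999114359797311965158376006866912720557127539105138757949653763552725122),
  (1209091548277552204358693683016449567888688287969772940969405552482222531699994504834899134611199094348369593185600697312182272603577141621, 357422843369361558328095220683626306270329870687070626559567208060879621490617552919224475354732189084953861948067197123005954365472094142),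
  (676374244882807269597243749570517080270357993442551544285914985828917011253415911519663199437325560369487783370417053766495726275192141450, 1463807707401560558778536838777723013277187478430202718943465077283288532730429015722486350270083757287568416010150070350710387730873843709),
  (1155309315346656114934993473336998965192472887797835030052863096261348918697015886608153976144043631606014517806024156200613798966879827775, 743286062253870790093190199882436801036488700508231089843863012921732367575166845785605411581932695525278869980154779692985660019855851209),
  (1203241637071275526207156810969576447757379927448721139435947188467960580724627135463975150299257919431332776393656303457931896632291360267, 695354144428060236260213191765175210844584820054519073048408600808051212135002602849164735137775892708974974133640982125098735254049390591),
  (1372225879034052214974442661768616484602406672503457815182085032098559178712709572463602624256855545259857003655946776559272926544851369855, 171437655134099943397481546392821163234626726851825640941138444900192978208904552279496152510240378725035997520892144639624162560578683381),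
  (678050889865633469688379264972877655116082444561360100667636374777419913840787260979737954956694054662885011460180281553944528752843180231, 1209459270734062605563887350028248842496635735511222345685216830499228118905699803608222493643301460647925688490916150117248884205072416696),
  (1185836967920742953432739633608220266565940242795126540294657327965077896815901910029820521644817374039028327937210336402460710781155540861, 357327019904732742966548190689422321297539107421745638338729323523579158907021213753247048390589236198356329944023116732399299808970408439),
  (1113243556928429400568911418528168651030492326018768133950690153101400713455788722934520070775818229162227244611087728650060037876638267322, 1410345124076010475159594776391595408918340170442286790889037701821091246299756876582608995843678318366989597249587667100977465633032633935),
  (1090211854852312357224629720365717507348161315401988742915520432414864205255717351299310647571289817200866916330533084595000287232935311290, 1247484983199759276531470702390564830422015084151719403171043329496088712746580503550692916289496371354591631313297851749818104542713104461),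
  (491661978752324208146676236812481437079616014853028825780208670643938631943979598545955857094536204767490819903419547725052126870928115909, 1395348635504695405132953994324850000559548116081142343082807709122614299603816465081973371985630670150411002469829129614627785582273626042),
  (1114920201911255600660046933930529225876216777137576690332411542049903616043160072394594847441288538587126070460415879801228781001063287287, 1155996687408512521944945287642121238137788427523306417630789455037030832475027664468345098294850176462065160027178430811591411741120003594),
  (1395257581110169258318724359931067628284737683120237206217254752785095686912780944098812103363821585128253953227446272012158179027974094719, 334297796010351142025605620393851741730951813142393028659132817225195511762080925311412243756435424384657309086660621721047680898358556663),
  (1150272987363503204969631934449779504969057761307252579004490317080726111558009179649627744083345723111607007428808948868666762860582385230, 345973703462165390101610775332702436276175405709926963466363324171029472341391710869446560685160764050617837783044095898681390027551801333),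
  (1459079657223841038612526585874408290076379105222410221996070579108037117914341710954422213006414657075440126315937639892923349726159456697, 1253575095600566252271740423504721201391497464165255233650193972659410932881866365379500588372281511001346277323610601455103157470408736334),
  (367778770127461580107871796785078777667078146845591973912422959655135294640127003340029241386548708594343510005324732948960421541843042295, 1377582615652074181316679118271842935044842143500072577796426559013458118889219817695131394666133289484919173392611567461973180772845093307),
  (711938225440047018060351448728957841867240474930425505576081996713268796511308641899855133758024397532516016546535115027371177086935891897, 1475161023844127911643474254134442898298551180142021393815831076635838219296058518606286884743564624024200290689043738105484926502133826047),
  (1162665442039959866111830479490569744808908085018729388563457043666328313153923854568136279656747151957858588219330933245127102742862496254, 1089489794918979269222166087985332092857699088815713630939072639242993035618688200887956491565716585536734315072294565379201030591204032069),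
  (300182076665335425914723454059341087828725259162740365718651520109279881543519858170019597475671349062250657786436690999352183482723842038, 1380499407395150797793693860273676689269962522817685490108812266221838656739777139412975941186999918291218816807823443446247945637854202061),
  (1203283848203942944511002239007910847575487181710773194110356493242237347442342735212014115910866663801598862860644108671285497258468984969, 1045919295399827900923748170688780852772134657407840449944179992938614259957628627206948606477215678676997723762932998430524225761566523254),
  (1473665489845527453264304624042014637308302572501741215083975842492381295126615300562053809803097312740563211291797673987992813579156848511, 550712711919827124972588286146809030670417833149728834859991596683445607415072127324130050816533938055254898756210599357991514072600786875),
  (1406068796383401299071156281316276947469949684818889606890204402946525882030008155392053519502698870987146862655839016249710373488312694654, 553629503662903741449603028148642784895538212467341747172377303891826145265629449041950652094574537348142692999123251761272236138825776845),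
  (1473707700978194871568150052080349037126409826763793269758385147266658061844330900310134679406963904092937169034848516378550611646215113213, 901277862891594789636123265070414672597967670503050211755762988814008655237698151681836100116789128104689138575530139025186365484069533490),
  (340800482829318504313895213576682190595304355854784171265550969685188915831938738813997704434124859493403050836752865170923132218238828161, 1336928907875999429495275942977125449184398091409812309113919619917459881078717565731992001341325040944894074670761100078565183607000812030),
  (1386447395266990383973829384462709280700638227470794540667878673659213583162763012558334598038473591390213002412899354611768507232661031041, 1035015827282455040428183490378091741951140593337860711581535021170424568858641786906353782277129972638704299480696086762675484338214123390),
  (114112242352211301700589256674615735066374587568172239243685359711497768198784145815720272091781037668909207741255734732209728262745620479, 1394990588101066072061326457586970877815319391134813006405625869853147261395542502973138374168870739970486628064178285204720717558641084621),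
  (1476571777095604138015611675971941556945502198336287995001419822473187172750930735570981483306362116014235045237080118711541204726763730814, 547124999331284711200520369144203952946055028902581056925822964820326693858293604064586387277574851927692360954391892848361526373950422963),
  (1102527747234798939517848388889738986036366453426099880773444815464301414447245397474555383056776439610444456992884258096546773156285644359, 412480595951698642824389974989491581556264744417519750158080139965067269197731174449835167414294354975948682737927961331071771177467772858),
  (333571722191172824079248184801947550119902493743746518540160502763361026382478771665495280985414936382501670542227633408807541723656880125, 1302040603793271828805502118226702576451997970680869711464645720201493575598177663070788992071361315759986693140994236861120158203178404342),
  (1389311471384399650421291008354301800519730599043289265910913348865742694069362847812524624432235598583016808715946801428415202251224626690, 680862963722144961992580594451881022299227951737391556751594997176742607479237239288337821667482752032528348345982685994041275667003211775),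
  (184615223064414140645044651330280344541927101085570627354900779238159058919706726005782773809548006432507255441635802356270460935811891199, 1388486083769447041812243798582532045865836207570052316159071530781647809988206657971206290212364773789479045240443532191922096241259858355),
  (1435957643750815911451855910812336844618633791907007218878487502177492635768242612899509766593518315414303154508003840518256419182454262202, 1077133054422561212194347972267552438128426245174016556648803909714753568242891645364082559411125164068189896928890025509571514790211204685),
  (1254248221139233349189491123953017222072881920588218990461910004214794803660636274518163486695365250755548608164202342221572114450166598143, 994227847199389032891947604430682973961289090956993506696743138465662341035062991584951729984731496744368247012289341960596294400624014857),
  (1356558547899575771593129754966649383551954120382676928679595574428246829424528555149125682262853240491873864504448883161780064949758834245, 511512276522797569683438546259182088718252560631185902105108415347497145881379590608789694100085626679214346329932707114264117239334567934),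
  (1488250377176976884675788658970320057400139631833673226319960256819188579032983235477334848536358852728396807117805820115142946913630832834, 931804748667663204791337999000127195224028342186153973604475122720672580939133385087684140070281553251617725378117248261651910047771375423),
  (438646023729190972720326017407190742057514768042147675261051538202104473896989883988384676729668467843964415410412573328870316288189118461, 1487517764340545968671292369852222553027824023783718468106099806164077686671855074130160816898156045492744708832448277975114442303126653431),
  (1159759154789883181360523427560642825171708459184182608646013063685522435529608420344599101648160746991545440529163631861873362640035662335, 1093077507507521682994234004987937170582061893062861408873241271106111949175466724147308593162067435557002059495719483240878675899581445709),
  (366324645675996702907409438189599967087678972404358855771478277200856891027313065895104665919735707715875276501341537333794061896764096442, 1471391290992619221114644166419401510032973361787075366111132302030739037196035308415626822714584285325537564077971432186520986759328713207),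
  (1209277466803015820944280599672705808974665079241276678651279619692260959471873762229180310614292913757463204528208383026129025242939522943, 333843936907263287743950803606363001930664521808487636937511985602349724442027746987525759074985816312960662609673534540878777997850556407),
  (122794176380795526758779371303790654351398225032607346699658523950765719285355245167946196580282059113445544753122003618314788929913468614, 1389258523103888429392684273210693629590065736067606512603657065959292079468530603253165711594858629150879702088995041639606889902038337977),
  (1050235013808637966293915640731755773254860613499433873331972060822605471182504761727996118453352942423074800080475463663834968501415575359, 557808901706596650227399948256916824460662647405382333202408926959148256501489434333914728293470418052784015338221587572594160640905445064),
  (1451047614248925939422097451359023780453127581786713310495492514957519197555556435166694868472407451611041298002301666067895373264156866117, 412662616214664919581152145701927892097479758525317999928610282707047537740975856673316826306913270777501597519825537311591482263869587386),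
  (677828011584941262106706913727099497475665410003493091028057870946811787156766088026682650457703349914278479362270567081358880588175507151, 1372223588145684988830464394035075436020170058536464745182373318286930189875279737040533374200441684077483678285759896574982400690607882227),
  (1371631952400984939286374619173203211646226875304352719962326851617701547822749238374976364194229841674719269148340551630292398301327149561, 1056050956153957033208300419190158747159218980008936393284133044723340155408731495255427440539913357976816774420250997219131825647781918582),
  (1482705285933025357644876326632272706714889913038294708250998480275431257004373717979141016896421091702400211773458098582567319777256144703, 531821935456960361089045624708414195963230297298711869025193745161266289235215594568229859215019134663925269344694910681644789871880961743),
  (883561901138031189785636796279054648492169311292029304628020239174987080103162708913599412903850222664690067141777807323023942719578832827, 1461583311000615412541604561473870126248443928228772542652528040499952624640645847918058983027310004944922845438434821182143080199335462981),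
  (642521899327848694482296069471188143767218120296512159789471101711392246453759176706702268641609831094832701476503086385008635841416808958, 1102885487499525491567273609933468554366591326621164232331845532636898361730856139135888851295906178128143459879674577503179610095324477439),
  (353970320061742167553024626678473423819277074170366181559488777329295132666844679471407928574292507178008660528797447727059610736579837887, 1299179832046429822139235765223204407274166856810395739019880822005989704854133130319316943405276414281161728262307503065864890948857626315),
  (1230586924886050730249229992252856789701619146583135673191827482498022796842975966513521439834562209558698854718628083775316363725902952139, 1394757904242315921814420751094002827989270574039664164946415723513946039964417531238881600297227401193417739408901236440386489491927353652),
  (1392574169767012925887775698177936359191618792621752920161667596016580594602668496525458988246649641534822161390058388734338233358169950580, 283193678426060079736373800792059337449077582525194870946687310323962779293911163005437410118316329441380409202032303279568519901667637247),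
  (1344465293105704309564615828356513949627550584662019700750771376002322764300396654925665694493459905281844581174542470668880891540802633722, 1103568140353827743372218463652272523299150003709952846080721104015217446128302140202145430265208358276549849225359596415438484930796978549),
  (1104022590500906398958504255385221639243677746495606941931685271634483480815772479077673626567501050182060043812281755410817710370938945333, 479488022972964410308335956081795190356653112714426377634722599693054122417144766861670509490246932617905466194397129361421665348647648971),
  (528643531108195115166910233367530983841286682217628132230527208207092278996295904436385150740410273376239934211621861112108864016381640911, 1394075251388013670009475897375198859056711896950875551197540152135626955567030986880262603968120273642427973079509539038897577991361003454),
  (1360234791834662115867163139122181317625490599772622136954136522275645221831301346751050405473275332012095675377990956580277390473013756102, 550669742279036319947867890115450555212035276437009619432226094192764917309806411479189258373865930447311495891737253425265296566625763263),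
  (132919112279689555834811067741063587787476051712473588424673263127506428512546118790884582135278571611547489183042252624965234080891273151, 1392174399247495870586996374027647698001778256622348951118131604140684644802590530637986139203985020198461783410534346196044601964282005576),
  (1483977510600454151988056110246021667299548361890159049534174070440746873768116208227980679226848233043690951905425950652504610009604161401, 1034287273188273633155166052966168319498701480315896204362626157510448962000080951826903146145724613891110009196994665194447829739897862135),
  (1209235158076271265933735166016591047504079582708974313324103334852763516210577436600395483578904805218567081291332697503802094944566378694, 1462260641282105490985814697324963491587911136535957286333273165706462225427880967335335773434761390856802370679145423714556716084338097983),
  (733334721742112518037230381708030606594855102310603333330827094393266222176471579491451159429498611741973115171726816589173359654532546429, 964878361435154091200557865519945891252035808709472612828229721151180982161819946477165151567130257996829278355971348225145154021925828602),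
  (1251529142252078716850631071257589937247011063900535873391168226896901843626173277840664637862195390714546947346828557348991984742208353862, 621900626514418968342494132695903418279129176555922642608969989114568663849613268369334159778385792278904785816707764530761011674166086077),
  (964510373006156556535063973495713921571679969267467593148282577196059371341946561207174478787053266469317255191813904050819379127992188854, 548768890138518520525388366767899394157101636108483019352817546197822606545263111202080218232095991429435471816200639590810221798087477321),
  (714754248422081635587048387370902772802048755254141326625150025265096700369114782603173350901398288910599963138389641489125868206861339129, 1056093547402612185422734261646886493544077807085702317944094442148152847939151350605666208731774247414400032228434059324011846361690388471),
  (717661242829896591462379510360919751953574817166846588256908460168529536746546533365690312160236336079016536875006077635785621498144751609, 957061871726103682476815671527386256663941229433915155377301763178288042183107467166421100448620700284139209651233589119185073689424036343),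
  (1010848024040645471252350858480773862663455194220577574896665603681899980074406715009889197863952686165245264884496933471166798874672103359, 1299137240797774669924801922766476660889308029733629814359919424581177012323713274969078175213415524843578470454124440960984870234949156426),
  (1034561534896422039719064769384644918613580328355677128258053426597868785617648329347692904954021666118836633959837551523782792622372814779, 549992411997546241503657754264357189872568068129824875751480968986255316522776980131577618721683915683251639464149492876055858164541704389),
  (1297866793286567631567917956242649878338786288853645855139551253382742452631787188158699559936819694714995140866645740464513661804757366351, 1372268977173675117741907688694480685011335570181069437616071867497923069614899395677762468422465572232588980414769678975867021204238892990),
  (1451638132668103341967443551190266625733420169041028266326642996699811501418724561123805906849691001121384400665278935853830034503248099019, 1301763337041249873366660142289559537261659174227710952848164941379251099173477866952197500817929993427677637335538852135751716370368167863),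
  (644703086531816152403047591481971775760148396165931791515379175863287285125856334757785771947308009917358487440517305023617495063498607092, 1054870025543584464444464874150428697828611375064360461545431019359720137553552351460509709787753965886360939344766711361638403884781123451),
  (149960835676076156480538162120479916370074515674940365911213999566144504492716842373285359048802903442842599309082084321671336515300491461, 1341741338904017719228766228748579853450134712366590059807069006667414785378941114771165136065562514325476877122928349653202368644811587514),
  (1248622147844263760975299948267572958095485001987830611759409791993469003895203239257529762691530149494250044455396427041096469946459750470, 720932302190927471288412722815403655159265754207709805175762668084433469605657151808579268061539339409165608393908234735587784346432438205),
  (880790195514886329319539174437028171218946448168294717070961683280799730406661164600598169468150671008551002708603536700970633410912452415, 620498052129971485878905300669278337622244464083183360519387895104927286542949342182913839534547383753481253267799938113974717981168519372),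
  (1431822138755138673059387145127884625956570357644707024208918524680971000396568977696285026635473121110218529532468476918167074833837326266, 1301455638227563521427330524036063756176018783395427421366696399868706509789457341731211915262538765707922553644900481741460678671310276685),
  (57379733850204596199065131871943680290876370151321723482656215029968267817993130484468500671745100292927744448482618243110665903516155599, 1480930967170093359304013144952689081983071929319745327668991183348476746932660186944490108901629913808848593097017351379240514512861771698),
  (1045834260132207197596782379766885032998010374313133068294752805221645748053497851501208949324839132287874151575242220813662470852745101003, 1295223492605780620277670032934501064069509420404663313375140042371106902534479410506173984620966969415645706052904539242709305938151492028),
  (1487929542109462554431578040109438266465068285579226027221409116132959188498049117886725529748819625584660330425454113303048784774426526069, 194744809317148942958686648120513734553424300660082025877296272626715240430413698117736724892391798000481468120204009154484053983023333375),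
  (443367612473136071661669897232943273249436353482895679396821934489293857160397596062542011320067676860655542870014156104771283679736496062, 1487163112791876260453673636054251774089581292310509435660547540846075949788438110909931119537975404806665336131846955769404670691866818115),
  (1353333905563661800807050607946512006867421355303162916803716153837240270336407244875220853879977576969391227048523063113010875704016896204, 1301263812396895410410543190342935389696316196781505927179379390896465297671555076247830940204593944194772750913875880989676276311308369843),
  (1115741266857159246053805441373258874566136253726519712073001531830244188308686693619570957930456918501450569374363383084653643747825811315, 671598127023069197979053361255252189587579792287537802461473276540667818398065772317183993315313357924658009565368440980691457630216931837),
  (743007313636257693563440534725726394626147209903797141038306018725859824186836174486629613058925265256121061734358052584398432405070807027, 1055369550187938927400581826097052845393954352510565487214216569842505939897973475513333763984434236588629284317590445712106733978328741759),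
  (1488020394361490707312387632252913756410045567299031995338886014540072298545492104072572615794943102664398425506665260123583850495623561585, 1229673004729198968589361447520618416051646311309963726497054566805591939739342952083877911000880360527290202692432052348326933021897785343),
  (508056242293984776829174267789495691278957404345572146036266170176405869643597141654789153140554615098316706384475366284058953321447161791, 1004269475294841215300433765511078993428619024306211045272131188406765408042857045379063610203668262417452528020021942845389994329280329294),
  (1418022535384510505974554978503064424896942406165839383443160389524375360533953871415132230665379004010909023958609968022342370036100890829, 818370174899860365257303319799762609035353928777207536790963038457125423504000150820866833157872124447387025588919143922802159220770734014),
  (981054778059330339548468417066857125023512041730650633537831671127444512035602415189972796433595816363251735489528234761057993288518205134, 743188934690765639800235104077569163232249677759080003143798100631479060613156781407050109716266448363068497806062736143044338201613322673),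
  (1273245191633264839658693583736212213959635485855010403023368318692353111668535577261862510261535878144542016741496407210522483974276644558, 1392981790611192408401672666911082615305550336678050644003102762459707033890027547362164076073524516473422039239314499423463376917285063089),
  (1006849067644532775718380092174610644840970597368031895278010222494629140771745617274295580112492433187206499094102980288774351977615196083, 674374866977179775691172159870308526874696291473150485268405598117009508330680812296940120671060934673320913882295727234809139142812743247),
  (697037155437008208312956641198443713911908930152212476611605314657302769467616970980016799677834766630472034766108418963549993675446550909, 909774757126433639597185490327875430532268385224053645641475495267071553950220885264375390885193680982901117634101311972602611823127035902),
  (552259811685762541997095246431591502974602009841383496191813243825239110124117933444022470738817978611390320895161835832399132468279508862, 1484386372837765682741554837439195436802464793124896752853615219268880168745407738661479941144271046158261607079613584179085626806575843825),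
  (720020994617527438737037586925093176827018544864368957745269550764903088662392299946761492552984640473440991454779334654162070795137843199, 1008488197385520151742725226986011195040730371332843015076971923085108025924619955932714834211044677906377667082464429084925107171242278771),
  (960878909445283290467896198647327964126732317616447230851309518427505923856072153394522337261789986599304190014821744474760927655485243709, 528780073915674487887775824101131112013010324186638643695664523541575122382928222047981747571820379067592747198806593495305016987611037390),
  (1431731286503110520178577552984409136011593075924901056091441626277388174045429365613670510213426973078855187146239116631456361908529004478, 266527442815513495796655724635959074677796772745545720746938105689829837440474754915710523821065290200744492709816861088190280736046073933),
  (987370591239387214880925048895033697810927676930263830844155109697812090335698561929290876288447849579377783980405944985047942077167454401, 1248659143223083714678452184176869377796359816420232167889182603698296638137561453030476910319840903048383066974813546982156554140657891262),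
  (1437501011789656066812010021782641371926985326603607447877015502342491200196196606608160591080410488165001861360424816235300329691193259967, 244085898653956426270023295493201758113690403830125854170186032862586940711281627615455312253520267203618743269834181989542697713230937679),
  (1296231510651995094485096531536845431758764150894438586316404786625870229154726867823836900148028618984639590524968710794071439901439557314, 1439863143413611184059529266022124265658774317855773116140347409213681681675372947304215366939224670531257906424244004319284391709367075261),
  (1299039481218467275828605258843965733777094041492391664763546870115883597579876942106802640800062130762307633994870188574585690426471088051, 1324167722897606544292609722703821978947996950392121126127710259832269697403283630179322003074568650177954703659062603380327981363337606735),
  (243398892273154662392923763789779769026765535877208740719563566804863212170419046328749152465419716754142480738847979461521710626468022653, 1293182372647238213360477755593940548940050291689355804602450413682821242616460871204409584495170538042287411755158368517093541186161868786),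
  (1008488272253014623977692781916600437790011466523055205408304512860253434165631686111746831467715549678641889942092138777565957002350297017, 1247710915138358200658892367307851722512518887834701954660249264674357021842214119415124492784237775466432344613607495360101716477228351694),
  (558029536972308088630527715229823738889994260520089887977387119419919105277640346686959592032999438858469407566213987836365449156783748991, 1461944828676208613214922408296438120238358424209476886276863146441637272016214611361224729576726023161135857639630905080438043783760707571),
  (1410613605489483111081809819962842396032509286332109681527292225146820954710638220452006680888515566181197562591514724678785478469858904262, 267475670900239009816215541504976729961637701331075933975871441561714290171184444554460200031301785546463943044918691421299655293441933117),
  (722019687779582805148967337669675730739839559820845027966951432739243157000278502544257202904502286577522807125993837062523742323560415668, 1348063985201761915668409480568402506712341071162103824600331827870441897135970730173277064640942014972487496629021774929814199870769069643),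
  (1395348440283590994150105009860902030385870140055607384792851335215285819684299847739506349727615760969597600175234014670469277651782598527, 333934437583224583033933564324622963086361517613237293739218449307777201984132770291061697728459197483853184094293010880522199851073517559),
  (1069683219094895947665852826625225095637357712729331415190781455723088467069888608943382059586104299583574939815867615226714228155050098883, 1387126272871745955896998796935666070543535519258088365614503941382473196874304758066913292979105285954467739074837684700039785090591489854),
  (1078535538307334266933303450789712401478578859193292637460492883956127030501035822601996445440773933132371614424594743928122844968187349492, 1247757758974466828843684920524425311802203929916948856728257110396069047994716777117822671630222908175631458515242316501553665287194148363),
  (907043827089001294938088314519351787394103796231513908901587039608252262024217091077771548905534073017342750852369543720512504967987218934, 1465539678682678685539340047827650681851337515982393047990804156860933424803719593499204802073163394738650307088911350224060249477908248077),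
  (1380902719230015966964514823435408478104412279310850590144733629394709820364407726087665500167567580468823555700183729404286170361250185085, 116107311963999759586266883743473958559591317880277454000597585916397195198143448789176450718394329763414907244442665979065664302030520307),
  (689184868395788561787427179154506307213998937832890275866663042100824895078608797314910233790589094463236149896007942368979043050156177035, 1395484424068127378564423385538141932301586179512584272921582113066567904110614851655697290932017840034818074165912248612631814490866862590),
  (526545476389893909059662667048632998970745021335072769577468951651239669984736908242695060044759705218835833046596231837232342118770409406, 1473897829879060108206764636430126543609388176236888955297882314071016977375505259141615673940087467160252558974915409204454277889042415821),
  (1092890447524376491986975493201836586514350069325862941857731941133775311441469857621288926890066573148225514423859061551488080924706359798, 1279877416891755141698956921650520637203936158030570165852362718800783121910121164695236530325669704488583941256210888744978645252128617999),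
  (503247436123880562606621856458652140848066014126354752659640581101713515787361147103422225665934298668226503030287953043085170192299308683, 1395439218157114411812411832260218297823949565845068624445508288903046696801366132562007611321899218048024604287195684967582862637967362556),
  (1380993531066548769096432967448777845350098929923037080395610870440052747618865194935427356415943279640492608482863092390848445501281402749, 301814779665936270178661563198527637684629289499615984615112848140068705400990596686834402076006642000274742955859691103196220380709650419),
  (1434693041223183885468501294475521069908655436005654369429877124439624626699160355420043588542465199179380928363656779402012775762106496718, 359781319169961066036942838811504044824467771293777844182823182328807584092733392560346956153836376316641173085045292918336205721306155453),
  (1069592407258363145533934682611855728391671062117144924939898244148144240699104612216705692867479916178321564941604967708476544994271822019, 1201418805169809445304604117480612391418497547638749834999988693632812841335982038115628467707481455376355986568491164508107230001053564734),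
  (999181275536824618399495944416924598356421900494248656478702557653028895270114318910531717603983704941371767028077580372384258276406066763, 541717008543904201802591764291575304801280656684035615447904156222480487493954766977504262683093808500802018228188294528258238155566631356),
  (722110542112083726342370067665766249497341926238387160454821956001976697947592285550867234040402567826136262715929927396954886012682633148, 1046647241582965621157856239824571149259619357015090533701960173003820712258433613074654199780358632293143358207276275100076352388647073783),
  (1255930451398398400141567035022666243616253553060161090467403974197989748540221711412991824236864226015518234706813913351139542197451358207, 1087350420969139706219029072249288761198893285529115334864629297033094339032307553118055038460400872184609136903212164558611686952433334263),
  (1255839597065897478948164305026575724858751186642618957979385235251781048529700204052274031818163198979189248794273504192653519578747372023, 1388767164587936000729582312993120118651614999676128625763089883842752571414061079719757857155712686626863508079407594045917111965404102219),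
  (705215204831674890809632877188351978539239451476847321260867124802546389947053947324659774735461388285659589287686440554654684871819001721, 928803613761957128353060319916577762232253276786361416290557262628649351960321109028328444182501484786345761531699315489515001567743312318),
  (716844625285866961511594232135347629621407571898165847254795494826371021088852202963826604856667614159706828292277700599890220293879253489, 1209327250089970452305290497575604264408469756258249705221397230159322143358441102221681795089610771695110924840200690591758767151340566094),
  (1016076612817233453932233134894338869314524375255788495674035777882740215260974846142282597764010210379308225730646770294714657312503496334, 659560636364912694607387684199568691828646736912764732859099567173738577169868231818694449550077896195078787013006546148277408648155627509),
  (247626840629521760962517043518507051271826123865020033354301644063856981116067991669342662248888961561123817618585262091137734810963822722, 1287458153263725795438311314821489176798057064298735955303608949413695414382300490801454539543726328017677139365233590716158114770016272253),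
  (1244210176611705408246202950079580073776583066221300431979884023557142863534556324046609070067794795283154060723591229544285141053376280447, 1108243528259922676777352135334093616475398520204240336831538489715805709311258666394511127742752908932312649145447791547528728113299081659),
  (825593748205754976709934790498397873182452005471434558235429207887499177489543091150662413395998963695161788595965321417989168120046026559, 1408022845454874305347796980722158263479577485823227225508763443355768796661303399162049792480128416525131190574020281305662755398158909427),
  (1473574122686885662585946238568093277824435336450073651108411761442318997260623142371509589587055030051246739153657549163963341228952500093, 602322840481940322032689930038488634715564663547403484714272836856702742180639521041802586385519009010109716273684536072793444047273347210),
  (1485294397473578654481310323511179447664105823288934309614843802434118261832429531577391322369983340839080655180316761251662178010859044861, 581429733191157351474366866953683779439059428872278482770247866354140646235639588674583505708024425871846079983694990326528290523407431366),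
  (1395529094127819546227658305076411021926079060501882141944800267094789061363653851147206611418913951524621035315349406127411437878961504191, 665335629737808194904142347653111946034760789731298187879407434217397083233007214115195663313192401421527678927695872426191289533467721411),
  (738610104572297460688499093609492111864099092023885838814262562809107185148266906828546035097490439153764968820340729135680633210809614021, 825593013300717170519943950138709114734886106789143581028868043917913743723177246582027715688397976909106720469606080989704926801208279422),
  (842992216014688816773872918423363438922336860849486794093212623057948244134323951380090931374595960138117924324456991748324898268371747194, 1486202771676280458265944019317445511942868116854813005883291571944479630223827064070385233056834758765490169023726035791179994110804099005),
  (876387115755311386652739134844503572247196501396525311160703695809318748037443960800799672240739804314593191669005368762576569216557646022, 1382992171215040500432827649539576864445500946857595170743019158997852088919149570800554436227881678329009848039871076900051437169594597245),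
  (743555293886865812845012570381162536734523818961912088686063841182438331505232547163436501535687861691030569909635379531239480249223741371, 897963319644410205921617345641334876352468147642560523806823208858274110543904579824252990630672680736879630984830127853672347626152919031),
  (1357189005072628624192278611883600463730794693016817377494552434134302783219128769509241003250156447346433928485391028695572035311534866301, 696175923855355117335585321928354831914545918875099080363141487987772324649423743319271116865021205470993809474565060062033943475058114698),
  (822235679386832308942428666731486682099109716974833713078718719752851450505926101675695380818567911296980720178106455006018605649802297213, 1417240319693338257352996435437962104492399434193291533026166494127388496518545529783816482190333810748026491958785967774572377958980256242),
  (1412927561936753386291596433001376587665963915879934370221621872368740698912565785920793771054681134635204586158838743140694898808524374522, 743515555959214347822289386248399194498051420762883968117341656321486341496506213700002430766604512791033097289383566851941820692621688461),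
  (741968173391220128456005217376403302947441380520486718810007754882513367566452701876854084844022265334651279687694803013704216685397933703, 816375539062253218514744495422905273722064158419079234916097860880442267708188013989881497918500459955033274214848535411157825515033722751),
  (648844801226538352434847075174723686126072329236833702075150295876308035725298774104076415843492440372589288886574085323046559080591130247, 909498909847368013949719430838137281330587467648163224033331463439893944763997038258269826569122316510702999394728989248771558157259393403),
  (877974236250957071041746487849262806034278939837950758257848248081974281024834602322258627968077252993518451650489232401557169687421256186, 1464579951797197487839700499758006467075904936081076300334895344465900116358989777106375584262693096835415462161235070752414572453616943093),
  (744282129838490403665791830414937494580896010068311252090826024950733135377960498210776963998014989721168358310342948921533195669204875195, 1292415424121228556520818340166327738258477877850887307910945920154795737422747919605801861501939968242392853495561605619885695018383441615),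
  (760001998141054348259071508160010758153555857963268787413047393718171144748670788263413114235816890216722179820111309959173353400380180678, 1476845254588455295735723041429443061644482202185290766391887810128921671387933793078022966707383874789893941240751600889291936597379364733),
  (1209411008011682994969299687165047864019937216349071364262591621318382525802256122830943646637981111204794666150180219884544834643075006335, 333889231672211616281922011046699328608724903945721645263144632381261572007146265170558581161334816326433755818111699701572248492744620021),
  (1472847286735261071765166978534318319978063145343673865093446720048370472066912350533418289691479789240487229556852442905931407267813392253, 207870736005121971433488935513495772809554933339076700610150125560181115301796181260253715514251721504596493762953058306580096655042824626),
  (500706345494780942956057856348871984922369306689499697720786052862929384471327256589063892469890657298931400620943415622040756418760408749, 1022840140027147143406125209639323436486094448122868879896641392735892636977824701319774761768189621223501148541984644081164476563427707386),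
  (1392259576040863266645235088862815287842745807140251753569230194633949408660431083730412778931013667755820801247631618244309996715640862521, 139368147886442149320225875246540454841007438856389024568023824109760423317508214270898760151557728157270255700964727464762877568280971774),
  (1185428465344358951813725566831644594823502025019730646690083265748608012764286888025150004244618884490997513245854286689161029999344484223, 729065367962030757227569959804083032034398108721398491867395769097604115921050459056507101377883868950239838915252991249904680410118375625),
  (89899403327765100109173445319318587036101534203181171171615904040548497144122313708269045831371300150944588657684024248414111127633377148, 1441590294399675962853186826158691117125231088878930927965917362043574061154570053100209388127685930440995377880348983906259360917661698491),
  (1418382161199077654675968362994032916465315404744109048637406516549709941635806177058821940810100847994904584209170078544399044305095772291, 73228994130593064164446557066539123163601344770418432417631931767484613155289850266654542620118580458490909287568221484368158169273204732),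
  (1468849850187963068904888508795915069211098074427980469447526548426189057564490101443870771678928931517992210479672743126848973906093539327, 1462312126184536796672396933884036332423682579725905414529434562032839849802617990577214612975771053637397001331349059425130209183870727751),
  (1011714060147752708652208200846962784250487683292113800577930340906896310864124287474779221838935523046859377803549883356573605372549398525, 1415746370343965329842387189923647010373070374377573261561254406952440067401967305995419274471434243679662012090092346309171523633111105583),
  (547035193367975460361853753268270871996711925339127411759037677422586105004191619011776668655492284256867895570109789538211485001262806910, 1488156050240247429683196570119080439175843294226753821940013895602406732133118393141741859533606256336071332009267101697277212291875471315),
  (1464756080161186359640187472897567053631033063836205159861492350026189125224779052169012098209059786941403572440602191749384920886711157078, 538587489115418368751965810695178383004501984386413929487059866875952232061358684344138618296764833551648674291891688929179747936146292731),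
  (1453627799289706600693545462742861568980506394025965260247579055740924169929152348722649432829773021200246119177333708519342219735855024471, 1477621932760573200887645130744434179507632492308600407223403498674567370793459735077565004214842866568984624734054253276293379257505134319),
  (500661274405866755397634643364736734830994266245535352239831205726503531612793106814564339154934923376307991696183052566211908026043989675, 1022797555255422125095677316490441179334942654611267583864669582015506224649151903604520650955376487305572602117282229577406456701548232660),
  (465085928534571622878677348179819882496545857928680736085035068950230103206892060538278985972198704546095715920022652035403837533174347711, 1034427640176401784072839213943345287291603787430069407809508414178751910204998298124737710857521154996733648070567020638276436482546728784),
  (1034608475578698361574163732107875886078805244193358270837511064317641948331354117688718912265267979605912113068940784796783268078806911485, 1198421808114068682806059238480661402227214836025903003169529175040389270783355076980013185911009779285764845946345094342398010402042543791),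
  (1022842341019232467598850211001668268901014353119031932248082240023484165233602774614750784691362141840100230995907363478428625805282097148, 476711926698810497706707869874391213869939866455386783824910775153824928669866255261992888553356210662326061647929781962057892311752263995),
  (1395487745768132001754012831733119814636997843867468153529490757899675374748895867446332017076014777713066482808637563740393432753209605763, 290553556360489711200774508509524731309456883122597949803440785201102521196004423822323498278959528915047110543654068776082505576887615868),
  (1232673420337237572450094172431936116304580828336153830998102156676529693145279538767088879204665123099737629048846833480737792360573847617, 258935940254715823386893814232241421070755301201314825360044162532506063937098668024400171946764816024243882849372947186546804827648688062),
  (1020390700182433404386234532302721145928000105403895081759586825874948853250929830997828932960126202561761759813733668137326350693310660543, 1418703789388282962594404629036481763721700544591423822735703194026881817524843097280120271221540394572114883450923804608890468445118791749),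
  (724067294195134846853701612374609310479934079700391013397998428053010239745368625332807720156094198895740394016025964790120359814789838846, 1299491685071807037708731873840543387920059167061034916875608061199788546417735319410382191776790673777672567164247900280906258215088422907),
  (275608144189605182335047635881415387196836110154760758394169814726852050271244752590057114271509729268825608926322952645565935546989000638, 1255883348275553203630739568992988819218077132317664232538098021757372086314561033035169781606419774834529415559863855019227165063548783097),
  (1447858694713043779682020404709705096577789269279288099300760311756776108667711487404637777275204706061302098499170603873529845551969861499, 1483209494015994895218659506431407918579783703584673600643640358962126042786422177687475377351725198721454804643812317141913509039857186502),
  (1488473232757872787894469235872723499562261338804768403331572982054701563607422306933380220251079757489783129906417544403838160231118930391, 657062160165740851400658393651974100253123451468718623157614206292592077485048498966373856833691612847302991209647545413168831619747807101),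
  (491984634371186059663608311908978373153481848436865256316255672620150728135273342377675892878430452314587550169045114704272745973573222121, 1019840136211104492343659877377606425986312475792977058653351566543149886685062760038417159360355613726062472683544161077353264970870030270),
  (1253664575812156861672962276518146088937889641763424066342480300631101808665533792387022283854056331649534906594596899387874898916092692677, 238038572423257724840631241684869834914654176429954521847988598954956202545893064763081567208471230655195158226146867175788660601500204863),
  (996673547585746976131952769327564699996771844906944673163778972219041696750611376883355146619333840595182989673781664326557906252303695678, 1300229118337960479945712046079686046473079052738761656837798045585942401043114844272029365706828807540992702383891343002727037571405185219),
  (987951836462152092839503224887671088227884403341710939184304249833938741393175945288956629763826590212971462188882543708032242995009945466, 1297229114521917828883246713817969035973297113783663293272836978522276566591619519091209121472487951684339625035818930045448319820625852039),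
  (506430378982529576409159701397893207233711458785788323586514143767658325982543857005969870108694627811324237112833003985751532346485524615, 1017209994000000430764662940803467440262791309836004645387552572039090917059182298325577630527696033463001933318791304421751950484065746941),
  (857576374751538975082315873001537447595583223599918533634540816002725724346171019025382902470159529709781125270366504741198797828345842045, 1387086173282509074780523934759198453482998962604955547049603016597695098236837240328549956292035721660955161377302481426927993098011147911),
  (726793291316901985885115271263555783777853818734363602718649910438128909064785893012210029198806283489260211674990835173275121554257065979, 1438863723953587618903687029344710691324781784206538596227197211302999920523469984908967610808275526340695427889228054637242030097900240892),
  (1392761748646364862722599172844173341339077570543403403389152680336473983910499493899387670182215386267540484887710341031180679582811422342, 151181517478709130005819353005357427904733732567001651408663029187776962964142018030430387460071829774830743677804283591450199334372508027),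
  (1477437010601535839237189236821570804137162843263771879488065497237710279174993170686922403947055779365343829299148700262822284590147698242, 744281966424335356811131864685259883193696389902986076123270377934609777616849493550915899805717140249295670887519099436976587736749179391),
  (1482749199270124154441367390823702277250921387359183741844907969530650102986628066355448885971922884821770778083826143730049758217744922621, 662692306192887564042120662487830096476426389506802218667274080749246087066165332523742820787194396854390996811556738413505893313418381690),
  (92898364471510726132019599438143933433290923641492565075314351748721573579119774648628453755896053531254952750105859787164012989569321407, 1399487703710249871462639987419136356272993240764421595202889278471909751559418633550245807198109925526918581254751194709117829737802104384),
  (1406796039641759258320821480849551835142055906502400528074398019303201247478078441847221794388698864036264950900697253164396373285871269885, 833361744580220595416258465004870333245825382707847103586824199437378994936209766842916836719748498760669036356995970669663310796254347199),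
  (368370216013333906835047459309334605835743801177934381109533662692350069639158606280657347434858220269165355161051648326690582568185645435, 1480893529936923892503009954010418289905036879070802809196272674162933643166214509211135353311012358331454531606370495763037832493188251332),
  (1201965159059712658534161376950380131734723849643063549369381753935171885203699256634288828511098268397884271316420485886870864265096461958, 662876140197661335770761898093977949561584400011455393007250341548988460342386331345310940804176402113309409504674817885455850194581062011),
  (1399304400085100434785886883603237444760346160488972641989813518524763049901609681544099472505705180706221641044091219237530093917336221378, 461539749240915201386564335676140529901415412357305972100863011788852340538861855879767753800133684202969765986441478669294772826719406527),
  (104573164506892047366676627532312223935231323195207519872490242467122792994141323998297662956915319715228320021349109120005476128334563707, 1386536662557413692774438760142974617891415450274659718368505232911631707288355215340292316048322046363792681269813650966473258060168035980),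
  (1387672186334425308087375460430484667255969522980327053173438549000147229623273029896732690571189624042292640379024429839449378053806864006, 476079317191358698317563981479625005890478366367106102069900990102143783224715661870492307542567274900251190374483833324011740842019539451),
  (1484886063873488468235978229146469681520904057688823387131235220209043947489059820780755712863640788790660461911542842870698465367972380669, 1114515434966033432598027575486666948930621196733488954474577632830123033599407016733293920132686243272839416854968780525272729368618055543),
  (92940950756216920668165204359559446432973584826195473857851134475027168413490555237108680570187228326258961324256715147547538655046289727, 1401076230507857189705438405946459093880341701114160910092269929835728298638874448241586044013479026398173483595406044625988756501904228040),
  (1479796501561548913600754516732781007436155038085400797744721113446952434789789829028800234762103211850203197098525954576412023215678797821, 1439413234678683000909772203960934526916092424192995528645269030966100151189311514394494188660628467072458619426748408267431331729137205239),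
  (1221089012367046608767607397369447299616683506211737825991154042301906328373092243447584879177069824005544053327885111669173496745199403005, 1020158567586523232869456381619223276916999767937345863646810191578821097721547722862450882869995931305177566518411935728708154935597840191),
  (1479478484708291159403706126936835911006288883109584626831908534492928437538553049767265786734692928629285029818725760523460136522009804797, 1300220073543795958226959271677238015542674965660692519239853499572491845121763597598733669049860536894700039604151263317537838588193912759),
  (1221045402851274079830252807027824724842707350101238464313258727135277280826627391475753959294516804575310980960121253069572789324182734990, 275970073760688991625723481626935877428594085606831860568760257993371519650363209909187599213777994014547020862013590023238708456226553723),
  (276607527155240584456071383144605936854769777265299636070326585307222320285884774977485947948662748906647465723621747529830749716520875891, 1400941267410320873837347563805092679706249950511202204314410062644153217494700375541865876477124703925076980045911396703404970394016303308),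
  (1404711979250297743618158985812871215210915899783158834378607873403090709247868960159247521980560945298655636879101575332879927548592502466, 275835110663152675757632639485569463272000340802137250185880408618737409429014492656613131168829836392730141306113949486443027764523059583),
  (1442047030136546861242976801493152674617434221606119287908079792134045753389993332911523405272272414773174893640019268939623155498261413885, 1110835279358170456282924272450670780048569196559819339828148902866440531104694029277700160364915622145252565002646653627373674449361436671),
  (276289510301982830259022993348660840733305974483888146494036820376782935549444885471894453457286121189532671330933558651394220983102472051, 1261748106275433831154534631521396167772896306434448142269633961108433841896741084437442973141359498506370432428274015408292103935171231884),
  (1479434875192518630466351536595213336770376405295706198549648767197234245868967877795165126212879478375900395254008379036843670648664377486, 556031579717961716983226371684950616080516292027574659254273592712453723434817117816188934630751846880988929938145428690750550233099272179),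
  (371686128767289236003881318862342888028360496948174265843035101178136735226683930312051200658972488812125461369277173689129198123160174591, 1294455405230499319204056412877518236325454008965022896111500280807873493755137254978672506356210182804557097789142462777429366722361556620),
  (1258794874276276132188030522267453055541982214265781419432945390371208859199202709057507937887775884041094828194432669102777388506260963470, 604548029081201536252571413137199624051145232064310713856160136655857546815425718765941834629804531023838339375785241262262889909420294003),
  (1346650411671240455498118475979470634741534157605809616030609065715663624990704997661143242426799944093142676885958785476044874820402282353, 1078127980403104968233402491094548703376936803634704322715554316106390371055332931260866063137604446853320366613694779252555498552595317247),
  (333119225518546303912892138665733775459354133015976277586449894931284478221803780186387751915729756696953755727842840847878892316742648187, 1203419995158974031636344146564617843102293065218830572954947970733872106997730246776352029665845234946871002960719812805327468840081161860),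
  (1390035752834672007389986995139278784670603928518507347867080791270161719995258362781151708205906194576114178684053646726940628508450244619, 930217018655860453313213368235919484171040712382615161697129657344911615612428933306549930259923868865094704008433176160220035218292080631),
  (151046127851046737725560304534582570404114245528931065167894665114891829080179431511339070209046003815701987632086101315803650317141129215, 1342971854593739138473401454329767244296082949001758950713386824751277317135745855928425406355262866947406507226782275348941706398682578444),
  (1436049534029087078574483017435405343063502401284852153094776111291724549849187944791961719708013020117411908272139458102153072655212740596, 703942541465206231903415494543579665065811977766543817907084928272167341632663325937140415109260751621032382851175182836396524925261709819),
  (104346462610009661858675931146285672052613270286502766246921690992780895441181868406766818997731701573620878922700322422496880062409736182, 1384222089866057806334696286385516705377716640752826601375803414945460882759030776669600612172312481368822432179223780208612615049210476173),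
  (287191818108246191881465339116630871278343664642555244773976077790271660830118414741866929992849134685041525237590896417176014159559505904, 1201424291203992564132705378433924766382846646708466706516066034626269226787154471117997845669627018063949378723060397580819309581953943695),
  (1207962655167172441202655161008127946933501758191352666869059574678630682803495560588626750097434999756729284134691949658774283052415712911, 1069768878090625560150270676001067917795101975354124578640503305794388677199589737090024230154049884507541858444967234164757179442619481983),
  (1480528588594876636839265290827588697476215128660444522611015485231204980809726147655849268232409291395408189829321281611497283231928043663, 1441817891838601643275402927628642477720943462721066423133773188836367725318177157655522116892613730146500153958094167533366170196107067258),
  (104346451527621958555624924682348315773324252089740231161930541305862563491309996745566209667562240353667644876987201358106781595083997174, 1384222100954023203914773775827305815195225518723986852710351659227281699516019741172319033034515569841736132962134144286467172177054512781),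
  (1392256374592307228295140101599332999710899617732337437371380782437242174658925501964348672206863113172121586520169886873983328632323422073, 151091421922180976499853613653315986297730041858689888247963705693308302713291826835113656207606877625770913094229882977371275771957496311),
  (1450312377237310400213436754085289254546627704586516851111673347068374797756472718171145969102891693364976921988430894632772129855547375485, 603052553070240321900610386513104476317094689073922177481380977572587282201234677272628194509988506802362078890846309731335336954421032590),
  (1480528577512488933536214284363625109306505724020767938762034317924901288147790663779295910229889342245059693738615859709905987702062336143, 1441817902926567040855480417070433594349741332004799333936604822444261739069531644404223808145051282176930432165211592877454698683926839162),
  (322075511001218129378686502134383395519162944181002097661190965205610689977697798443004843742235935708856269816723517805524579632986194418, 1202191249415079694840501169233154877984210960350113590463431434147140595711324487801631307500553194411733912478137626535879051267585081279),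
  (1469627438369228742497618248143348670303417567607087307136466681649112542605943634103304707299424074198560800131106111763573605205438103181, 1045874797337695371621959188071808486826770897438612139432642539080288370009202093831178111719731841451846947717040344144971023459175872374),
  (209098947479918192802597646764037347273751985217177073316617297254392677418511466228557452345471412230632211824677028965784247409504663410, 1280234135057105500104130949321955380825588059427092759366675783653548593536085870659346386900382531361743849337542426096394733541337876925),
  (1298405028865658888389814422202100731002480507416105033265848877286709774326982948600095192607261222703794771085057845867498447721772108287, 651022482320004951963940179715355921148732691932806783576366199545850580407883159461634839417740428659222828416967013386992923226352385739),
  (971052977368914687733354528707238553089257963446086053982262026659911728777341686152274422796137752299141699022488100077142614981103058878, 1266106997727097694776280198322288837194495803290210837533509845113386857419657069362378762943255457555108340372166881106986823098866598261),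
  (784258273711174972501759453633109763062136633755495240500423140721580099409726220086457728388577159488381278912231328734427137891872276415, 1465257962392050841705582431802134499818258027050426747980617860858811697490347540813147025061361387015199563740312031903683678251092298225),
  (707673408480232247566861366201982263380703646587466983187063621796230743238448039078577807920267272430922100779751055494703338183083406913, 1060001934667703176949809939066924729203738851696458192609529137129909721187121025378650359419515260272322902823204972325008444539522777022),
  (1376592084940764796420952748676296220898988466831202862947321343902842753296017332826035494687367680043190810009524522459335726077501767183, 1042876583451801797873726865334694300683370803434778989216960865973210316417791077870398577308733781361578045996073429077940005227060021744),
  (1485199732523398603621409497287091530474930815785684694507838446976653935483299394067933107758158282255710255246334225077743480062525590014, 451871517655051805034637946233161715942196634944701392532468846773050057788284368140159286328102290174016996605358163591911299371094750799),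
  (115339597250642423647668071169364247166334063037262023425717435238158660822244365757182850993371692489128307678044507262526209161097623537, 1482383313607952220781665505522622215424756909172658548389239446878632689515135888967862352314481820800371378350125080158828274048395378623),
  (742560763766320450974834109354474319065220220287002177334233852477383733698156670815006786528715019485753010664148987047806986129137205442, 908820899252514660083837498794027596577162297250905849450985017412499544420895675858303324152225670719321645868107923180738713065292300159),
  (742599919065216162118161938931778594414828051224100717233098768581247788681426493580596503218564177418511269541251598697972187687695679985, 1478619935787509905266376756414337329315636330607429641373199545719547199260601744229606506468943976237199883052486785298772274683834269391),
  (1485527743006121409247405129091233125914405260217512802609005848674857710608082507768774510320070351018299456988019245675199518931553353358, 754230577257485121495830380299565091828630431134445769548526863095873908797252030456445883113445936603606257772468685496486774340614900095),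
  (749003752643468252324463249011101489734519038641177875973620453711771183257902656732074219095910347296405091779157052494273423154534678399, 744280901669810796927823180245057426270722925048452605796739877276433732924491647532759531963124274088742207292634058123873482252312623024),
  (1263478518280674973838513850147216824692986426644210785722149458743779501376532916942584240253032886308516203763937802325052504250962148943, 232404481200198223647373362221159409613470636278742797513362226745232943027632448691473006647548648624682820471204013014181049142544957370),
  (179986879809265899972272123577397973425527359782533771417786628105560570448952899132886733465434093358285737171020190528369180459407526082, 1475845496175836123029049890784982716244726074077593347275559284652056174679355105709461852042654718028755908390785849533726058723984521087),
  (1485566898305017120390732961486788500592612964621988058655075197629540824281336175383113392848570339088587848021560655387087164128433799101, 1324029613792480366678369633260366340343819340358240057440696729089567386602851475344483777910261536294101343124868734819139229143797876943),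
  (1324297248170278851952591218604911686449532346287290329716645001312300187484288259325852653752436339209583771859589079219455893467387901887, 1293415182533847729227491481191157664616613104523270213285204342354296892273855829273938754946137768743224940062308686953450915139470491341),
  (1278463818772822897890391075913556986148292678486769150694342170202542181109251005848667244168265888370060591970331044234990254784044335101, 732063581847924330975802282541417394044933249590362195232591555723547611983362328272048658914288588763571330025055209201938671776160527951),
  (975414188714191653569384724537445623495408879932986296309079502022422529340160259897403264081644734799654274822519951259788824794068137914, 1270377707427746659050395963249571012575066763489064986514207757398917776786119947428380754446238490179031407995669036763374178237344139765),
  (723253407227791272230254487799372705943950750649561754562188791226546652677632056946816577285880440758859868424481977168940825836276172871, 974690125439134833663832071318278166092515000295827593166184542721433135342995618243649130363048485594280550478542018850444878257300963258),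
  (738238707719939196282131685308048511464495604525889578965078389301096903945445461502774611725574452641435464875648870513341541489116727797, 1474349226086860940992260951957560671977291395186782827532775457160215457943752962353836527621584737396744799269734938329150494463343179343),
  (1311577636600522803327025389566528210500916949973975532694535130250577049761019187507498460017894864577027223303904638563507833440907016063, 177256304746489333982610793063917516123969598939421370196727842102274962830271312890132913770659310214026036983611680462892440403023232944),
  (1376264074458041990794956809189590856259622836598521769475109985716468245692247957763003911690751231015749430088633723473331902994672798079, 740517523849368481412534431287079265459127673068150456975217545869391925800089974519770308295647807132905652376672499160442679881795352256),
  (927315070394343824080872857449473089082266401462888685288391771060395757266885628251252696142979572540973223227268860378404048588555419274, 1325525883881455548715158110345528270613450750354049403625506278303213527571500478681045771326779507193175599734986971591109627701767457279),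
  (1481976941439387190605911048297202251890125970538166846815715350399451181235943230103175147907911559479022619004606910150378622563087567231, 705938245420187699407051800048886613879615623872657230780551697939536216035316938967718702542287943389728837939597702762953688831982811120),
  (1480525387146320598489172766189492537250011711656784638564472517767868995674127903084281861720656140707673667962911590815097710767020984527, 1453541165874340470455030666035420302676282055794878897634608372506856401278949938500860750537502266537876899836167393064527678525470146419),
  (1484928650158194662772118908817110645209049017923998360838931781341014857222811436168435212940931092562746223392463866955309301246357143421, 1116103961763640750840825994013989686538106360253527207609231565583136432014197404514064982725331954806994941258073591437345125706284120063),
  (1200733306697218844067999862935601569142922034299792434293593220213946951369113317374872851998854895805532483433151680169945129227116366141, 1406840898821153828728321563743080673635709781910240346251258345979208110083346674927441248437660695770498471090721464713187437198318745587),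
  (92399062264351437258413905135867617774240787347084903758093617868114270364536573051766390897595338988350471128120292203039661124365563896, 1439827738188306254084208788946631941401373927577502748989624234964804956798459534910107775778753713123251943892526888110101247740786769423),
  (1402755411011067195825765697998184932094442057770156369247813915927090972727208386613412256179531271173258926461741854989414429732462657159, 831365431106311870198649059469771559338937857364788105325529866238041550848280828417701562879608697816405050476736088888552821399815735807),
  (836954791025642934783941453181877859589271258458001561405944609719364228381538031927664626949909450724362440620041138790047767924108670840, 692492419848238835298182076458640123898340522664908038541951555696443528635838488357763408041844904864815861327227755330859780045084295103),
  (737421212678095693080598979972578542383287650427797849555860888372336581130407113456831380646535323113541821281267465445781177010166450687, 1453273563760255118192962769143676522599962959104957769362671955473790651948350887408188098471492978591993891097773111102500287057963759168),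
  (1062000095712167722143857776604824027382256871135456325833547835020302187826227537230461722483631531294437945912823615483856805559990747130, 430248263475720330926943068706801067737171648363293500725986564203596922794761473706502390256177226957849859237565129998986612907941316615),
  (1206549420831945390861239274600798047035455244857560693828716040718623795979386312563231425865738700458361710811069235789890425485311063869, 1067407902560781611681690815379237178033227670659283328561550444261932042712741335577727454752434623156198705127533815627832428020142964735),
  (708581898170692710686509346151500277463294058986243499802923169675791158173581975886555224245065221208540202425568810167642762345116092615, 1479475248678303881078874704626659080272529835786268754341921744065059770018226393881976972521587892943704211093854684587927063151341713400),
  (1033160781204764739750240966858102496212810628175103699446271073195002350229417779181036514743419395916773298252183579193408070430824070850, 456449948393769093815376732586352872079324383611013676988761456108175829451385670958162990499647962788690692273959338085425013192698907071),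
  (1439817099010354744451864304606065230338757415923659608679120707145679289154951562155595876057455122319577384632823218383007115565265321975, 421293450331265335169106260708379441617139085598075952317100941798021436484308306544879847846048535093416061589502087379308954091750705659),
  (1479570653678652220156251906551325037019726438999796318534083764633094145829505429782674497882043992326934230933095427895781600079877486399, 1113794979941737762471004556092502403534672288327606420875495655711705511221859912282236758106772900914830834248394383182687555697646763716),
  (1406887137908656735665100781449452283468057695052119348703455291989173610624443008347790558273205407106590565118793340513427984591756441591, 81729073725421228985673580627075148607857009729846189606946525574316524693173174885280846824001197673958515989146652361564571514508953740),
  (464399979831388863836493740027793219541280976094947773886656187595307588375277191315673781159004427354916533160552584347812165779076434429, 1406886486379298967403649028430411297098518341436634677048726744024017183439232310703678795117154700833361761976912543547645159380459960187),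
  (1105844296974760224248957277149682989773236947822008243127474855778852251194726272949535632932385445574508503187423570378796558493084024330, 1488515854610085627098969436326240393439270976896038605575302321180781729040177146125380806312353947699121967308196300825618062065465819127),
  (1444915253440099642146166480537805807552577335967466815381523809638915778595069375929548082670443572246263586265829195438657744898235582479, 1116010226195234234113934032693391615987012103699299589315045454977419191725877632921509967346668166991509613857220060396859629941674719220),
  (835409543354924158781533732378586286992783137763788032373567804635401445554443951807101160830273378719132151263194711322352793218094989306, 696816763502959088867844834097500276229085928531130170990009600868459117179898022088730443876293492225839068344121337859855899601651367439),
  (696806617919782023892064425855896986141619177395317622177138525932366586826378034693962634855226636221957393030302659307954827892552087541, 1164304425016612499739907746035783959375447291643695561734289127687061397895204980231095274244298457333417598817873179770578509237699234299),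
  (369510970108930245268238289441770086905984808316147495252440336496685643589907759788063815437385305075279874476454957887339395626341236426, 1488561442168230763353437640307094214099655312669609304188671538448193759117319635144761207351059332796692739494258162688916560523156258687),
  (1433139973189188957125757487228667548284553955845407005715649346808927478025569396969714870320495397827996700730501486390647429081245660989, 800839402533542853743310778385107216210899249057855849581052510910379636914353477973371127325694179367340009061290242367974765517812550135),
  (1174480471416686622587159479482283232349935835215206211109747068952897158912330415456623668974115458948429389932378736255722489549592480247, 687730570013032206593281898417065142401960451647789621143259806485325128080804780825946209046822052372850539943717859758866402229836822152),
  (57743662025798869426043988678926143995222997862301492719753175261877871971150472835629015011696157283736164295774751886651445664930613448, 1442042984441802705381833562026839023635006829159840641948640502447144319414040059680294056862521285574951514259016604362489345933909669695),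
  (1174480499820263555455876750239929133537537831009492762480347273680284226877805468218665967117417937028489487070467534268384784972228086271, 324311135088107695560028195703787925069837158834014670438539510561443640761766089317278652158502562189521045733127868501609570981266830860),
  (362970131426522085222488737747102281807146225416049739080480207155123326636943136648301623024493598078042858488967397413992830878827394568, 1452219467861775453149118693759477002493793745370962996340045895702928226101445285439867151921645441869732570879334472577268770181501438455),
  (1439680783468020286301659952598578743604597837070187246540388088177431483824103550703015834255311814616165074145344590569506991329649885175, 1200600811764922592348887328864926776159470605073897129583813079044374246668167109886208835104509332328978366922393317787977883980117573627),
  (1287503889722398862615210583543625418188588868325419513965366064866224772068981158794743685251045598677433037715542666998896332376631148541, 255079376731133282730418950716877597537185621943362681609703249746088191506860378880508348678141750998209006996512245841908296045540914887),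
  (430202668844443769302358168111977081222462907902133669305011994504763653142013637631986722944079268110522079964942146111779187828558135431, 1430779189475444080866282613638327767902125902227369202269631491841128268293056754244368873000277683280175194721778974559303762976224313336),
  (1439680811871597823416848695692834624277286081569252391062143814943120554163868033976601684339453836033237838835685944583511528375198941183, 837181376839996748874696533306817296373054558705995024750903683241160138728900443403368317526133413248646580160682305604684314793841000319),
  (659651236542843612528934944872874143317223434322754777955405633881349204338155151098860784476855336480154101271033930531545463296622591927, 831097828992226517936812649364431596827990900035455320784698292673189786016855973548778854429006955982864100552589255805915168871752401100),
  (1109838717772851973130439660798670635526973646673817975285552575495656934288257481072866416431371115571553593847604111873909473890013282378, 1428646803798805892323966869445977256059784324089776466013660328277295476871181441658337112037822551177790619690804157017488364824350949311),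
  (1207641460399116848590343613923711313021398260089080305718855289279085231974018005830263705928807364377279990533476698322423041317752799229, 717386781923762836533750154321274489179811264913385733639697806393904706843716088244302796275212854348861532811315290532961794200969412467),
  (929580759316725122611684010015735835361397448560671796180282723394123871047985044055536718985402332453535442693537585196025342878034165752, 709026106741823260798706754980200322961766007120844444012470506637372776167148256009426839018461143329941613531104461627849327255228514679),
  (579788807219573332247514002165591434646750407772372523892017474285851966759308118837175249681005499288486359035274006599085616402354143159, 1293405234184824341053641921036078796535830969995566609389910563822480638211538511434593959081478450251415520033719616118791465905982294392),
  (1107247933998805546968872843841889361919518072093857989838513313972219607356300872697442405899156534718775851903941148571218576026942570360, 709170848399280378785046018343455663277906357748792512093029252765541682044725572355063105344898843789125230060344492976630447510877372551),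
  (662652540853793194834563573007573185550522783420480430180600082157885887531755184832548999571936678103907613318565413255523800529068078727, 826278813393649339948865117609865663023753178902373780229811074121538240301386129044274122960115325656990542728910282868484655240737456125),
  (673552269862250778486191270313391165047375923717650595666591799631286802595660340085392102194417532008161773092308046478953702113195046901, 911088006983981793562335928507618580648723514373050220080362918558514767673074880667009140082940211279054626343876096333784757876555775807),
  (1479389351106722313098247783984506139760007796285420630575806421307777170180915430695985300010717058565817745481569639107997558833724503933, 334850856334443941485699517911484667947809641114501805729466596492277399427796015839917090903469701533486938011611431348004951593299476103),
  (1207230939862926310780637690735463709097613812752249659188935597680374727113680389914952244996740157575158233506673882227698577128630012415, 1441681752920522262332036752025291723860004361634519909799432681019723641033644209484289349782311407587786978806643622168415377681383686010),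
  (917953256389546714103331640762325601508752194307912558988047953202107716483244612691576530222106903364548657549063642129129789660548057290, 1348875324192829855902524019900396063127172172086049214212184999654950565007699400548663562466127437746019756647199483744506815095909627903),
  (743418246499310789053886861109283530084470412752953115415186840410982606845713574640124133910006574968643389452994684014138020218326221179, 1051877497870244252261702439098611510769488960430922377686013536155084836656326462611653889939999776590997948505798936553643954946441215628),
  (917227695888974096654352188333576297343248126271742946254748759079146082338750605973891944734245046692072336040207695504789898025179807438, 1368499959699919028923464683589339128465091125531803188235767124636220010287807274225668265186991180724659696512198594081907962989263192563),
  (1316485472345474734718945275495556060996712085604518732313000127473099285186121476176389983986823767917895079653214020528011279756599230389, 556753957144642542504863194421315933477934927412529208991203195052593677168344157106756388596584607221225643481268734180205810335101222783),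
  (290511123723834178481846583581503743678988341676879463694545981846500995277510840131022539945181045223963853282978841344982438862989033090, 1200598805459839619872294047172490180904701010626233059384084578331897483651037668619872103037794455415609371681011211299337398996122468861),
  (1026071707770352825274747573622843578200172689656208506132236610542356297570561084664653762743028651603305171520566191933166440436151090822, 1207867134920788157999077079711797342118286263694309409112345084795400426231710952595462076526829730569656771737594476269759578749662134783),
  (1207596388966557365636188478354380653191955742704693467932645481421795291481475024038804084215923686280947468692350429538505102480539385853, 313264443436017507762674106624630082751677196001349119526203120571236735828271866715641813138493713188347982687691185375409867407277162299),
  (1384898114371069688629736313205389279806151720285786012665604513840293672409394566766759690596970574789500756967979245894867664240522578303, 1441826494579163992614448140877868896408139437965840479071863419092850637552353261007821086040467847112078565126330536969145339795113770634),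
  (743463317587988957043354675503827846675265435218603837123377557996398244036510663830454593524626825794236020116404004302638808065665663355, 1455999836358000157928279130772839147842551553679596246274435650477261362052495074632974654058252120778878534073980603170588282113866333892),
  (1386351449662332972904030593520848436879922738989440864597279688666602247354200454960565260804437785812478788617490776131552418420628670779, 697543448020074260211570271967080683191891452753852784271167029152404060289819874567785413363644272509324670416248639982247024702529732300),
  (173714448693199677635187959869907131900883101327775704388634848821256851525311763916321215787430096141719130093490068314581769281865758717, 1454626798130143593272070628070527790956689521352268336545045315489671810017779099282540461470286285925022451219096592230340015944435236855),
  (1417065519825110290801830338191528734110563802353584550146840037319138901001242309824224095931675690212859842410024434071378005354528898758, 824961165791918276085574557493243914420850335832696578720954936031343073190257612288127045849670599998396588766529821641767115794866503995),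
  (742692691537308346726124982184094981450878176141814789479966556943505330266852268231430966320843592989543539622081825301469033051870705535, 1071502133374625740034478244526247531005705683697539206128173965262164360470990370167754661388363544563676814564062313286590607164180547712),
  (816602590818471334683817743858679139624218830055697130099872064484449334571003795841824766587148278287467869197619979878583327516860088253, 696170412564887389676176628843183510449113123862961949917593269335294088869725207022976843815652843759608165658755840003402330362072793087),
  (1479706991402344313889840863587784385870453998042690114528783735620472275137931168313753071382645848137331392922238541743342056926928156479, 334487574145365254762279475400724088649871315965763840266294330554401847034130980886117874039117992669417547830775755385030342837352286404),
  (1417836182267080636454755063477947766212924669033610212097843587484576310337805370372084025535123003134384285432606256940969660623609678018, 1209458846593935141012856567112522058113026578323257015860684019882603429854791854308342054199763927380481683497318423834536216112759027583),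
  (1479023990858151901364665092134917872488338646125154078568790632998545675639132524390429107741650828602881417909885088875364312479019565439, 1463268165645656840172511234588495422547194075282895278791707620992609330844754526870713026107288995551417210499476917455922738628095114950),
  (1418519027541770178214298698539619967582352628510670027012108480559646395417810777180373098937551280837017886991051895970347382648965430914, 80678122005498237803511548160869885347686054057145959296075121261376076542345533653716996212821431499782272153839135616272372531256623485),
  (79587952687732684780688993888459269748431188909498609201432715008973554716125343473176650648468478434651488015735526145474540506955382781, 1433184949612790321981856521341393479660277864103240712772940302679219957389614133859608646845103146820750807612912710213734020057107791803),
  (1116276073911964795285280340930899629557133242780658510393727203174882643225570607632938644748588067234320726825660893175744339181645575777, 1247254407111075004098397960828579739897668433199413105238916130757806652564463485309886899265159620140497893526382636415851448645296586750),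
  (287753427802688447873477448101254946952048878211453781119634475247397311295354218954157393445515284374435793783134518325710056783356100602, 1392709165687496718221253194639212440373137874539897978593996718451378437301527077773342287518638968641881304501048226536136538250599708303),
  (1209095366470590035606918775878162282202981967923153491086526970608095880570987926889381379890378176954650034247953520144178018924158236662, 1098795412303273262791200859792118456507199230243880464341429936269785119705038513511806799072969582915808053622241309637391629701714298953),
  (1134003887881395730156482418314658916051965322115832857583989944589162310879413102088093505063309600077444483557322606634566880871363641342, 360467628801804505973986355680409722370248375718718918450349797432102564641492449448519043524933370710884678909428053781360598277462968321),
  (1488562786342320215839052197834673159780894688142779127163767144197977059813938475523445398421012545476486764103003782515030885398598385733, 1296549407708293489046915024302809264657103596976577657868843286800945693655574411451378878953878185127029234342079555706403087763191627775),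
  (354604489483824793696322617105678372127627467878555377871648411052026844630195017781471541312339327927943645039340218347765702174370168763, 1320034880219237996665475104834559835189218111156133023180947483620314883393273630146316819098592190808986166846957969964782561883097905150),
  (726810994125268687317836589643933011226015903988959523019801820441813241453370684533954994605144025620394480983732416204526379826885446047, 1369409378801926313617646000600277110444598204457122751223717927653989306906521959185672600933482573685500716063455574618545681348046075903),
  (1200918831872284619553692273981884997876071087293151113149895808243329205089185742529762493940450283006831698707028857394917465826973974463, 287691131637941714699224767215272866548685131518607308935073478041779233333348055238525829488379969876582559025736916028734718606607141232),
  (1413638821365365913539172129742518982174904858117804398995435617873385903083296035399799106687663156296031545399774313163615366648522885197, 557937702830146760788079690578644278748920851294897628360465690854208201370109051324291830026656909029308686769263852124616769385179119543),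
  (1186092885537273690078545733692389446305693213087966229747701967207090996954857012011831112805451371631709986630667440023138539441768890094, 313584312262126986299072436403272185405340657714347755733210856087797301958183303187354921871566602920353082693225134481477881007957868369),
  (1421650924594871540072413817714610399410868029017680729562634232988115912487631896051059492577029745076576261408082681739345137886491068757, 1301088091241378098814868670664623576773015163964511949164888304555069033509489683661070855343505794402731265211192975322176914265668040367),
  (371931540117695217655993399029874742866191516032013428813632871345823852178385878612829607018592620308059709286138074676041422048245823419, 1361732172487005131685539886233482805999805550335707751954603205001851549356691509172326575457789403648238178073241888834169398395551107582),
  (1067543736731862152731779283646433135868794385006464910795514367228755952456267575423468182981861713552649799889694998024914560622081849201, 1293320030085919966021443890821843271761428304673011035138238395628033696048645058907309055986473403919773631905778506265558939487969495214),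
  (348110964569526152910298976617765135183187329988322984415455589094725232853653848793736611631010884809123561004899113352335004967886632682, 1388170482154412108453299548277398128257226307551963687297951700697255097447611805563650311129011359366179273631934806920362711748123295711),
  (1201555085690809287239917990695332910018781207934887570432785856863422559062355201377184956964634036959252518485440036922687040346430373878, 1057461539397653931216410740297139487963788611744649394597914959987838773385677333447460138239129251859336423656760523856971560490075403849),
  (633801193604062693306681779571941141119376975345762889963641811450723968873520931423456903706939095469484586762963128939676746778396327934, 906821947823081807060680519213877432666875516977384603626980970686457820335740559452326691512943319363366184118329142119436241574607978459),
  (835227913631714208365417458713271696838606267692800850077173290763172280983778577032635995666218825579830158544928907936318871533369969079, 653339237791273119087595150583031243340065712828064068304832654671626593965135674231272791106699179980568093574856767690482161983808321132),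
  (1484843468301569501520352716971637589655215246794696856943161067256221817035549651941547530727577209389624142499973710245889002706923664969, 1370452550745532056546597923607525606506940736485817747123154857738253195372344193167602833858252196997060209423279319618093110208157993399),
  (1488023391873198189691971805794189619755606930343723847756022815325165274911801580708401243843193716658491558155637861807758524545882933391, 404848009966453322646652117434887546695146815052952289283641507548919692214032538841432978258711895686633061412750333328792831174377453429),
  (1473983497823498430572611406307507745575119216991710993896499288346519723505150381854181874112289885301194059442681125236348627052958580573, 923992275180390885900346437322629128565564731224229930345695657288126604089916047375936384676444808141163720946774431357976300912816179635),
  (953609777280020519110742922236156208369039479592504418513755993376997178773991946698832294282316689979422047218767271922565241902748158399, 549217324571619835927021653204601478241785665144787633191914038117806555354456367329015571626194115680486655419226421340693057572572233726)]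

/-- The same for the damaged edges `450, …, 458` of the graph with five tiles. -/
def extraCertificates : List (ℕ × ℕ) := [
  (11, 502), (510, 457), (451, 62), (511, 39), (508, 475), (61, 503), (455, 504), (508, 459),
  (3, 508), (508, 459), (511, 55), (509, 458), (43, 503), (470, 61), (2, 509), (471, 60),
  (43, 511), (509, 450), (508, 459), (471, 61), (43, 503), (500, 11), (509, 470), (42, 511),
  (511, 43), (479, 500), (32, 479), (500, 459), (43, 502), (479, 61), (471, 61), (511, 482),
  (471, 41), (40, 479), (511, 502), (479, 508), (11, 508), (43, 502), (500, 31), (511, 483),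
  (470, 61), (502, 43), (41, 478), (41, 471), (479, 501), (511, 58), (470, 493), (509, 458),
  (61, 458), (463, 501), (498, 63), (482, 63), (61, 467), (43, 503), (479, 492), (59, 494),
  (500, 27), (48, 463), (463, 501), (32, 479), (511, 58), (491, 62), (479, 485), (52, 475),
  (479, 41), (494, 475), (475, 37), (479, 41), (490, 471), (53, 510), (495, 510), (463, 497),
  (15, 501), (511, 58), (496, 463), (466, 493), (45, 471), (18, 493), (495, 22), (509, 19),
  (506, 493), (471, 58), (61, 507), (511, 48), (45, 479), (466, 495), (497, 30), (15, 511),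
  (510, 481), (7, 510), (495, 20), (19, 511), (508, 491), (506, 485), (493, 30), (62, 495),
  (507, 21), (23, 507), (500, 479), (509, 507), (467, 44), (53, 510), (63, 455), (504, 63),
  (453, 510), (63, 497), (15, 501), (499, 14), (499, 60), (460, 511), (508, 507), (63, 451),
  (63, 459), (463, 52), (496, 511), (508, 499), (463, 60), (51, 463), (506, 53), (461, 506),
  (460, 507), (55, 463), (51, 463), (510, 53), (47, 479), (507, 52), (468, 491), (453, 506),
  (503, 458), (493, 54), (506, 461), (506, 37), (7, 511), (509, 474), (63, 479), (509, 50),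
  (458, 55), (55, 493), (499, 461), (491, 479), (55, 488), (476, 55), (30, 507), (22, 493),
  (511, 474), (489, 55), (503, 40), (509, 479), (503, 460), (10, 503), (47, 506), (39, 478),
  (509, 59), (474, 485), (474, 37), (501, 31), (456, 503), (456, 55), (63, 490), (458, 53),
  (63, 490), (501, 479), (53, 506), (458, 53), (458, 501), (511, 463), (509, 47), (14, 497),
  (499, 478), (55, 474), (493, 503), (503, 511), (460, 51), (59, 460), (63, 493), (63, 456),
  (470, 59), (471, 58), (488, 503), (63, 461), (474, 45), (63, 456), (471, 63), (488, 471),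
  (55, 511), (488, 503), (479, 40), (503, 63), (493, 466), (489, 502), (55, 479), (511, 459),
  (497, 62), (26, 493), (478, 41), (495, 479), (14, 497), (511, 463), (501, 511), (43, 470),
  (511, 463), (500, 59), (11, 500), (497, 62), (479, 493), (46, 467), (42, 469), (503, 59),
  (477, 494), (509, 503), (479, 42), (497, 62), (499, 61), (46, 467), (487, 26), (479, 493),
  (34, 477), (477, 494), (508, 463), (511, 51), (14, 497), (56, 503), (3, 508), (501, 62),
  (43, 477), (39, 508), (478, 483), (505, 31), (509, 475), (62, 487), (510, 39), (508, 487),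
  (451, 60), (455, 504), (63, 475), (455, 504), (63, 479), (504, 39), (504, 39), (471, 490),
  (57, 479), (471, 58), (47, 477), (471, 506), (494, 53), (455, 508), (57, 463), (495, 29),
  (504, 487), (23, 506), (472, 55), (507, 463), (459, 53), (511, 52), (510, 49), (511, 462),
  (1, 511), (52, 507), (511, 53), (4, 507), (507, 462), (510, 51), (463, 53), (39, 504),
  (504, 479), (511, 463), (479, 39), (58, 477), (27, 493), (485, 506), (3, 508), (510, 23),
  (485, 478), (508, 51), (509, 491), (453, 510), (511, 41), (58, 471), (511, 35), (483, 476),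
  (28, 511), (509, 495), (26, 503), (487, 24), (455, 60), (507, 487), (490, 21), (31, 495),
  (510, 459), (501, 506), (43, 478), (17, 494), (55, 490), (461, 506), (507, 23), (54, 493),
  (469, 494), (46, 505), (510, 25), (478, 61), (43, 503), (41, 503), (503, 14), (501, 458),
  (473, 503), (473, 62), (495, 503), (54, 457), (495, 467), (474, 61), (511, 501), (17, 494),
  (53, 494), (494, 27), (468, 43), (47, 503), (495, 62), (475, 501), (52, 459), (478, 505),
  (507, 476), (489, 54), (55, 463), (493, 50), (474, 509), (30, 511), (475, 501), (62, 463),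
  (485, 58), (507, 453), (495, 62), (467, 509), (478, 63), (499, 461), (45, 498), (37, 506),
  (487, 31), (28, 499), (510, 15), (510, 23), (507, 492), (5, 507), (61, 482), (21, 491),
  (507, 500), (494, 31), (494, 55), (493, 54), (467, 509), (19, 509), (494, 55), (509, 458),
  (60, 475), (19, 509), (504, 31), (463, 501), (510, 11), (49, 510), (494, 31), (487, 62),
  (479, 481), (463, 497), (56, 479), (503, 46), (475, 485), (475, 485), (44, 475), (503, 62),
  (53, 506), (479, 39), (44, 475), (42, 477), (55, 494), (490, 477), (477, 51), (479, 39),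
  (499, 508), (475, 501), (44, 475), (62, 459), (511, 473), (503, 457), (475, 493), (457, 54),
  (503, 509), (27, 486), (492, 27), (63, 502), (467, 493), (492, 27), (63, 502), (55, 511),
  (510, 9), (511, 54), (449, 511), (62, 457), (510, 457), (19, 510), (493, 55), (36, 475),
  (511, 485), (475, 62), (457, 502), (467, 510), (44, 467), (511, 45), (493, 502), (456, 63),
  (503, 493), (484, 63), (63, 475), (475, 484), (503, 494), (466, 45), (63, 466), (456, 63),
  (503, 46), (63, 466), (503, 493), (493, 511), (508, 63), (491, 469), (23, 490), (456, 63),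
  (39, 475), (511, 484), (63, 465), (472, 63), (28, 507), (499, 46), (495, 469), (506, 21),
  (55, 490), (54, 475), (461, 511), (55, 475), (460, 511), (507, 36), (56, 479), (511, 55),
  (503, 45), (503, 45), (492, 475), (27, 502), (463, 498), (19, 492), (492, 475), (305, 222),
  (494, 509), (223, 291), (255, 300), (511, 17), (311, 248), (335, 435), (155, 364), (492, 223),
  (505, 159), (502, 381), (511, 39), (254, 359), (457, 191), (311, 472), (327, 504), (191, 450),
  (456, 511), (189, 503), (330, 509), (503, 10), (506, 15), (501, 63), (63, 501)]

/-- The colour of edge `e` when edge `off + s` is damaged. -/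
def certColor (l : List (ℕ × ℕ)) (s e : ℕ) : Color :=
  (if (l.getD e (0, 0)).1.testBit s then 1 else 0, if (l.getD e (0, 0)).2.testBit s then 1 else 0)

/-- The bits of the damaged edges at the vertex `v`. -/
def damageMask (T off v : ℕ) : ℕ :=
  (2 ^ inc T v 0 ||| 2 ^ inc T v 1 ||| 2 ^ inc T v 2) >>> off

/-- The bits of the damaged edges for which the colours at the vertex `v` have nonzero sum. -/
def defect (l : List (ℕ × ℕ)) (a b c : ℕ) : ℕ :=
  ((l.getD a (0, 0)).1 ^^^ (l.getD b (0, 0)).1 ^^^ (l.getD c (0, 0)).1) |||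
    ((l.getD a (0, 0)).2 ^^^ (l.getD b (0, 0)).2 ^^^ (l.getD c (0, 0)).2)

theorem testBit_damageMask {T off v s : ℕ} (h : ∀ k < 3, inc T v k ≠ off + s) :
    (damageMask T off v).testBit s = false := by
  have h0 := h 0 (by omega)
  have h1 := h 1 (by omega)
  have h2 := h 2 (by omega)
  simp [damageMask, h0, h1, h2]

theorem good_of_check {T off w : ℕ} {l : List (ℕ × ℕ)}
    (h : ∀ v < 294 + 4 * T, defect l (inc T v 0) (inc T v 1) (inc T v 2) ||| damageMask T off v =
      damageMask T off v)
    (hl : ∀ e < 441 + 6 * T, (l.getD e (0, 0)).1 ||| (l.getD e (0, 0)).2 = 2 ^ w - 1)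
    {s : ℕ} (hs : s < w) : Good T (off + s) (certColor l s) := by
  intro v hv hj
  have hm := testBit_damageMask hj
  have hd : (defect l (inc T v 0) (inc T v 1) (inc T v 2)).testBit s = false := by
    have := congrArg (fun x => Nat.testBit x s) (h v hv)
    simp only [Nat.testBit_or, hm, Bool.or_false] at this
    exact this
  have hn : ∀ e < 441 + 6 * T, certColor l s e ≠ 0 := by
    intro e he h0
    have := congrArg (fun x => Nat.testBit x s) (hl e he)
    simp only [Nat.testBit_or, Nat.testBit_two_pow_sub_one, hs, decide_true] at this
    simp only [certColor, Prod.mk_eq_zero] at h0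
    cases h1 : (l.getD e (0, 0)).1.testBit s <;> cases h2 : (l.getD e (0, 0)).2.testBit s <;>
      simp_all
  refine ⟨hn _ (inc_lt hv (by omega)), hn _ (inc_lt hv (by omega)), hn _ (inc_lt hv (by omega)),
    ?_⟩
  simp only [defect, Nat.testBit_or, Nat.testBit_xor, Bool.or_eq_false_iff] at hd
  obtain ⟨h1, h2⟩ := hd
  have aux : ∀ x y z : Bool, ((x ^^ y) ^^ z) = false →
      (if x then 1 else 0 : ZMod 2) + (if y then 1 else 0) + (if z then 1 else 0) = 0 := by decide
  exact Prod.ext (aux _ _ _ h1) (aux _ _ _ h2)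

theorem certificates_defect : ∀ v < 294 + 4 * 3,
    defect certificates (inc 3 v 0) (inc 3 v 1) (inc 3 v 2) ||| damageMask 3 0 v =
      damageMask 3 0 v := by
  decide +kernel

theorem certificates_ne : ∀ e < 441 + 6 * 3,
    (certificates.getD e (0, 0)).1 ||| (certificates.getD e (0, 0)).2 = 2 ^ 459 - 1 := by
  decide +kernel

theorem extraCertificates_defect : ∀ v < 294 + 4 * 5,
    defect extraCertificates (inc 5 v 0) (inc 5 v 1) (inc 5 v 2) ||| damageMask 5 450 v =
      damageMask 5 450 v := by
  decide +kernel

theorem extraCertificates_ne : ∀ e < 441 + 6 * 5,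
    (extraCertificates.getD e (0, 0)).1 ||| (extraCertificates.getD e (0, 0)).2 = 2 ^ 9 - 1 := by
  decide +kernel

/-- The map from the edges of the graph with `T + 2` tiles to those of the graph with `T` tiles
that folds the tiles `i`, `i + 1`, `i + 2` onto the tile `i`. -/
def fold (i e : ℕ) : ℕ :=
  if e < 438 then e
  else if (e - 438) % 6 < 3 then if e < 450 + 6 * i then e else e - 12
  else if e < 444 + 6 * i then e else if e < 450 + 6 * i then e - 6 else e - 12

theorem fold_edgeOfLabel {T i e : ℕ} (hi : i < T) (he : e < 444) :
    fold i (edgeOfLabel (T + 2) e) = edgeOfLabel T e := by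
  unfold fold edgeOfLabel; split_ifs <;> omega

theorem Good.unfold {T i j : ℕ} {f : ℕ → Color} (hi : i < T) (hf : Good T (fold i j) f)
    (hj : ∀ e, fold i e = fold i j → e = j) : Good (T + 2) j fun e => f (fold i e) := by
  intro v hv h
  beta_reduce
  have hj' : ∀ k < 3, fold i (inc (T + 2) v k) ≠ fold i j := fun k hk h' => h k hk (hj _ h')
  rcases lt_or_ge v 294 with h1 | h1
  · have hk : ∀ k < 3, fold i (inc (T + 2) v k) = inc T v k := fun k hk => by
      rw [inc_core h1, inc_core h1, fold_edgeOfLabel hi (coreInc_spec v h1 k hk).1]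
    rw [hk 0 (by omega), hk 1 (by omega), hk 2 (by omega)]
    exact hf v (by omega) fun k hk' => by rw [← hk k hk']; exact hj' k hk'
  · obtain ⟨t, rfl | ⟨k, hk, rfl⟩⟩ := exists_tile_index h1
    · obtain ⟨t', ht', hh⟩ : ∃ t' < T, ∀ k < 3, fold i (441 + 6 * t + k) = 441 + 6 * t' + k := by
        refine ⟨if t ≤ i then t else if t = i + 1 then i else t - 2, ?_, fun k hk => ?_⟩
        · split_ifs <;> omega
        · unfold fold; split_ifs <;> omega
      simp only [inc_centre] at hj' ⊢
      rw [hh 0 (by omega), hh 1 (by omega), hh 2 (by omega)]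
      have := hf (297 + 4 * t') (by omega) fun k hk' => by
        rw [inc_centre, ← hh k hk']; exact hj' k hk'
      simpa only [inc_centre] using this
    · obtain ⟨a0, a1, a2⟩ := inc_leaf (T := T + 2) (t := t) hk
      have b0 := hj' 0 (by omega)
      have b1 := hj' 1 (by omega)
      have b2 := hj' 2 (by omega)
      rw [a0] at b0 ⊢
      rw [a1] at b1 ⊢
      rw [a2] at b2 ⊢
      obtain ⟨t', ht', h2, h01⟩ : ∃ t' < T, fold i (441 + 6 * t + k) = 441 + 6 * t' + k ∧
          (fold i (438 + 6 * t + k) = 438 + 6 * t' + k ∧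
            fold i (444 + 6 * t + k) = 444 + 6 * t' + k ∨
          fold i (438 + 6 * t + k) = 444 + 6 * t' + k ∧
            fold i (444 + 6 * t + k) = 438 + 6 * t' + k) := by
        refine ⟨if t ≤ i then t else if t = i + 1 then i else t - 2, ?_, ?_, ?_⟩
        · split_ifs <;> omega
        · unfold fold; split_ifs <;> omega
        · by_cases c1 : t = i + 1
          · right; unfold fold; constructor <;> split_ifs <;> omega
          · left; unfold fold; constructor <;> split_ifs <;> omega
      obtain ⟨c0, c1, c2⟩ := inc_leaf (T := T) (t := t') hk
      have key := hf (294 + 4 * t' + k) (by omega) (fun k' hk' => by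
        obtain rfl | rfl | rfl : k' = 0 ∨ k' = 1 ∨ k' = 2 := by omega
        all_goals omega)
      rw [c0, c1, c2] at key
      rcases h01 with ⟨h0, h1⟩ | ⟨h0, h1⟩
      · rwa [h0, h1, h2]
      · rw [h0, h1, h2]
        obtain ⟨k0, k1, k2, k3⟩ := key
        exact ⟨k1, k0, k2, by rw [← k3]; ring⟩

theorem exists_good_step {T : ℕ} (hT : 3 ≤ T) (h : ∀ j < 441 + 6 * T, ∃ f, Good T j f) {j : ℕ}
    (hj : j < 441 + 6 * (T + 2)) (hT' : j < 450 ∨ 459 ≤ j ∨ 5 ≤ T) :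
    ∃ f, Good (T + 2) j f := by
  have key : ∃ i < T, fold i j < 441 + 6 * T ∧ ∀ e, fold i e = fold i j → e = j := by
    rcases lt_or_ge j 438 with h1 | h1
    · have hv : fold 0 j = j := by
        rw [fold, if_pos h1]
      refine ⟨0, by omega, by omega, fun e he => ?_⟩
      rw [hv] at he
      unfold fold at he
      split_ifs at he <;> omega
    · obtain ⟨t, k, hk, rfl | rfl⟩ := exists_chain_index h1
      · have hm : (438 + 6 * t + k - 438) % 6 < 3 := by omega
        rcases le_or_gt 4 t with h2 | h2
        · have hv : fold 0 (438 + 6 * t + k) = 426 + 6 * t + k := by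
            rw [fold, if_neg (by omega), if_pos hm, if_neg (by omega)]; omega
          refine ⟨0, by omega, by omega, fun e he => ?_⟩
          rw [hv] at he
          unfold fold at he
          split_ifs at he <;> omega
        · have hv : fold (T - 1) (438 + 6 * t + k) = 438 + 6 * t + k := by
            rw [fold, if_neg (by omega), if_pos hm, if_pos (by omega)]
          refine ⟨T - 1, by omega, by omega, fun e he => ?_⟩
          rw [hv] at he
          unfold fold at he
          split_ifs at he <;> omega
      · have hm : ¬ (441 + 6 * t + k - 438) % 6 < 3 := by omega
        rcases le_or_gt 3 t with h2 | h2
        · have hv : fold 0 (441 + 6 * t + k) = 429 + 6 * t + k := by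
            rw [fold, if_neg (by omega), if_neg hm, if_neg (by omega), if_neg (by omega)]; omega
          refine ⟨0, by omega, by omega, fun e he => ?_⟩
          rw [hv] at he
          unfold fold at he
          split_ifs at he <;> omega
        · have hv : fold (T - 1) (441 + 6 * t + k) = 441 + 6 * t + k := by
            rw [fold, if_neg (by omega), if_neg hm, if_pos (by omega)]
          refine ⟨T - 1, by omega, by omega, fun e he => ?_⟩
          rw [hv] at he
          unfold fold at he
          split_ifs at he <;> omega
  obtain ⟨i, hi, hlt, hinj⟩ := key
  obtain ⟨f, hf⟩ := h _ hlt
  exact ⟨_, hf.unfold hi hinj⟩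

theorem exists_good (m : ℕ) : ∀ j < 441 + 6 * (3 + 2 * m), ∃ f, Good (3 + 2 * m) j f := by
  have h3 : ∀ j < 441 + 6 * 3, ∃ f, Good 3 j f := fun j hj => by
    have := good_of_check certificates_defect certificates_ne (s := j) (by omega)
    rw [Nat.zero_add] at this
    exact ⟨_, this⟩
  induction m with
  | zero => exact h3
  | succ m ih =>
    intro j hj
    by_cases h : m = 0 ∧ 450 ≤ j ∧ j < 459
    · obtain ⟨rfl, h1, h2⟩ := h
      have := good_of_check extraCertificates_defect extraCertificates_ne (s := j - 450) (by omega)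
      rw [Nat.add_sub_cancel' h1] at this
      exact ⟨_, this⟩
    · exact exists_good_step (by omega) ih hj (by omega)

theorem critical_graph (m : ℕ) : Critical (graph (3 + 2 * m)) :=
  critical_of_good (exists_good m)

/-- An invariant of the colours of three parallel strands: their sum, together with the repeated
colour if there is one and the orientation otherwise. -/
def tau (a b c : Color) : Color × Color :=
  (a + b + c, if a = b then a else if a = c then a else if b = c then b
    else if b = (a.2, a.1 + a.2) then 0 else (1, 0))

/-- The effect of a tile on the invariant `tau`. -/
def tauStep (x : Color × Color) : Color × Color := (x.1, x.1 + x.2)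

theorem tauStep_tauStep : ∀ x, tauStep (tauStep x) = x := by decide +kernel

theorem Tri.eq_add : ∀ a b c : Color, Tri a b c → c = a + b := by decide +kernel

theorem tau_tile : ∀ a₀ a₁ a₂ b₀ b₁ b₂ : Color, Tri a₀ b₀ (a₀ + b₀) → Tri a₁ b₁ (a₁ + b₁) →
    Tri a₂ b₂ (a₂ + b₂) → Tri (a₀ + b₀) (a₁ + b₁) (a₂ + b₂) →
    tau b₀ b₁ b₂ = tauStep (tau a₀ a₁ a₂) ∧ tau a₀ a₂ a₁ ≠ tauStep (tau a₀ a₁ a₂) := by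
  decide +kernel

theorem tau_of_tri {a₀ a₁ a₂ b₀ b₁ b₂ x₀ x₁ x₂ : Color} (h₀ : Tri a₀ b₀ x₀) (h₁ : Tri a₁ b₁ x₁)
    (h₂ : Tri a₂ b₂ x₂) (h : Tri x₀ x₁ x₂) :
    tau b₀ b₁ b₂ = tauStep (tau a₀ a₁ a₂) ∧ tau a₀ a₂ a₁ ≠ tauStep (tau a₀ a₁ a₂) := by
  obtain rfl := h₀.eq_add
  obtain rfl := h₁.eq_add
  obtain rfl := h₂.eq_add
  exact tau_tile _ _ _ _ _ _ h₀ h₁ h₂ h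

theorem color_add_self : ∀ a : Color, a + a = 0 := by decide

theorem color_eq_of_add_eq_zero : ∀ a b : Color, a + b = 0 → a = b := by decide

theorem superedge_flow {ap aq ar bp bq br cp cq cr xp xq xr yp yq yr : Color}
    (hap : ap ≠ 0) (hcq : cq ≠ 0) (hq₀ : Tri aq bq xq) (hr₀ : Tri ar br xr) (hc₀ : Tri xp xq xr)
    (hp₁ : Tri bp cp yp) (hr₁ : Tri br cr yr) (hc₁ : Tri yp yq yr)
    (h : tau ap ar aq = tauStep (tau cp cq cr)) :
    xp + bp + ap = bq + yq + cq ∧ xp + bp + ap ≠ 0 := by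
  have hs : ap + ar + aq = cp + cq + cr := congrArg Prod.fst h
  have e1 := hq₀.2.2.2
  have e2 := hr₀.2.2.2
  have e3 := hc₀.2.2.2
  have e4 := hp₁.2.2.2
  have e5 := hr₁.2.2.2
  have e6 := hc₁.2.2.2
  have key : xp + bp + ap = bq + yq + cq := by
    apply color_eq_of_add_eq_zero
    have := color_add_self (xq + xr + yp + yr + br + aq + ar + cp + cr)
    calc _ = (aq + bq + xq) + (ar + br + xr) + (xp + xq + xr) + (bp + cp + yp) + (br + cr + yr)
          + (yp + yq + yr) + (ap + ar + aq) + (cp + cq + cr) -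
          ((xq + xr + yp + yr + br + aq + ar + cp + cr) +
            (xq + xr + yp + yr + br + aq + ar + cp + cr)) := by ring
      _ = 0 := by rw [e1, e2, e3, e4, e5, e6, hs, this, zero_add, zero_add, zero_add, zero_add,
          zero_add, zero_add, color_add_self, sub_zero]
  refine ⟨key, fun h0 => ?_⟩
  have hp₀ : Tri ap bp xp := ⟨hap, hp₁.1, hc₀.1, by rw [← h0]; ring⟩
  have hq₁ : Tri bq cq yq := ⟨hq₀.2.1, hcq, hc₁.2.1, by rw [← h0, key]; ring⟩
  have h1 := tau_of_tri hp₀ hq₀ hr₀ hc₀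
  have h2 := (tau_of_tri hp₁ hq₁ hr₁ hc₁).1
  rw [h2, h1.1, tauStep_tauStep] at h
  exact h1.2 h

/-- The vertices whose removal leaves a graph that is not colourable. -/
def IsSpecial (v : ℕ) : Prop := v = 74 ∨ v = 137

instance (v : ℕ) : Decidable (IsSpecial v) := by unfold IsSpecial; infer_instance

/-- An entry of the table of superedges. -/
def sup (i k : ℕ) : ℕ := (superedges.getD i []).getD k 0

theorem sup_vertex : ∀ i < 15, ∀ k < 21, (k = 0 ∨ 3 ≤ k) ∧ (i ≠ 8 ∨ k < 9) →
    sup i k < 294 ∧ ¬ IsSpecial (sup i k) := by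
  decide +kernel

theorem sup_inner : ∀ i < 15,
    coreInc (sup i 5) 1 = coreInc (sup i 3) 2 ∧ coreInc (sup i 5) 2 = coreInc (sup i 4) 2 ∧
    coreInc (sup i 8) 0 = coreInc (sup i 6) 2 ∧ coreInc (sup i 8) 2 = coreInc (sup i 7) 2 ∧
    coreInc (sup i 7) 0 = coreInc (sup i 4) 1 := by
  decide +kernel

theorem sup_tiles : ∀ i < 15, i ≠ 8 →
    (coreInc (sup i 9) 0 = coreInc (sup i 6) 1 ∧ coreInc (sup i 10) 0 = sup i 2 ∧
      coreInc (sup i 11) 0 = coreInc (sup i 7) 1) ∧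
    (coreInc (sup i 13) 0 = coreInc (sup i 9) 1 ∧ coreInc (sup i 14) 0 = coreInc (sup i 10) 1 ∧
      coreInc (sup i 15) 0 = coreInc (sup i 11) 1) ∧
    (coreInc (sup i 17) 0 = coreInc (sup i 13) 1 ∧ coreInc (sup i 18) 0 = coreInc (sup i 14) 1 ∧
      coreInc (sup i 19) 0 = coreInc (sup i 15) 1) ∧
    (coreInc (sup i 17) 1 = sup i 1 ∧ coreInc (sup i 18) 1 = coreInc (sup i 4) 0 ∧
      coreInc (sup i 19) 1 = coreInc (sup i 3) 0) := by
  decide +kernel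

theorem sup_centres : ∀ i < 15, i ≠ 8 → ∀ t < 3, ∀ k < 3,
     coreInc (sup i (12 + 4 * t)) k = coreInc (sup i (9 + 4 * t + k)) 2 := by
  decide +kernel

theorem sup_chain : coreInc (sup 8 6) 1 = 438 ∧ sup 8 2 = 439 ∧ coreInc (sup 8 7) 1 = 440 ∧
    sup 8 1 = 441 ∧ coreInc (sup 8 4) 0 = 442 ∧ coreInc (sup 8 3) 0 = 443 ∧
    coreInc 6 1 = 439 ∧ coreInc 4 0 = 441 := by
  decide +kernel

theorem sup_succ : ∀ i < 15,
    coreInc (sup i 0) 0 = coreInc (sup ((i + 14) % 15) 3) 1 ∧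
    coreInc (sup i 0) 1 = coreInc (sup i 5) 0 ∧
    coreInc (sup ((i + 14) % 15) 8) 1 = coreInc (sup i 6) 0 ∧
    sup ((i + 14) % 15) 2 = sup i 1 := by
  decide +kernel

/-- The colouring `g` of the labelled edges of the fixed part is proper outside the special
vertices, and the chain transfers the invariant `tau`. -/
structure IsCoreColoring (g : ℕ → Color) : Prop where
  tri : ∀ v < 294, ¬ IsSpecial v → Tri (g (coreInc v 0)) (g (coreInc v 1)) (g (coreInc v 2))
  chain : tau (g 441) (g 442) (g 443) = tauStep (tau (g 438) (g 439) (g 440))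

/-- The flow through a superedge. -/
def flow (g : ℕ → Color) (i : ℕ) : Color :=
  g (coreInc (sup i 5) 0) + g (coreInc (sup i 6) 0) + g (sup i 1)

theorem IsCoreColoring.tau_eq {g : ℕ → Color} (hg : IsCoreColoring g) {i : ℕ} (hi : i < 15) :
    tau (g (sup i 1)) (g (coreInc (sup i 4) 0)) (g (coreInc (sup i 3) 0)) =
      tauStep (tau (g (coreInc (sup i 6) 1)) (g (sup i 2)) (g (coreInc (sup i 7) 1))) ∧
    g (sup i 1) ≠ 0 ∧ g (sup i 2) ≠ 0 := by
  by_cases h8 : i = 8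
  · subst h8
    obtain ⟨h1, h2, h3, h4, h5, h6, h7, h8⟩ := sup_chain
    rw [h1, h2, h3, h4, h5, h6, ← h7, ← h8]
    refine ⟨?_, (hg.tri 4 (by omega) (by decide)).1, (hg.tri 6 (by omega) (by decide)).2.1⟩
    rw [h7, h8]
    exact hg.chain
  · obtain ⟨⟨a0, a1, a2⟩, ⟨b0, b1, b2⟩, ⟨c0, c1, c2⟩, ⟨d0, d1, d2⟩⟩ := sup_tiles i hi h8
    have hc := sup_centres i hi h8
    have ht : ∀ k < 21, 3 ≤ k → Tri (g (coreInc (sup i k) 0)) (g (coreInc (sup i k) 1))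
        (g (coreInc (sup i k) 2)) := fun k hk hk' => by
      obtain ⟨h1, h2⟩ := sup_vertex i hi k hk ⟨Or.inr hk', Or.inl h8⟩
      exact hg.tri _ h1 h2
    have step : ∀ t < 3, tau (g (coreInc (sup i (9 + 4 * t)) 1))
        (g (coreInc (sup i (10 + 4 * t)) 1)) (g (coreInc (sup i (11 + 4 * t)) 1)) =
        tauStep (tau (g (coreInc (sup i (9 + 4 * t)) 0))
          (g (coreInc (sup i (10 + 4 * t)) 0)) (g (coreInc (sup i (11 + 4 * t)) 0))) := by
      intro t h
      have h4 := ht (12 + 4 * t) (by omega) (by omega)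
      rw [hc t h 0 (by omega), hc t h 1 (by omega), hc t h 2 (by omega)] at h4
      have h2 := ht (9 + 4 * t + 1) (by omega) (by omega)
      have h3 := ht (9 + 4 * t + 2) (by omega) (by omega)
      rw [show 10 + 4 * t = 9 + 4 * t + 1 by ring, show 11 + 4 * t = 9 + 4 * t + 2 by ring]
      exact (tau_of_tri (ht (9 + 4 * t) (by omega) (by omega)) h2 h3 h4).1
    have s0 := step 0 (by omega)
    have s1 := step 1 (by omega)
    have s2 := step 2 (by omega)
    simp only [Nat.mul_zero, Nat.mul_one, Nat.add_zero, Nat.reduceAdd, Nat.reduceMul] at s0 s1 s2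
    refine ⟨?_, ?_, ?_⟩
    · rw [← d0, ← d1, ← d2, s2, c0, c1, c2, s1, b0, b1, b2, s0, a0, a1, a2, tauStep_tauStep]
    · rw [← d0]; exact (ht 17 (by omega) (by omega)).2.1
    · rw [← a1]; exact (ht 10 (by omega) (by omega)).1

theorem IsCoreColoring.flow_eq {g : ℕ → Color} (hg : IsCoreColoring g) {i : ℕ} (hi : i < 15) :
    flow g i = g (coreInc (sup i 3) 1) + g (coreInc (sup i 8) 1) + g (sup i 2) ∧ flow g i ≠ 0 := by
  obtain ⟨h, h1, h2⟩ := hg.tau_eq hi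
  obtain ⟨e1, e2, e3, e4, e5⟩ := sup_inner i hi
  have ht : ∀ k < 9, 3 ≤ k → Tri (g (coreInc (sup i k) 0)) (g (coreInc (sup i k) 1))
      (g (coreInc (sup i k) 2)) := fun k hk hk' => by
    obtain ⟨h1, h2⟩ := sup_vertex i hi k (by omega) ⟨Or.inr hk', Or.inr hk⟩
    exact hg.tri _ h1 h2
  have t5 := ht 5 (by omega) (by omega)
  have t7 := ht 7 (by omega) (by omega)
  have t8 := ht 8 (by omega) (by omega)
  rw [e1, e2] at t5
  rw [e5] at t7
  rw [e3, e4] at t8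
  exact superedge_flow h1 h2 (ht 3 (by omega) (by omega)) (ht 4 (by omega) (by omega)) t5
    (ht 6 (by omega) (by omega)) t7 t8 h

theorem IsCoreColoring.tri_flow {g : ℕ → Color} (hg : IsCoreColoring g) {i : ℕ} (hi : i < 15) :
    Tri (flow g ((i + 14) % 15)) (flow g i) (g (coreInc (sup i 0) 2)) := by
  obtain ⟨h1, h2⟩ := sup_vertex i hi 0 (by omega) ⟨Or.inl rfl, Or.inr (by omega)⟩
  obtain ⟨e1, e2, e3, e4⟩ := sup_succ i hi
  have hi' : (i + 14) % 15 < 15 := by omega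
  have ht := hg.tri _ h1 h2
  refine ⟨(hg.flow_eq hi').2, (hg.flow_eq hi).2, ht.2.2.1, ?_⟩
  rw [(hg.flow_eq hi').1, flow, e3, e4, ← e1, ← e2]
  have h := color_add_self (g (coreInc (sup i 6) 0) + g (sup i 1))
  calc _ = (g (coreInc (sup i 0) 0) + g (coreInc (sup i 0) 1) + g (coreInc (sup i 0) 2)) +
        ((g (coreInc (sup i 6) 0) + g (sup i 1)) + (g (coreInc (sup i 6) 0) + g (sup i 1))) := by
        ring
    _ = 0 := by rw [h, ht.2.2.2, add_zero]

/-- The code of a colour. -/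
def Color.code (c : Color) : ℕ := c.1.val + 2 * c.2.val

theorem code_add : ∀ a b : Color, Color.code (a + b) = Color.code a ^^^ Color.code b := by
  decide +kernel

theorem code_lt (a : Color) : a.code < 4 := by revert a; decide +kernel

theorem code_pos : ∀ a : Color, a ≠ 0 → 0 < a.code := by decide +kernel

theorem Tri.code {a b c : Color} (h : Tri a b c) : a.code ^^^ b.code = c.code ∧
    a.code ≠ 0 ∧ b.code ≠ 0 ∧ a.code ≠ b.code ∧ a.code ^^^ b.code ≠ 0 := by
  have hc := h.eq_add
  have hab : a.code ≠ b.code := fun hab => by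
    have h1 := code_add a b
    rw [hab, Nat.xor_self, ← hc] at h1
    exact (code_pos c h.2.2.1).ne' h1
  rw [← code_add, ← hc]
  exact ⟨rfl, (code_pos a h.1).ne', (code_pos b h.2.1).ne', hab, (code_pos c h.2.2.1).ne'⟩

/-- The `i`-th digit of a partial assignment. -/
def digit (s i : ℕ) : ℕ := s / 4 ^ i % 4

/-- Whether the partial assignment `s` of the first `m` edges extends to a colouring that is proper
at all listed vertices. -/
def search : List (ℕ × ℕ × ℕ × ℕ) → ℕ → ℕ → Bool
  | [], _, _ => true
  | (_, a, b, c) :: l, m, s =>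
    if c < m then Nat.beq (Nat.xor (digit s a) (digit s b)) (digit s c) && search l m s
    else if b < m then
      Bool.not (Nat.beq c m) || (Bool.not (Nat.beq (digit s a) (digit s b)) &&
        search l (m + 1) (s + Nat.xor (digit s a) (digit s b) * 4 ^ m))
    else if a < m then
      Bool.not (Nat.beq b m && Nat.beq c (m + 1)) || [1, 2, 3].any fun x =>
        Bool.not (Nat.beq (digit s a) x) &&
          search l (m + 2) (s + (x + 4 * Nat.xor (digit s a) x) * 4 ^ m)
    else
      Bool.not (Nat.beq a m && (Nat.beq b (m + 1) && Nat.beq c (m + 2))) ||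
        [1, 2, 3].any fun x => [1, 2, 3].any fun y => Bool.not (Nat.beq x y) &&
          search l (m + 3) (s + (x + 4 * y + 16 * Nat.xor x y) * 4 ^ m)

set_option maxRecDepth 100000 in
theorem search_baseVertices : search baseVertices 0 0 = false := by
  decide +kernel

/-- The digits of `s` are the first `m` values of `F`. -/
def Agree (F : ℕ → ℕ) (m s : ℕ) : Prop := s < 4 ^ m ∧ ∀ i < m, digit s i = F i

theorem Agree.succ {F : ℕ → ℕ} {m s : ℕ} (h : Agree F m s) (hF : F m < 4) :
    Agree F (m + 1) (s + F m * 4 ^ m) := by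
  obtain ⟨h1, h2⟩ := h
  refine ⟨?_, fun i hi => ?_⟩
  · rw [pow_succ]; nlinarith
  · unfold digit at *
    rcases Nat.lt_succ_iff_lt_or_eq.1 hi with h | rfl
    · rw [← h2 i h]
      obtain ⟨d, rfl⟩ := Nat.exists_eq_add_of_lt h
      have : F (i + d + 1) * 4 ^ (i + d + 1) = 4 ^ i * (F (i + d + 1) * 4 ^ d * 4) := by ring
      rw [this, Nat.add_mul_div_left _ _ (by positivity), Nat.add_mul_mod_self_right]
    · rw [Nat.add_mul_div_right _ _ (by positivity), Nat.div_eq_of_lt h1, Nat.zero_add,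
        Nat.mod_eq_of_lt hF]

theorem search_eq_true {F : ℕ → ℕ} (hF : ∀ i, F i < 4) (l : List (ℕ × ℕ × ℕ × ℕ)) :
    ∀ m s, Agree F m s → (∀ p ∈ l, p.2.1 < p.2.2.1 ∧ p.2.2.1 < p.2.2.2 ∧ F p.2.1 ^^^ F p.2.2.1 = F p.2.2.2 ∧ F p.2.1 ≠ 0 ∧
      F p.2.2.1 ≠ 0 ∧ F p.2.1 ≠ F p.2.2.1 ∧ F p.2.1 ^^^ F p.2.2.1 ≠ 0) →
      search l m s = true := by
  have hx : ∀ x y, Nat.xor x y = x ^^^ y := fun _ _ => rfl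
  have hb : ∀ x y, Nat.beq x y = decide (x = y) := fun x y => by
    rw [Bool.eq_iff_iff, Nat.beq_eq, decide_eq_true_iff]
  have hm : ∀ x, x < 4 → x ≠ 0 → x ∈ [1, 2, 3] := by decide
  induction l with
  | nil => intros; rfl
  | cons p l ih =>
    rintro m s hs hp
    obtain ⟨v, a, b, c⟩ := p
    obtain ⟨hab, hbc, h1, h2, h3, h4, h5⟩ := hp _ List.mem_cons_self
    simp only [] at hab hbc h1 h2 h3 h4 h5
    have ih' := fun m s hs => ih m s hs fun p hp' => hp p (List.mem_cons_of_mem _ hp')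
    unfold search
    simp only [hx, hb]
    split_ifs with c1 c2 c3
    · rw [hs.2 a (by omega), hs.2 b (by omega), hs.2 c c1, h1, ih' _ _ hs]
      simp
    · rcases eq_or_ne c m with rfl | hc
      · rw [hs.2 a (by omega), hs.2 b c2, h1, ih' _ _ (hs.succ (hF c))]
        simp [h4]
      · simp [hc]
    · by_cases hc : b = m ∧ c = m + 1
      · obtain ⟨rfl, rfl⟩ := hc
        have := (hs.succ (hF b)).succ (hF (b + 1))
        rw [show s + F b * 4 ^ b + F (b + 1) * 4 ^ (b + 1) =
          s + (F b + 4 * F (b + 1)) * 4 ^ b by ring] at this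
        rw [hs.2 a c3, Bool.or_eq_true, List.any_eq_true]
        refine Or.inr ⟨F b, hm _ (hF b) h3, ?_⟩
        rw [h1, ih' _ _ this]
        simp [h4]
      · rw [Bool.or_eq_true]
        left
        simp only [Bool.not_eq_true', Bool.and_eq_false_iff, decide_eq_false_iff_not]
        omega
    · by_cases hc : a = m ∧ b = m + 1 ∧ c = m + 2
      · obtain ⟨rfl, rfl, rfl⟩ := hc
        have := ((hs.succ (hF a)).succ (hF (a + 1))).succ (hF (a + 2))
        rw [show s + F a * 4 ^ a + F (a + 1) * 4 ^ (a + 1) + F (a + 1 + 1) * 4 ^ (a + 1 + 1) =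
          s + (F a + 4 * F (a + 1) + 16 * F (a + 2)) * 4 ^ a by ring] at this
        rw [Bool.or_eq_true, List.any_eq_true]
        refine Or.inr ⟨F a, hm _ (hF a) h2, List.any_eq_true.2 ⟨F (a + 1), hm _ (hF _) h3, ?_⟩⟩
        rw [h1, ih' _ _ this]
        simp [h4]
      · rw [Bool.or_eq_true]
        left
        simp only [Bool.not_eq_true', Bool.and_eq_false_iff, decide_eq_false_iff_not]
        omega

/-- The labels at a vertex of the base graph. -/
def baseInc (v : ℕ) : List ℕ :=
  if v < 1000 then [coreInc v 0, coreInc v 1, coreInc v 2]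
  else [1000 + (v - 1000 + 14) % 15, v, coreInc (sup (v - 1000) 0) 2]

theorem baseVertices_spec : ∀ p ∈ baseVertices, p.2.1 < p.2.2.1 ∧ p.2.2.1 < p.2.2.2 ∧
    (if p.1 < 1000 then p.1 < 294 ∧ ¬ IsSpecial p.1 else p.1 < 1015) ∧
    List.isPerm [baseEdges.getD p.2.1 0, baseEdges.getD p.2.2.1 0, baseEdges.getD p.2.2.2 0]
      (baseInc p.1) = true := by
  decide +kernel

/-- The colours of the edges of the base graph. -/
def baseColor (g : ℕ → Color) (l : ℕ) : Color := if l < 1000 then g l else flow g (l - 1000)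

/-- The three colours in the list are proper at a vertex. -/
def TriList (l : List Color) : Prop := (∀ a ∈ l, a ≠ 0) ∧ l.sum = 0

theorem triList_iff {a b c : Color} : TriList [a, b, c] ↔ Tri a b c := by
  simp [TriList, Tri, and_assoc, add_assoc]

theorem TriList.perm {l l' : List Color} (h : TriList l) (hl : l.Perm l') : TriList l' :=
  ⟨fun a ha => h.1 a (hl.mem_iff.2 ha), by rw [← hl.sum_eq]; exact h.2⟩

theorem coreInc_lt_of_ge (i : ℕ) (hi : i < 15) : coreInc (sup i 0) 2 < 1000 := by
  have := (coreInc_spec _ (sup_vertex i hi 0 (by omega) ⟨Or.inl rfl, Or.inr (by omega)⟩).1 2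
    (by omega)).1
  omega

theorem IsCoreColoring.triList_baseInc {g : ℕ → Color} (hg : IsCoreColoring g) {v : ℕ}
    (hv : if v < 1000 then v < 294 ∧ ¬ IsSpecial v else v < 1015) :
    TriList ((baseInc v).map (baseColor g)) := by
  unfold baseInc
  split_ifs at hv ⊢ with h
  · have hl : ∀ k < 3, baseColor g (coreInc v k) = g (coreInc v k) := fun k hk => by
      have := (coreInc_spec v hv.1 k hk).1
      exact if_pos (by omega)
    simp only [List.map_cons, List.map_nil]
    rw [hl 0 (by omega), hl 1 (by omega), hl 2 (by omega), triList_iff]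
    exact hg.tri v hv.1 hv.2
  · obtain ⟨i, rfl⟩ := Nat.exists_eq_add_of_le (not_lt.1 h)
    simp only [List.map_cons, List.map_nil, Nat.add_sub_cancel_left]
    have hi : i < 15 := by omega
    have h1 : baseColor g (1000 + (i + 14) % 15) = flow g ((i + 14) % 15) := by
      rw [baseColor, if_neg (by omega), Nat.add_sub_cancel_left]
    have h2 : baseColor g (1000 + i) = flow g i := by
      rw [baseColor, if_neg (by omega), Nat.add_sub_cancel_left]
    rw [h1, h2, baseColor, if_pos (coreInc_lt_of_ge i hi), triList_iff]
    exact hg.tri_flow hi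

theorem not_isCoreColoring (g : ℕ → Color) : ¬ IsCoreColoring g := by
  intro hg
  have h := search_eq_true (F := fun i => (baseColor g (baseEdges.getD i 0)).code)
    (fun i => code_lt _) baseVertices 0 0 ⟨by omega, by omega⟩ fun p hp => by
      obtain ⟨h1, h2, h3, h4⟩ := baseVertices_spec p hp
      have h5 := (hg.triList_baseInc h3).perm ((List.isPerm_iff.1 h4).map _).symm
      exact ⟨h1, h2, (triList_iff.1 h5).code⟩
  rw [search_baseVertices] at h
  exact Bool.noConfusion h

/-- The edges at the special vertices. -/
def danglings : List ℕ := [101, 159, 191, 195, 254, 291]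

/-- The end of an edge at a special vertex which is not special. -/
def freeEnd (e : ℕ) : ℕ :=
  let p := coreEnds.getD e (0, 0)
  if p.1 = 74 ∨ p.1 = 137 then p.2 else p.1

theorem danglings_spec : ∀ e ∈ danglings, e < 438 ∧ freeEnd e < 294 ∧
    (∀ k < 3, coreInc (freeEnd e) k ∈ danglings → coreInc (freeEnd e) k = e) ∧
    ((coreEnds.getD e (0, 0)).1 = freeEnd e ∧ IsSpecial (coreEnds.getD e (0, 0)).2 ∨
      (coreEnds.getD e (0, 0)).2 = freeEnd e ∧ IsSpecial (coreEnds.getD e (0, 0)).1) := by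
  decide +kernel

theorem coreInc_special : ∀ k < 3, coreInc 74 k ∈ danglings ∧ coreInc 137 k ∈ danglings := by
  decide +kernel

theorem edgeOfLabel_mem_danglings {T e : ℕ} : edgeOfLabel T e ∈ danglings ↔ e ∈ danglings := by
  have h : ∀ e ∈ danglings, e < 438 := fun e he => (danglings_spec e he).1
  unfold edgeOfLabel
  split_ifs with h1
  · rfl
  · exact ⟨fun h2 => absurd (h _ h2) (by omega), fun h2 => absurd (h _ h2) (by omega)⟩

theorem mem_danglings_of_isEnd {T e v : ℕ} (he : e < 441 + 6 * T) (hv : IsSpecial v)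
    (h : IsEnd T e v) : e ∈ danglings := by
  obtain ⟨-, k, hk, rfl⟩ := exists_inc_eq he h
  obtain ⟨h1, h2⟩ := coreInc_special k hk
  rcases hv with rfl | rfl <;> rw [inc_core (by omega), edgeOfLabel_mem_danglings] <;> assumption

theorem eq_freeEnd {T e v : ℕ} (he : e ∈ danglings) (hv : ¬ IsSpecial v) (h : IsEnd T e v) :
    v = freeEnd e := by
  obtain ⟨h1, -, -, h2⟩ := danglings_spec e he
  rw [IsEnd, ends_core h1] at h
  rcases h2 with ⟨h2, h3⟩ | ⟨h2, h3⟩ <;> rcases h with rfl | rfl <;> first | assumption | contradiction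

/-- The colouring obtained by choosing the colours of the dangling edges properly. -/
def extend (T : ℕ) (h : ℕ → Color) (e : ℕ) : Color :=
  let h₀ := fun e => if e ∈ danglings then 0 else h e
  if e ∈ danglings then
    h₀ (inc T (freeEnd e) 0) + h₀ (inc T (freeEnd e) 1) + h₀ (inc T (freeEnd e) 2)
  else h e

theorem tri_of_two : ∀ {a b : Color}, a ≠ 0 → b ≠ 0 → a ≠ b →
    Tri (0 + a + b) a b ∧ Tri a (a + 0 + b) b ∧ Tri a b (a + b + 0) := by
  decide +kernel

theorem tri_extend {T : ℕ} (hT : 0 < T) {h : ℕ → Color}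
    (hh : ∀ e < 441 + 6 * T, ∀ e' < 441 + 6 * T, e ∉ danglings → e' ∉ danglings →
      ∀ v : ℕ, IsEnd T e v → IsEnd T e' v → h e ≠ 0 ∧ (e ≠ e' → h e ≠ h e'))
    {v : ℕ} (hv : v < 294 + 4 * T) (hs : ¬ IsSpecial v) :
    Tri (extend T h (inc T v 0)) (extend T h (inc T v 1)) (extend T h (inc T v 2)) := by
  have hpair : ∀ j < 3, ∀ k < 3, inc T v j ∉ danglings → inc T v k ∉ danglings →
      h (inc T v j) ≠ 0 ∧ (inc T v j ≠ inc T v k → h (inc T v j) ≠ h (inc T v k)) :=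
    fun j hj k hk h1 h2 => hh _ (inc_lt hv hj) _ (inc_lt hv hk) h1 h2 v (isEnd_inc hv hj)
      (isEnd_inc hv hk)
  obtain ⟨n1, n2, n3⟩ := inc_ne hT hv
  have hfree : ∀ k < 3, inc T v k ∈ danglings → v = freeEnd (inc T v k) :=
    fun k hk hd => eq_freeEnd hd hs (isEnd_inc hv hk)
  have honly : ∀ k < 3, inc T v k ∈ danglings → ∀ j < 3, inc T v j ∈ danglings →
      inc T v j = inc T v k := by
    intro k hk hd j hj hd'
    have hvk := hfree k hk hd
    obtain ⟨h1, h2, h3, -⟩ := danglings_spec _ hd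
    rw [← hvk] at h2 h3
    have h4 := h3 j hj (by rwa [inc_core h2, edgeOfLabel_mem_danglings] at hd')
    rw [inc_core h2, h4, edgeOfLabel, if_pos (by omega)]
  by_cases d0 : inc T v 0 ∈ danglings
  · have d1 : inc T v 1 ∉ danglings := fun hd => n1 (honly _ (by omega) hd _ (by omega) d0)
    have d2 : inc T v 2 ∉ danglings := fun hd => n2 (honly _ (by omega) hd _ (by omega) d0)
    simp only [extend, d0, d1, d2, ← hfree 0 (by omega) d0, if_true, if_false]
    exact (tri_of_two (hpair 1 (by omega) 1 (by omega) d1 d1).1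
      (hpair 2 (by omega) 2 (by omega) d2 d2).1 ((hpair 1 (by omega) 2 (by omega) d1 d2).2 n3)).1
  by_cases d1 : inc T v 1 ∈ danglings
  · have d2 : inc T v 2 ∉ danglings := fun hd => n3 (honly _ (by omega) hd _ (by omega) d1)
    simp only [extend, d0, d1, d2, ← hfree 1 (by omega) d1, if_true, if_false]
    exact (tri_of_two (hpair 0 (by omega) 0 (by omega) d0 d0).1
      (hpair 2 (by omega) 2 (by omega) d2 d2).1
      ((hpair 0 (by omega) 2 (by omega) d0 d2).2 n2)).2.1
  by_cases d2 : inc T v 2 ∈ danglings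
  · simp only [extend, d0, d1, d2, ← hfree 2 (by omega) d2, if_true, if_false]
    exact (tri_of_two (hpair 0 (by omega) 0 (by omega) d0 d0).1
      (hpair 1 (by omega) 1 (by omega) d1 d1).1
      ((hpair 0 (by omega) 1 (by omega) d0 d1).2 n1)).2.2
  simp only [extend, d0, d1, d2, if_false]
  exact tri_of_ne _ _ _ ⟨(hpair 0 (by omega) 1 (by omega) d0 d1).1,
    (hpair 1 (by omega) 1 (by omega) d1 d1).1, (hpair 2 (by omega) 2 (by omega) d2 d2).1,
    (hpair 0 (by omega) 1 (by omega) d0 d1).2 n1, (hpair 0 (by omega) 2 (by omega) d0 d2).2 n2,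
    (hpair 1 (by omega) 2 (by omega) d1 d2).2 n3⟩

theorem isCoreColoring_of_tri {m : ℕ} {f : ℕ → Color}
    (hf : ∀ v < 294 + 4 * (2 * m + 1), ¬ IsSpecial v →
      Tri (f (inc (2 * m + 1) v 0)) (f (inc (2 * m + 1) v 1)) (f (inc (2 * m + 1) v 2))) :
    IsCoreColoring fun e => f (edgeOfLabel (2 * m + 1) e) := by
  have htile : ∀ t < 2 * m + 1, tau (f (444 + 6 * t)) (f (445 + 6 * t)) (f (446 + 6 * t)) =
      tauStep (tau (f (438 + 6 * t)) (f (439 + 6 * t)) (f (440 + 6 * t))) := by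
    intro t ht
    have hl : ∀ j < 3, Tri (f (438 + 6 * t + j)) (f (444 + 6 * t + j)) (f (441 + 6 * t + j)) := by
      intro j hj
      have := hf (294 + 4 * t + j) (by omega) (by unfold IsSpecial; omega)
      obtain ⟨h0, h1, h2⟩ := inc_leaf (T := 2 * m + 1) (t := t) hj
      rwa [h0, h1, h2] at this
    have hc := hf (297 + 4 * t) (by omega) (by unfold IsSpecial; omega)
    simp only [inc_centre] at hc
    have := (tau_of_tri (hl 0 (by omega)) (hl 1 (by omega)) (hl 2 (by omega)) hc).1
    simpa only [Nat.add_right_comm _ (6 * t), Nat.reduceAdd] using this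
  have hchain : ∀ s ≤ m, tau (f (438 + 12 * s)) (f (439 + 12 * s)) (f (440 + 12 * s)) =
      tau (f 438) (f 439) (f 440) := by
    intro s
    induction s with
    | zero => intro; rfl
    | succ s ih =>
      intro hs
      have h1 := htile (2 * s) (by omega)
      have h2 := htile (2 * s + 1) (by omega)
      rw [show 438 + 6 * (2 * s + 1) = 444 + 6 * (2 * s) by omega,
        show 439 + 6 * (2 * s + 1) = 445 + 6 * (2 * s) by omega,
        show 440 + 6 * (2 * s + 1) = 446 + 6 * (2 * s) by omega, h1, tauStep_tauStep] at h2
      rw [show 438 + 12 * (s + 1) = 444 + 6 * (2 * s + 1) by omega,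
        show 439 + 12 * (s + 1) = 445 + 6 * (2 * s + 1) by omega,
        show 440 + 12 * (s + 1) = 446 + 6 * (2 * s + 1) by omega, h2, ← ih (by omega)]
      congr 2 <;> omega
  refine ⟨fun v hv hs => ?_, ?_⟩
  · have := hf v (by omega) hs
    rwa [inc_core hv, inc_core hv, inc_core hv] at this
  · have h1 := htile (2 * m) (by omega)
    rw [show 438 + 6 * (2 * m) = 438 + 12 * m by omega,
      show 439 + 6 * (2 * m) = 439 + 12 * m by omega,
      show 440 + 6 * (2 * m) = 440 + 12 * m by omega, hchain m le_rfl] at h1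
    have e : ∀ k < 3, edgeOfLabel (2 * m + 1) (441 + k) = 444 + k + 6 * (2 * m) := fun k hk => by
      unfold edgeOfLabel
      rw [if_neg (by omega)]
      omega
    have e0 := e 0 (by omega)
    have e1 := e 1 (by omega)
    have e2 := e 2 (by omega)
    simp only [Nat.reduceAdd, Nat.add_zero] at e0 e1 e2
    rw [e0, e1, e2]
    exact h1

theorem not_threeEdgeColorable_induce (m : ℕ) :
    ¬ ThreeEdgeColorable ((graph (2 * m + 1)).induce
      ({⟨74, by omega⟩, ⟨137, by omega⟩}ᶜ : Set (Fin (294 + 4 * (2 * m + 1))))) := by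
  intro h
  obtain ⟨f, hf⟩ := exists_coloring_of_threeEdgeColorable (by omega) h
  have hS : ∀ e < 441 + 6 * (2 * m + 1), e ∉ danglings →
      ∀ v : Fin (294 + 4 * (2 * m + 1)), IsEnd (2 * m + 1) e v →
        v ∈ ({⟨74, by omega⟩, ⟨137, by omega⟩}ᶜ : Set (Fin (294 + 4 * (2 * m + 1)))) := by
    rintro e he hd v hv (hv' | hv')
    · exact hd (mem_danglings_of_isEnd he (Or.inl (congrArg Fin.val hv')) hv)
    · exact hd (mem_danglings_of_isEnd he (Or.inr (congrArg Fin.val hv')) hv)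
  exact not_isCoreColoring _ (isCoreColoring_of_tri fun v hv hs =>
    tri_extend (by omega) (fun e he e' he' hd hd' => hf e he e' he' (hS e he hd) (hS e' he' hd'))
      hv hs)

theorem not_bicritical_graph (m : ℕ) : ¬ Bicritical (graph (2 * m + 1)) := fun h =>
  not_threeEdgeColorable_induce m (h _ _ (by simp [Fin.ext_iff]))

theorem threeEdgeColorable_induce {V : Type*} {G : SimpleGraph V} (h : ThreeEdgeColorable G)
    (S : Set V) : ThreeEdgeColorable (G.induce S) := by
  obtain ⟨f, hf⟩ := h
  have hmem : ∀ e ∈ (G.induce S).edgeSet, e.map Subtype.val ∈ G.edgeSet := by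
    intro e
    induction e with
    | _ x y => exact id
  refine ⟨fun e => f (e.map Subtype.val), fun e₁ h₁ e₂ h₂ hne ⟨v, hv₁, hv₂⟩ =>
    hf _ (hmem _ h₁) _ (hmem _ h₂) (fun h => hne (Sym2.map.injective Subtype.val_injective h))
      ⟨v, Sym2.mem_map.2 ⟨v, hv₁, rfl⟩, Sym2.mem_map.2 ⟨v, hv₂, rfl⟩⟩⟩

theorem not_threeEdgeColorable_graph (m : ℕ) : ¬ ThreeEdgeColorable (graph (2 * m + 1)) :=
  fun h => not_threeEdgeColorable_induce m (threeEdgeColorable_induce h _)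

theorem testBit_add_two_pow {a i j : ℕ} (h : a.testBit i = false) (hj : j ≠ i) :
    (a + 2 ^ i).testBit j = a.testBit j := by
  have hr : a / 2 ^ i % 2 = 0 := by
    rw [Nat.testBit_eq_decide_div_mod_eq, decide_eq_false_iff_not] at h
    omega
  have hlt := Nat.mod_lt a (show 0 < 2 ^ i by positivity)
  obtain ⟨q, hq⟩ : ∃ q, a / 2 ^ i = 2 * q := ⟨a / 2 ^ i / 2, by omega⟩
  have ha : a = 2 ^ (i + 1) * q + a % 2 ^ i := by
    conv_lhs => rw [← Nat.div_add_mod a (2 ^ i), hq]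
    ring
  rw [ha, add_assoc, Nat.testBit_two_pow_mul_add _ (by rw [pow_succ]; omega),
    Nat.testBit_two_pow_mul_add _ (by rw [pow_succ]; omega)]
  split_ifs with h1
  · rw [add_comm, Nat.testBit_two_pow_add_gt (by omega)]
  · rfl

/-- The number whose bits are, for all `a < 2 ^ n`, the bits `i` of `a`. -/
def mask : ℕ → ℕ → ℕ
  | 0, _ => 0
  | n + 1, i => if i = n then (2 ^ 2 ^ n - 1) <<< 2 ^ n else mask n i ||| mask n i <<< 2 ^ n

theorem mask_lt (n i : ℕ) : mask n i < 2 ^ 2 ^ n := by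
  induction n with
  | zero => simp [mask]
  | succ n ih =>
    unfold mask
    have h : 2 ^ 2 ^ (n + 1) = 2 ^ 2 ^ n * 2 ^ 2 ^ n := by rw [pow_succ, Nat.mul_two, pow_add]
    have hp : 0 < 2 ^ 2 ^ n := by positivity
    rw [h, Nat.shiftLeft_eq, Nat.shiftLeft_eq]
    split_ifs
    · exact Nat.mul_lt_mul_of_pos_right (by omega) hp
    · rw [← h]
      exact Nat.or_lt_two_pow (h ▸ ih.trans_le (Nat.le_mul_of_pos_right _ hp))
        (h ▸ Nat.mul_lt_mul_of_pos_right ih hp)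

theorem testBit_mask {n i a : ℕ} (hi : i < n) (ha : a < 2 ^ n) :
    (mask n i).testBit a = a.testBit i := by
  induction n generalizing a with
  | zero => omega
  | succ n ih =>
    unfold mask
    rw [pow_succ] at ha
    split_ifs with h
    · subst h
      rw [Nat.testBit_shiftLeft, Nat.testBit_two_pow_sub_one, Nat.testBit_eq_decide_div_mod_eq]
      by_cases h : a < 2 ^ i
      · simp [h, Nat.div_eq_of_lt h]
      · have h1 : a / 2 ^ i = 1 := by
          apply Nat.div_eq_of_lt_le <;> omega
        have h2 : a - 2 ^ i < 2 ^ i := by omega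
        simp [h1, h2, not_lt.1 h]
    · rw [Nat.testBit_or, Nat.testBit_shiftLeft]
      by_cases h1 : a < 2 ^ n
      · rw [ih (by omega) h1]
        simp [h1]
      · rw [Nat.testBit_lt_two_pow ((mask_lt n i).trans_le
          (Nat.pow_le_pow_right (by omega) (not_lt.1 h1))), ih (by omega) (by omega)]
        obtain ⟨b, rfl⟩ := Nat.exists_eq_add_of_le (not_lt.1 h1)
        simp [Nat.testBit_two_pow_add_gt (show i < n by omega)]

/-- The image of the set of bits under clearing the bit `i` of the positions. -/
def clear (X i : ℕ) : ℕ := (X ^^^ (X &&& mask 16 i)) ||| (X &&& mask 16 i) >>> 2 ^ i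

theorem testBit_clear {X i a : ℕ} (hX : X.testBit a = true) (hi : i < 13) (ha : a < 2 ^ 16) :
    ∃ b, (clear X i).testBit b = true ∧ b.testBit i = false ∧
      ∀ j, j ≠ i → b.testBit j = a.testBit j := by
  have hm := testBit_mask (n := 16) (by omega : i < 16) ha
  unfold clear
  cases h : a.testBit i with
  | false =>
    refine ⟨a, ?_, h, fun _ _ => rfl⟩
    simp [hX, hm, h]
  | true =>
    obtain ⟨b, rfl⟩ := Nat.exists_eq_add_of_le (Nat.ge_two_pow_of_testBit h)
    have hb : b.testBit i = false := by
      rw [Nat.testBit_two_pow_add_eq] at h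
      simpa using h
    refine ⟨b, ?_, hb, fun j hj => ?_⟩
    · rw [Nat.testBit_or, Nat.testBit_shiftRight, Nat.testBit_and, hX, hm, h]
      simp
    · rw [add_comm, testBit_add_two_pow hb hj]

/-- The position `a` stands for the slot values `σ` and the number `d` of crossing edges. -/
def Codes (a : ℕ) (σ : ℕ → Bool) (d : ℕ) : Prop := (∀ i < 13, a.testBit i = σ i) ∧ a >>> 13 = d

theorem Codes.lt {a d : ℕ} {σ : ℕ → Bool} (h : Codes a σ d) (hd : d < 6) : a < 6 * 2 ^ 13 := by
  have := h.2
  rw [Nat.shiftRight_eq_div_pow] at this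
  omega

theorem Codes.of_testBit {a b i d : ℕ} {σ τ : ℕ → Bool} (h : Codes a σ d) (hi : i < 13)
    (hb : ∀ j, j ≠ i → b.testBit j = a.testBit j) (hbi : b.testBit i = τ i)
    (hτ : ∀ j < 13, j ≠ i → τ j = σ j) : Codes b τ d := by
  refine ⟨fun j hj => ?_, ?_⟩
  · rcases eq_or_ne j i with rfl | hji
    · exact hbi
    · rw [hb j hji, h.1 j hj, hτ j hj hji]
  · rw [← h.2]
    apply Nat.eq_of_testBit_eq
    intro j
    rw [Nat.testBit_shiftRight, Nat.testBit_shiftRight, hb _ (by omega)]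

theorem exists_codes_set {X a i d : ℕ} {σ τ : ℕ → Bool} (hX : X.testBit a = true)
    (h : Codes a σ d) (hd : d < 6) (hi : i < 13) (hτ : ∀ j < 13, j ≠ i → τ j = σ j) :
    ∃ b, Codes b τ d ∧ if τ i = true then ((clear X i) <<< 2 ^ i).testBit b = true
      else (clear X i).testBit b = true := by
  obtain ⟨b, hb, hbi, hba⟩ := testBit_clear hX hi ((h.lt hd).trans (by norm_num))
  cases hi' : τ i with
  | false => exact ⟨b, h.of_testBit hi hba (by rw [hbi, hi']) hτ, by simpa using hb⟩
  | true =>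
    refine ⟨b + 2 ^ i, h.of_testBit hi (fun j hj => ?_) ?_ hτ, ?_⟩
    · rw [testBit_add_two_pow hbi hj, hba j hj]
    · rw [add_comm, Nat.testBit_two_pow_add_eq, hbi, hi', Bool.not_false]
    · simpa [Nat.testBit_shiftLeft] using hb

/-- The effect of an edge between the slots `i` and `j`. -/
def edgeBits (i j X : ℕ) : ℕ :=
  ((X ^^^ (X &&& (mask 16 i ^^^ mask 16 j))) |||
    (X &&& (mask 16 i ^^^ mask 16 j)) <<< 2 ^ 13) % 2 ^ (6 * 2 ^ 13)

theorem exists_codes_edgeBits {X a i j d : ℕ} {σ : ℕ → Bool} (hX : X.testBit a = true)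
    (h : Codes a σ d) (hi : i < 13) (hj : j < 13) (hd : d + (σ i ^^ σ j).toNat < 6) :
    ∃ b, Codes b σ (d + (σ i ^^ σ j).toNat) ∧ (edgeBits i j X).testBit b = true := by
  have ha := h.lt (by omega)
  have hi' := testBit_mask (n := 16) (by omega : i < 16) (a := a) (by omega)
  have hj' := testBit_mask (n := 16) (by omega : j < 16) (a := a) (by omega)
  rw [h.1 i hi] at hi'
  rw [h.1 j hj] at hj'
  have h2 := h.2
  rw [Nat.shiftRight_eq_div_pow] at h2
  cases hx : σ i ^^ σ j with
  | false =>
    refine ⟨a, by simpa using h, ?_⟩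
    simp only [edgeBits, Nat.testBit_mod_two_pow, Nat.testBit_or, Nat.testBit_xor,
      Nat.testBit_and, hi', hj', hx, hX, ha]
    simp
  | true =>
    rw [hx] at hd
    simp only [Bool.toNat_true] at hd ⊢
    refine ⟨a + 2 ^ 13, ⟨fun k hk => ?_, ?_⟩, ?_⟩
    · rw [add_comm, Nat.testBit_two_pow_add_gt hk, h.1 k hk]
    · rw [Nat.shiftRight_eq_div_pow]
      omega
    · have : a + 2 ^ 13 < 6 * 2 ^ 13 := by omega
      simp only [edgeBits, Nat.testBit_mod_two_pow, Nat.testBit_or, Nat.testBit_shiftLeft,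
        Nat.add_sub_cancel, Nat.testBit_xor, Nat.testBit_and, hi', hj', hx, hX, this]
      simp

/-- The effect of copying the slot `i` to the slot `j`. -/
def copyBits (i j X : ℕ) : ℕ :=
  (clear X j ^^^ (clear X j &&& mask 16 i)) ||| (clear X j &&& mask 16 i) <<< 2 ^ j

theorem exists_codes_copyBits {X a i j d : ℕ} {σ τ : ℕ → Bool} (hX : X.testBit a = true)
    (h : Codes a σ d) (hi : i < 13) (hj : j < 13) (hij : i ≠ j) (hd : d < 6)
    (hτ : ∀ k < 13, k ≠ j → τ k = σ k) (hτj : τ j = σ i) :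
    ∃ b, Codes b τ d ∧ (copyBits i j X).testBit b = true := by
  have hi' : ∀ b, b < 2 ^ 16 → (mask 16 i).testBit b = b.testBit i :=
    fun b hb => testBit_mask (by omega) hb
  cases hc : σ i with
  | false =>
    obtain ⟨b, hb, hb'⟩ := exists_codes_set hX h hd hj hτ
    rw [if_neg (by simp [hτj, hc])] at hb'
    refine ⟨b, hb, ?_⟩
    rw [copyBits, Nat.testBit_or, Nat.testBit_xor, Nat.testBit_and, hb',
      hi' b ((hb.lt hd).trans (by norm_num)), hb.1 i hi, hτ i hi hij, hc]
    rfl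
  | true =>
    obtain ⟨b, hb, hb'⟩ := exists_codes_set hX h hd hj hτ
    rw [if_pos (by simp [hτj, hc]), Nat.testBit_shiftLeft, Bool.and_eq_true,
      decide_eq_true_iff] at hb'
    obtain ⟨c, rfl⟩ := Nat.exists_eq_add_of_le hb'.1
    rw [Nat.add_sub_cancel_left] at hb'
    have hcj : c.testBit j = false := by
      have := hb.1 j hj
      rw [hτj, hc, Nat.testBit_two_pow_add_eq] at this
      simpa using this
    have hci : c.testBit i = true := by
      rw [← testBit_add_two_pow hcj hij, add_comm, hb.1 i hi, hτ i hi hij, hc]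
    refine ⟨2 ^ j + c, hb, ?_⟩
    have := (Nat.le_add_left c (2 ^ j)).trans_lt (hb.lt hd)
    rw [copyBits, Nat.testBit_or, Nat.testBit_shiftLeft, Nat.add_sub_cancel_left,
      Nat.testBit_and, hb'.2, hi' c (by omega), hci]
    simp

/-- Five values, the last of which stands for all indices from `4` on. -/
structure Five (α : Type) where
  x₀ : α
  x₁ : α
  x₂ : α
  x₃ : α
  x₄ : α

namespace Five

variable {α β : Type}

/-- The value at an index. -/
def get (t : Five α) : ℕ → α
  | 0 => t.x₀
  | 1 => t.x₁
  | 2 => t.x₂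
  | 3 => t.x₃
  | _ => t.x₄

/-- The pointwise image. -/
def map (f : α → β) (t : Five α) : Five β := ⟨f t.x₀, f t.x₁, f t.x₂, f t.x₃, f t.x₄⟩

/-- The pointwise combination. -/
def zip (f : α → α → α) (s t : Five α) : Five α :=
  ⟨f s.x₀ t.x₀, f s.x₁ t.x₁, f s.x₂ t.x₂, f s.x₃ t.x₃, f s.x₄ t.x₄⟩

/-- The effect of increasing the index. -/
def shift (z : α) (f : α → α → α) (t : Five α) : Five α := ⟨z, t.x₀, t.x₁, t.x₂, f t.x₃ t.x₄⟩

theorem get_map (f : α → β) (t : Five α) (i : ℕ) : (t.map f).get i = f (t.get i) := by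
  rcases i with _ | _ | _ | _ | i <;> rfl

theorem get_zip (f : α → α → α) (s t : Five α) (i : ℕ) :
    (zip f s t).get i = f (s.get i) (t.get i) := by
  rcases i with _ | _ | _ | _ | i <;> rfl

theorem get_shift {P : α → Prop} {z : α} {f : α → α → α} (hf : ∀ a b, P a ∨ P b → P (f a b))
    {t : Five α} {i : ℕ} (h : P (t.get i)) : P ((t.shift z f).get (i + 1)) := by
  rcases i with _ | _ | _ | _ | i
  · exact h
  · exact h
  · exact h
  · exact hf _ _ (Or.inl h)
  · exact hf _ _ (Or.inr h)

theorem get_of_le (t : Five α) {i : ℕ} (h : 4 ≤ i) : t.get i = t.x₄ := by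
  obtain ⟨i, rfl⟩ := Nat.exists_eq_add_of_le' h
  rfl

end Five

/-- A table of sets of positions, indexed by the numbers of vertices on the two sides. -/
abbrev Table : Type := Five (Five ℕ)

/-- A step of a sweep through a graph: a vertex is stored in a slot, an edge between the vertices in
two slots is counted, or the vertex in the slot `i` is copied to the slot `j`. -/
inductive SweepStep
  | intro (i v : ℕ)
  | edge (i j e : ℕ)
  | copy (i j : ℕ)

namespace SweepStep

/-- The effect of a step on a table. -/
def onTable (t : Table) : SweepStep → Table
  | intro i _ =>
    let s := t.map (·.map (clear · i))
    (s.map (·.shift 0 (· ||| ·))).zip (.zip (· ||| ·))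
      ((s.map (·.map (· <<< 2 ^ i))).shift ⟨0, 0, 0, 0, 0⟩ (.zip (· ||| ·)))
  | edge i j _ => t.map (·.map (edgeBits i j))
  | copy i j => t.map (·.map (copyBits i j))

/-- The effect of a step on the slots. -/
def onSlots (m : List ℕ) : SweepStep → List ℕ
  | intro i v => m.set i v
  | edge _ _ _ => m
  | copy i j => m.set j (m.getD i 0)

/-- The new vertex of a step. -/
def vertices : SweepStep → List ℕ
  | intro _ v => [v]
  | _ => []

/-- The counted edge of a step with its ends. -/
def edges (m : List ℕ) : SweepStep → List (ℕ × ℕ × ℕ)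
  | edge i j e => [(e, m.getD i 0, m.getD j 0)]
  | _ => []

/-- The slots of a step exist. -/
def Valid : SweepStep → Prop
  | intro i _ => i < 13
  | edge i j _ => i < 13 ∧ j < 13
  | copy i j => i < 13 ∧ j < 13 ∧ i ≠ j

instance : DecidablePred Valid := fun s => by cases s <;> unfold Valid <;> infer_instance

end SweepStep

/-- The number of listed vertices `v` with `σ v = b`. -/
def countSide (σ : ℕ → Bool) (b : Bool) (l : List ℕ) : ℕ := (l.map fun v => (σ v == b).toNat).sum

/-- The number of listed edges whose ends are on different sides. -/
def countCross (σ : ℕ → Bool) (l : List (ℕ × ℕ × ℕ)) : ℕ :=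
  (l.map fun p => (σ p.2.1 ^^ σ p.2.2).toNat).sum

/-- The table has an entry for the given slots and numbers, unless there are too many crossing
edges. -/
def Table.Has (t : Table) (σ : ℕ → Bool) (m : List ℕ) (A B d : ℕ) : Prop :=
  m.length = 13 ∧ (d < 6 → ∃ a, ((t.get A).get B).testBit a = true ∧
    Codes a (fun i => σ (m.getD i 0)) d)

theorem getD_set {m : List ℕ} {i j v : ℕ} (hi : i < m.length) :
    (m.set i v).getD j 0 = if j = i then v else m.getD j 0 := by
  simp only [List.getD_eq_getElem?_getD, List.getElem?_set, hi]
  split_ifs with h1 h2 h2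
  · rfl
  · exact absurd h1.symm h2
  · exact absurd h2.symm h1
  · rfl

theorem Table.Has.step {t : Table} {σ : ℕ → Bool} {m : List ℕ} {A B d : ℕ}
    (h : t.Has σ m A B d) (s : SweepStep) (hs : s.Valid) :
    (s.onTable t).Has σ (s.onSlots m) (A + countSide σ true s.vertices)
      (B + countSide σ false s.vertices) (d + countCross σ (s.edges m)) := by
  obtain ⟨hm, h⟩ := h
  have hor : ∀ b x y : ℕ, x.testBit b = true ∨ y.testBit b = true → (x ||| y).testBit b = true :=
    fun b x y h => by rw [Nat.testBit_or, Bool.or_eq_true]; exact h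
  cases s with
  | intro i v =>
    refine ⟨by simp [SweepStep.onSlots, hm], fun hd => ?_⟩
    obtain ⟨a, ha, hc⟩ := h (by simpa [countCross, SweepStep.edges] using hd)
    obtain ⟨b, hb, hb'⟩ := exists_codes_set (τ := fun j => σ ((m.set i v).getD j 0)) ha hc
      (by simpa [countCross, SweepStep.edges] using hd) hs
      fun j _ hj => by simp only [getD_set (hm.symm ▸ hs : i < m.length), if_neg hj]
    refine ⟨b, ?_, by simpa [countCross, SweepStep.edges, SweepStep.onSlots] using hb⟩
    simp only [getD_set (hm.symm ▸ hs : i < m.length), if_true] at hb'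
    simp only [SweepStep.onTable, SweepStep.vertices, countSide, List.map_cons, List.map_nil,
      List.sum_singleton, Five.get_zip]
    apply hor
    cases hv : σ v with
    | false =>
      left
      rw [hv, if_neg (by simp)] at hb'
      simp only [beq_self_eq_true, Bool.toNat_true, Five.get_map]
      refine Five.get_shift (P := fun x : ℕ => x.testBit b = true) (hor b) ?_
      rw [Five.get_map]
      exact hb'
    | true =>
      right
      rw [hv, if_pos rfl] at hb'
      simp only [beq_self_eq_true, Bool.toNat_true]
      refine Five.get_shift (P := fun x : Five ℕ => (x.get _).testBit b = true)
        (fun x y hxy => by rw [Five.get_zip]; exact hor _ _ _ hxy) ?_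
      simp only [Five.get_map]
      exact hb'
  | edge i j e =>
    refine ⟨hm, fun hd => ?_⟩
    simp only [countCross, SweepStep.edges, List.map_cons, List.map_nil,
      List.sum_singleton] at hd ⊢
    obtain ⟨a, ha, hc⟩ := h (by omega)
    obtain ⟨b, hb, hb'⟩ := exists_codes_edgeBits ha hc hs.1 hs.2 hd
    exact ⟨b, by rw [SweepStep.onTable, Five.get_map, Five.get_map]; exact hb', hb⟩
  | copy i j =>
    refine ⟨by simp [SweepStep.onSlots, hm], fun hd => ?_⟩
    have hd' : d < 6 := by simpa [countCross, SweepStep.edges] using hd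
    obtain ⟨a, ha, hc⟩ := h hd'
    have hj : j < m.length := hm.symm ▸ hs.2.1
    obtain ⟨b, hb, hb'⟩ := exists_codes_copyBits
      (τ := fun k => σ ((m.set j (m.getD i 0)).getD k 0)) ha hc hs.1 hs.2.1 hs.2.2 hd'
      (fun k _ hk => by simp only [getD_set hj, if_neg hk]) (by simp only [getD_set hj, if_true])
    exact ⟨b, by rw [SweepStep.onTable, Five.get_map, Five.get_map]; exact hb',
      by simpa [countCross, SweepStep.edges, SweepStep.onSlots] using hb⟩

/-- A function applied to the value of a number. -/
def force {α : Type} (n : ℕ) (f : ℕ → α) : α := Nat.rec (f 0) (fun k _ => f (k + 1)) n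

theorem force_eq {α : Type} (n : ℕ) (f : ℕ → α) : force n f = f n := by cases n <;> rfl

/-- A function applied to the five values of a row. -/
def forceRow {α : Type} (t : Five ℕ) (f : Five ℕ → α) : α :=
  force t.x₀ fun x₀ => force t.x₁ fun x₁ => force t.x₂ fun x₂ => force t.x₃ fun x₃ =>
    force t.x₄ fun x₄ => f ⟨x₀, x₁, x₂, x₃, x₄⟩

/-- A function applied to the values of a table. -/
def forceTable {α : Type} (t : Table) (f : Table → α) : α :=
  forceRow t.x₀ fun x₀ => forceRow t.x₁ fun x₁ => forceRow t.x₂ fun x₂ => forceRow t.x₃ fun x₃ =>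
    forceRow t.x₄ fun x₄ => f ⟨x₀, x₁, x₂, x₃, x₄⟩

theorem forceTable_eq {α : Type} (t : Table) (f : Table → α) : forceTable t f = f t := by
  simp only [forceTable, forceRow, force_eq]

/-- The effect of a sweep on a table, continued by a function. -/
def sweepTable {α : Type} (f : Table → α) : List SweepStep → Table → α
  | [], t => f t
  | s :: l, t => forceTable (s.onTable t) (sweepTable f l)

/-- The effect of a sweep on the slots. -/
def sweepSlots : List SweepStep → List ℕ → List ℕ
  | [], m => m
  | s :: l, m => sweepSlots l (s.onSlots m)

/-- The edges counted in a sweep. -/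
def sweepEdges : List SweepStep → List ℕ → List (ℕ × ℕ × ℕ)
  | [], _ => []
  | s :: l, m => s.edges m ++ sweepEdges l (s.onSlots m)

theorem sweepTable_eq {α : Type} (f : Table → α) (l : List SweepStep) (t : Table) :
    sweepTable f l t = f (sweepTable id l t) := by
  induction l generalizing t with
  | nil => rfl
  | cons s l ih =>
    simp only [sweepTable, forceTable_eq]
    exact ih _

theorem countSide_append (σ : ℕ → Bool) (b : Bool) (l l' : List ℕ) :
    countSide σ b (l ++ l') = countSide σ b l + countSide σ b l' := by
  simp [countSide]

theorem countCross_append (σ : ℕ → Bool) (l l' : List (ℕ × ℕ × ℕ)) :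
    countCross σ (l ++ l') = countCross σ l + countCross σ l' := by
  simp [countCross]

theorem Table.Has.sweep {σ : ℕ → Bool} (l : List SweepStep) (hl : ∀ s ∈ l, s.Valid) :
    ∀ {t : Table} {m : List ℕ} {A B d : ℕ}, t.Has σ m A B d →
    (sweepTable id l t).Has σ (sweepSlots l m)
      (A + countSide σ true (l.flatMap SweepStep.vertices))
      (B + countSide σ false (l.flatMap SweepStep.vertices)) (d + countCross σ (sweepEdges l m)) := by
  induction l with
  | nil => intro t m A B d h; exact h
  | cons s l ih =>
    intro t m A B d h
    have := ih (fun s hs => hl s (List.mem_cons_of_mem _ hs)) (h.step s (hl s List.mem_cons_self))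
    simp only [sweepTable, forceTable_eq, sweepSlots, sweepEdges, List.flatMap_cons,
      countSide_append, countCross_append, ← add_assoc]
    exact this

/-- The sweep through the first tile. -/
def initSweep : List SweepStep := [
  .intro 0 294, .intro 1 295, .intro 2 296, .intro 6 297, .edge 6 0 441, .edge 6 1 442,
  .edge 6 2 443, .copy 0 3, .copy 1 4, .copy 2 5]

/-- The sweep through the tile `t`. -/
def tileSweep (t : ℕ) : List SweepStep := [
  .intro 6 (297 + 4 * t),
  .intro 7 (294 + 4 * t), .edge 6 7 (441 + 6 * t), .edge 3 7 (438 + 6 * t), .copy 7 3,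
  .intro 7 (295 + 4 * t), .edge 6 7 (442 + 6 * t), .edge 4 7 (439 + 6 * t), .copy 7 4,
  .intro 7 (296 + 4 * t), .edge 6 7 (443 + 6 * t), .edge 5 7 (440 + 6 * t), .copy 7 5]

/-- The sweep through the fixed part. -/
def coreSweep : List SweepStep := [
  .intro 6 0, .edge 4 6 442, .intro 4 1, .edge 0 4 438, .intro 0 2, .edge 5 0 443, .intro 5 3,
  .edge 6 5 0, .edge 2 5 440, .intro 2 4, .edge 3 2 441, .intro 3 5, .edge 6 3 1, .edge 0 3 2,
  .intro 6 6, .edge 1 6 439, .intro 1 7, .edge 4 1 3, .edge 5 1 4, .intro 5 8, .edge 3 5 5,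
  .intro 3 9, .edge 4 3 6, .intro 4 10, .edge 0 4 7, .intro 0 11, .edge 1 0 8, .intro 1 12,
  .edge 0 1 9, .intro 7 13, .edge 0 7 10, .intro 0 14, .intro 8 15, .edge 6 8 11, .edge 1 8 12,
  .edge 0 8 13, .intro 8 16, .edge 6 8 14, .intro 6 17, .edge 1 6 15, .intro 1 18, .edge 0 1 16,
  .intro 9 19, .edge 0 9 17, .intro 0 20, .edge 6 0 18, .edge 9 0 19, .intro 10 21,
  .edge 6 10 20, .edge 1 10 21, .intro 6 22, .edge 8 6 22, .edge 9 6 23, .intro 9 23,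
  .edge 8 9 24, .edge 1 9 25, .intro 1 24, .edge 9 1 26, .intro 8 25, .edge 7 8 27, .edge 0 8 28,
  .edge 1 8 29, .intro 0 26, .edge 4 0 30, .edge 1 0 31, .intro 1 27, .edge 6 1 32, .edge 0 1 33,
  .intro 0 28, .edge 1 0 34, .intro 1 29, .edge 10 1 35, .intro 6 30, .edge 7 6 36, .intro 7 31,
  .edge 4 7 37, .intro 4 32, .edge 6 4 38, .intro 8 33, .edge 6 8 39, .intro 6 34, .edge 8 6 40,
  .intro 9 35, .edge 1 9 41, .edge 8 9 42, .intro 8 36, .edge 1 8 43, .intro 1 37, .edge 9 1 44,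
  .intro 9 38, .edge 8 9 45, .intro 10 39, .edge 8 10 46, .intro 8 40, .edge 6 8 47,
  .intro 11 41, .edge 1 11 48, .edge 9 11 49, .edge 8 11 50, .intro 11 42, .edge 1 11 51,
  .edge 10 11 52, .intro 1 43, .edge 6 1 53, .edge 11 1 54, .intro 6 44, .edge 4 6 55,
  .edge 1 6 56, .intro 1 45, .edge 9 1 57, .edge 6 1 58, .intro 6 46, .edge 0 6 59, .edge 1 6 60,
  .intro 1 47, .edge 10 1 61, .edge 6 1 62, .intro 6 48, .edge 1 6 63, .intro 1 49, .edge 0 1 64,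
  .intro 0 50, .edge 5 0 65, .edge 6 0 66, .intro 9 51, .edge 7 9 67, .edge 1 9 68, .edge 0 9 69,
  .intro 0 52, .edge 6 0 70, .intro 6 53, .edge 4 6 71, .intro 4 54, .edge 8 4 72, .intro 8 55,
  .edge 4 8 73, .intro 9 56, .edge 4 9 74, .intro 4 57, .edge 8 4 75, .intro 10 58,
  .edge 8 10 76, .intro 8 59, .edge 0 8 77, .edge 4 8 78, .intro 11 60, .edge 0 11 79,
  .edge 10 11 80, .intro 0 61, .edge 10 0 81, .intro 10 62, .edge 4 10 82, .intro 4 63,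
  .edge 9 4 83, .edge 0 4 84, .edge 10 4 85, .intro 4 64, .edge 6 4 86, .edge 9 4 87,
  .intro 9 65, .edge 4 9 88, .intro 4 66, .edge 11 4 89, .intro 11 67, .edge 10 11 90,
  .edge 9 11 91, .edge 4 11 92, .intro 10 68, .edge 0 10 93, .edge 9 10 94, .intro 0 69,
  .edge 6 0 95, .edge 4 0 96, .intro 4 70, .edge 10 4 97, .intro 6 71, .edge 7 6 98, .intro 7 72,
  .edge 8 7 99, .intro 8 73, .edge 5 8 100, .intro 5 74, .edge 1 5 101, .intro 1 75,
  .edge 3 1 102, .intro 9 76, .edge 3 9 103, .intro 3 77, .edge 2 3 104, .intro 10 78,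
  .edge 2 10 105, .intro 2 79, .edge 9 2 106, .edge 10 2 107, .intro 11 80, .edge 1 11 108,
  .edge 10 11 109, .intro 10 81, .edge 2 10 110, .intro 2 82, .edge 11 2 111, .intro 11 83,
  .edge 3 11 112, .edge 10 11 113, .edge 2 11 114, .intro 11 84, .edge 8 11 115, .edge 2 11 116,
  .intro 2 85, .edge 11 2 117, .intro 11 86, .edge 3 11 118, .edge 2 11 119, .intro 3 87,
  .edge 1 3 120, .edge 11 3 121, .intro 1 88, .edge 10 1 122, .edge 2 1 123, .intro 2 89,
  .edge 8 2 124, .edge 3 2 125, .intro 3 90, .edge 2 3 126, .intro 2 91, .edge 0 2 127,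
  .intro 0 92, .edge 9 0 128, .intro 8 93, .edge 4 8 129, .intro 9 94, .edge 4 9 130,
  .intro 4 95, .intro 10 96, .edge 2 10 131, .edge 9 10 132, .edge 4 10 133, .intro 10 97,
  .edge 2 10 134, .intro 2 98, .edge 9 2 135, .intro 9 99, .edge 4 9 136, .intro 11 100,
  .edge 4 11 137, .intro 4 101, .edge 8 4 138, .intro 12 102, .edge 2 12 139, .edge 9 12 140,
  .edge 4 12 141, .intro 12 103, .edge 8 12 142, .intro 8 104, .edge 2 8 143, .edge 11 8 144,
  .edge 12 8 145, .intro 2 105, .edge 10 2 146, .edge 9 2 147, .intro 8 106, .edge 12 8 148,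
  .edge 2 8 149, .intro 2 107, .edge 4 2 150, .intro 4 108, .edge 7 4 151, .edge 8 4 152,
  .edge 2 4 153, .intro 4 109, .edge 7 4 154, .intro 7 110, .edge 2 7 155, .intro 2 111,
  .edge 10 2 156, .intro 8 112, .edge 11 8 157, .intro 9 113, .edge 6 9 158, .intro 10 114,
  .edge 5 10 159, .edge 7 10 160, .edge 9 10 161, .intro 10 115, .edge 4 10 162, .edge 9 10 163,
  .intro 9 116, .edge 7 9 164, .intro 7 117, .edge 10 7 165, .intro 10 118, .edge 9 10 166,
  .edge 7 10 167, .intro 11 119, .edge 10 11 168, .intro 10 120, .edge 9 10 169, .intro 9 121,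
  .edge 10 9 170, .intro 12 122, .edge 8 12 171, .edge 11 12 172, .edge 9 12 173, .intro 12 123,
  .edge 11 12 174, .intro 11 124, .edge 8 11 175, .intro 8 125, .edge 9 8 176, .intro 9 126,
  .edge 12 9 177, .edge 11 9 178, .edge 8 9 179, .intro 9 127, .edge 10 9 180, .intro 10 128,
  .edge 2 10 181, .edge 11 10 182, .intro 11 129, .edge 12 11 183, .edge 9 11 184, .intro 12 130,
  .edge 10 12 185, .edge 11 12 186, .intro 10 131, .edge 2 10 187, .edge 9 10 188, .intro 2 132,
  .edge 8 2 189, .edge 12 2 190, .intro 8 133, .edge 5 8 191, .intro 5 134, .edge 7 5 192,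
  .intro 7 135, .edge 10 7 193, .intro 9 136, .edge 2 9 194, .intro 2 137, .edge 4 2 195,
  .intro 4 138, .edge 5 4 196, .intro 10 139, .edge 5 10 197, .intro 5 140, .edge 9 5 198,
  .intro 11 141, .edge 9 11 199, .intro 9 142, .intro 12 143, .edge 4 12 200, .edge 11 12 201,
  .edge 9 12 202, .intro 12 144, .edge 10 12 203, .edge 11 12 204, .intro 11 145,
  .edge 12 11 205, .intro 12 146, .edge 5 12 206, .edge 9 12 207, .edge 11 12 208, .intro 12 147,
  .edge 7 12 209, .edge 5 12 210, .intro 5 148, .edge 4 5 211, .intro 4 149, .edge 11 4 212,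
  .edge 5 4 213, .intro 11 150, .edge 7 11 214, .edge 5 11 215, .intro 5 151, .edge 12 5 216,
  .edge 4 5 217, .intro 4 152, .edge 9 4 218, .edge 5 4 219, .intro 5 153, .edge 10 5 220,
  .intro 7 154, .edge 11 7 221, .intro 9 155, .edge 4 9 222, .intro 4 156, .edge 5 4 223,
  .intro 10 157, .edge 4 10 224, .intro 11 158, .edge 8 11 225, .edge 4 11 226, .intro 4 159,
  .edge 11 4 227, .intro 11 160, .edge 9 11 228, .edge 4 11 229, .intro 12 161, .edge 9 12 230,
  .intro 9 162, .edge 10 9 231, .edge 11 9 232, .intro 11 163, .edge 4 11 233, .intro 4 164,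
  .edge 9 4 234, .intro 9 165, .edge 12 9 235, .edge 11 9 236, .edge 4 9 237, .intro 9 166,
  .edge 11 9 238, .intro 11 167, .edge 7 11 239, .edge 12 11 240, .intro 12 168, .edge 10 12 241,
  .edge 9 12 242, .intro 10 169, .edge 9 10 243, .edge 11 10 244, .intro 9 170, .edge 4 9 245,
  .edge 10 9 246, .intro 4 171, .edge 7 4 247, .edge 12 4 248, .intro 7 172, .edge 4 7 249,
  .intro 4 173, .edge 8 4 250, .intro 8 174, .edge 5 8 251, .intro 5 175, .edge 6 5 252,
  .intro 6 176, .edge 8 6 253, .intro 10 177, .edge 2 10 254, .edge 5 10 255, .edge 6 10 256,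
  .intro 10 178, .edge 5 10 257, .intro 5 179, .edge 3 5 258, .edge 8 5 259, .edge 10 5 260,
  .intro 5 180, .edge 9 5 261, .intro 8 181, .edge 10 8 262, .intro 9 182, .edge 4 9 263,
  .edge 8 9 264, .intro 10 183, .edge 4 10 265, .intro 4 184, .edge 9 4 266, .intro 9 185,
  .edge 4 9 267, .intro 11 186, .edge 5 11 268, .edge 4 11 269, .intro 4 187, .edge 10 4 270,
  .edge 11 4 271, .intro 11 188, .edge 5 11 272, .intro 5 189, .edge 10 5 273, .intro 10 190,
  .edge 4 10 274, .intro 4 191, .edge 9 4 275, .edge 11 4 276, .edge 10 4 277, .intro 4 192,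
  .edge 9 4 278, .edge 5 4 279, .intro 9 193, .edge 4 9 280, .intro 4 194, .edge 7 4 281,
  .edge 11 4 282, .edge 9 4 283, .intro 4 195, .edge 10 4 284, .edge 9 4 285, .intro 9 196,
  .edge 7 9 286, .edge 5 9 287, .intro 5 197, .edge 6 5 288, .intro 6 198, .edge 9 6 289,
  .intro 7 199, .edge 3 7 290, .intro 3 200, .edge 2 3 291, .intro 2 201, .edge 8 2 292,
  .intro 8 202, .edge 1 8 293, .intro 1 203, .edge 8 1 294, .intro 9 204, .edge 8 9 295,
  .intro 8 205, .edge 1 8 296, .intro 10 206, .edge 1 10 297, .intro 1 207, .edge 8 1 298,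
  .intro 11 208, .edge 0 11 299, .edge 8 11 300, .intro 8 209, .edge 0 8 301, .edge 10 8 302,
  .intro 0 210, .edge 11 0 303, .intro 11 211, .edge 10 11 304, .intro 10 212, .edge 9 10 305,
  .edge 1 10 306, .edge 11 10 307, .intro 10 213, .edge 9 10 308, .edge 0 10 309, .intro 9 214,
  .edge 7 9 310, .edge 1 9 311, .intro 1 215, .edge 10 1 312, .edge 9 1 313, .intro 9 216,
  .edge 7 9 314, .edge 0 9 315, .intro 0 217, .edge 11 0 316, .edge 1 0 317, .intro 1 218,
  .edge 0 1 318, .intro 0 219, .edge 8 0 319, .intro 7 220, .edge 9 7 320, .intro 8 221,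
  .edge 0 8 321, .intro 9 222, .edge 0 9 322, .intro 0 223, .edge 9 0 323, .intro 10 224,
  .edge 9 10 324, .intro 9 225, .edge 8 9 325, .intro 11 226, .edge 1 11 326, .edge 0 11 327,
  .edge 9 11 328, .intro 11 227, .edge 9 11 329, .intro 9 228, .edge 1 9 330, .intro 1 229,
  .edge 0 1 331, .intro 0 230, .edge 11 0 332, .edge 9 0 333, .edge 1 0 334, .intro 0 231,
  .edge 11 0 335, .intro 11 232, .edge 10 11 336, .edge 9 11 337, .intro 9 233, .edge 1 9 338,
  .intro 1 234, .edge 0 1 339, .edge 11 1 340, .edge 9 1 341, .intro 1 235, .edge 10 1 342,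
  .intro 10 236, .edge 7 10 343, .edge 9 10 344, .edge 1 10 345, .intro 9 237, .edge 7 9 346,
  .intro 7 238, .edge 5 7 347, .edge 1 7 348, .intro 1 239, .edge 5 1 349, .edge 3 1 350,
  .edge 9 1 351, .intro 1 240, .edge 4 1 352, .intro 4 241, .edge 9 4 353, .intro 5 242,
  .edge 2 5 354, .intro 9 243, .edge 2 9 355, .edge 4 9 356, .intro 2 244, .edge 9 2 357,
  .intro 9 245, .edge 2 9 358, .intro 10 246, .edge 1 10 359, .edge 2 10 360, .intro 2 247,
  .edge 5 2 361, .edge 10 2 362, .intro 10 248, .edge 2 10 363, .intro 2 249, .edge 1 2 364,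
  .intro 1 250, .edge 9 1 365, .edge 10 1 366, .edge 2 1 367, .intro 1 251, .edge 9 1 368,
  .intro 9 252, .edge 6 9 369, .edge 2 9 370, .intro 2 253, .edge 6 2 371, .intro 6 254,
  .edge 5 6 372, .edge 1 6 373, .edge 2 6 374, .intro 5 255, .edge 1 5 375, .edge 9 5 376,
  .intro 1 256, .edge 10 1 377, .edge 5 1 378, .intro 5 257, .edge 7 5 379, .intro 6 258,
  .edge 3 6 380, .intro 3 259, .edge 8 3 381, .intro 7 260, .edge 0 7 382, .intro 0 261,
  .edge 5 0 383, .intro 8 262, .edge 5 8 384, .edge 6 8 385, .intro 5 263, .edge 8 5 386,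
  .intro 8 264, .intro 9 265, .edge 3 9 387, .edge 5 9 388, .edge 8 9 389, .intro 9 266,
  .edge 5 9 390, .intro 5 267, .edge 0 5 391, .edge 9 5 392, .intro 10 268, .edge 7 10 393,
  .edge 9 10 394, .intro 9 269, .edge 10 9 395, .intro 10 270, .edge 0 10 396, .edge 8 10 397,
  .edge 9 10 398, .intro 0 271, .edge 7 0 399, .edge 8 0 400, .intro 7 272, .edge 0 7 401,
  .intro 0 273, .edge 5 0 402, .intro 5 274, .edge 9 5 403, .edge 7 5 404, .edge 0 5 405,
  .intro 5 275, .edge 4 5 406, .intro 4 276, .edge 3 4 407, .edge 7 4 408, .intro 3 277,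
  .intro 7 278, .edge 6 7 409, .edge 5 7 410, .edge 3 7 411, .intro 6 279, .edge 2 6 412,
  .intro 2 280, .edge 5 2 413, .intro 5 281, .edge 4 5 414, .edge 6 5 415, .intro 4 282,
  .edge 1 4 416, .intro 1 283, .edge 2 1 417, .edge 5 1 418, .intro 5 284, .edge 2 5 419,
  .intro 2 285, .edge 3 2 420, .edge 4 2 421, .edge 5 2 422, .intro 2 286, .edge 1 2 423,
  .intro 1 287, .edge 3 1 424, .edge 2 1 425, .intro 3 288, .edge 6 3 426, .intro 6 289,
  .edge 1 6 427, .intro 1 290, .edge 4 1 428, .edge 3 1 429, .edge 6 1 430, .intro 1 291,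
  .edge 5 1 431, .edge 6 1 432, .intro 4 292, .edge 0 4 433, .edge 1 4 434, .intro 0 293,
  .edge 2 0 435, .edge 3 0 436, .edge 4 0 437]

/-- The table before the sweep. -/
def emptyTable : Table :=
  ⟨⟨2 ^ 2 ^ 13 - 1, 0, 0, 0, 0⟩, ⟨0, 0, 0, 0, 0⟩, ⟨0, 0, 0, 0, 0⟩, ⟨0, 0, 0, 0, 0⟩, ⟨0, 0, 0, 0, 0⟩⟩

/-- Inclusion of rows. -/
def leRow (s t : Five ℕ) : Bool :=
  Nat.beq (s.x₀ ||| t.x₀) t.x₀ && Nat.beq (s.x₁ ||| t.x₁) t.x₁ && Nat.beq (s.x₂ ||| t.x₂) t.x₂ &&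
    Nat.beq (s.x₃ ||| t.x₃) t.x₃ && Nat.beq (s.x₄ ||| t.x₄) t.x₄

/-- Inclusion of tables. -/
def leTable (s t : Table) : Bool :=
  leRow s.x₀ t.x₀ && leRow s.x₁ t.x₁ && leRow s.x₂ t.x₂ && leRow s.x₃ t.x₃ && leRow s.x₄ t.x₄

set_option maxRecDepth 100000 in
theorem sweepTable_initSweep : sweepTable (fun t => sweepTable (fun s => leTable s t) (tileSweep 0) t &&
    sweepTable (fun s => Nat.beq s.x₄.x₄ 0) coreSweep t)
      (initSweep ++ tileSweep 0 ++ tileSweep 0) emptyTable = true := by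
  decide +kernel

/-- Whether the ends of the edge `e` are on different sides, as a number. -/
def cross (T : ℕ) (σ : ℕ → Bool) (e : ℕ) : ℕ := (σ (ends T e).1 ^^ σ (ends T e).2).toNat

/-- The table has the entry for the first `t` tiles. -/
def Table.HasTiles (w : Table) (T : ℕ) (σ : ℕ → Bool) (t : ℕ) : Prop :=
  ∃ x y, w.Has σ [294, 295, 296, 290 + 4 * t, 291 + 4 * t, 292 + 4 * t, x, y, 0, 0, 0, 0, 0]
    (∑ v ∈ Finset.Ico 294 (294 + 4 * t), (σ v == true).toNat)
    (∑ v ∈ Finset.Ico 294 (294 + 4 * t), (σ v == false).toNat)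
    (∑ e ∈ Finset.Ico 441 (438 + 6 * t), cross T σ e)

theorem Table.has_emptyTable (σ : ℕ → Bool) :
    emptyTable.Has σ [0, 0, 0, 0, 0, 0, 0, 0, 0, 0, 0, 0, 0] 0 0 0 := by
  refine ⟨rfl, fun _ => ?_⟩
  obtain ⟨a, ha, ha'⟩ : ∃ a < 2 ^ 13, ∀ i < 13, a.testBit i = σ 0 := by
    cases σ 0 with
    | false => exact ⟨0, by omega, by simp⟩
    | true => exact ⟨2 ^ 13 - 1, by omega, fun i hi => by
        rw [Nat.testBit_two_pow_sub_one, decide_eq_true_iff]; exact hi⟩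
  refine ⟨a, ?_, fun i hi => ?_, ?_⟩
  · change (2 ^ 2 ^ 13 - 1).testBit a = true
    rw [Nat.testBit_two_pow_sub_one, decide_eq_true_iff]
    exact ha
  · rw [ha' i hi]
    interval_cases i <;> rfl
  · rw [Nat.shiftRight_eq_div_pow, Nat.div_eq_of_lt ha]

theorem cross_centre {T t k : ℕ} (σ : ℕ → Bool) (hk : k < 3) :
    (σ (297 + 4 * t) ^^ σ (294 + 4 * t + k)).toNat = cross T σ (441 + 6 * t + k) := by
  rw [cross, ends_centre hk, Bool.xor_comm]

theorem cross_strand {T t k : ℕ} (σ : ℕ → Bool) (ht : t ≠ 0) (htT : t < T) (hk : k < 3) :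
    (σ (290 + 4 * t + k) ^^ σ (294 + 4 * t + k)).toNat = cross T σ (438 + 6 * t + k) := by
  rw [cross, ends_strand hk, if_neg ht, if_neg htT.ne]

theorem hasTiles_initSweep (T : ℕ) (σ : ℕ → Bool) :
    (sweepTable id initSweep emptyTable).HasTiles T σ 1 := by
  refine ⟨297, 0, ?_⟩
  have h := (Table.has_emptyTable σ).sweep initSweep (by decide)
  have c := fun k hk => cross_centre (T := T) (t := 0) (k := k) σ hk
  have c0 := c 0 (by omega)
  have c1 := c 1 (by omega)
  have c2 := c 2 (by omega)
  simp only [Nat.mul_zero, Nat.add_zero, Nat.reduceAdd] at c0 c1 c2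
  convert h using 1
  · rfl
  · simp [initSweep, SweepStep.vertices, countSide, Finset.sum_Ico_succ_top, add_assoc]
  · simp [initSweep, SweepStep.vertices, countSide, Finset.sum_Ico_succ_top, add_assoc]
  · simp [initSweep, SweepStep.edges, sweepEdges, SweepStep.onSlots, countCross,
      Finset.sum_Ico_succ_top, add_assoc, ← c0, ← c1, ← c2]

theorem sweepTable_tileSweep {α : Type} (f : Table → α) (t : ℕ) (w : Table) :
    sweepTable f (tileSweep t) w = sweepTable f (tileSweep 0) w := by
  simp only [tileSweep, sweepTable, SweepStep.onTable]

theorem Table.HasTiles.succ {w : Table} {T t : ℕ} {σ : ℕ → Bool} (h : w.HasTiles T σ t)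
    (ht : t ≠ 0) (htT : t < T) :
    (sweepTable id (tileSweep 0) w).HasTiles T σ (t + 1) := by
  obtain ⟨x, y, h⟩ := h
  refine ⟨297 + 4 * t, 296 + 4 * t, ?_⟩
  have h := h.sweep (tileSweep t) (by simp [tileSweep, SweepStep.Valid])
  rw [sweepTable_tileSweep] at h
  have c := fun k hk => cross_centre (T := T) (t := t) (k := k) σ hk
  have c0 := c 0 (by omega)
  have c1 := c 1 (by omega)
  have c2 := c 2 (by omega)
  have d := fun k hk => cross_strand (k := k) σ ht htT hk
  have d0 := d 0 (by omega)
  have d1 := d 1 (by omega)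
  have d2 := d 2 (by omega)
  simp only [Nat.add_zero, Nat.add_right_comm _ _ 1, Nat.reduceAdd] at c0 c1 c2 d0 d1 d2
  convert h using 1
  · simp only [tileSweep, sweepSlots, SweepStep.onSlots, List.set_cons_zero, List.set_cons_succ,
      List.getD_cons_zero, List.getD_cons_succ, List.cons.injEq, and_true, true_and]
    omega
  · rw [show 294 + 4 * (t + 1) = 294 + 4 * t + 1 + 1 + 1 + 1 by omega]
    repeat rw [Finset.sum_Ico_succ_top (by omega)]
    simp only [Nat.add_right_comm _ _ 1, Nat.reduceAdd, tileSweep, SweepStep.vertices, countSide,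
      List.flatMap_cons, List.flatMap_nil, List.cons_append, List.nil_append, List.map_cons,
      List.map_nil, List.sum_cons, List.sum_nil]
    ring
  · rw [show 294 + 4 * (t + 1) = 294 + 4 * t + 1 + 1 + 1 + 1 by omega]
    repeat rw [Finset.sum_Ico_succ_top (by omega)]
    simp only [Nat.add_right_comm _ _ 1, Nat.reduceAdd, tileSweep, SweepStep.vertices, countSide,
      List.flatMap_cons, List.flatMap_nil, List.cons_append, List.nil_append, List.map_cons,
      List.map_nil, List.sum_cons, List.sum_nil]
    ring
  · rw [show 438 + 6 * (t + 1) = 438 + 6 * t + 1 + 1 + 1 + 1 + 1 + 1 by omega]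
    repeat rw [Finset.sum_Ico_succ_top (by omega)]
    simp only [Nat.add_right_comm _ _ 1, Nat.reduceAdd, tileSweep, sweepEdges, SweepStep.edges,
      SweepStep.onSlots, countCross, List.cons_append, List.nil_append, List.map_cons,
      List.map_nil, List.sum_cons, List.sum_nil, List.set_cons_zero, List.set_cons_succ,
      List.getD_cons_zero, List.getD_cons_succ, c0, c1, c2, d0, d1, d2]
    ring

theorem testBit_of_beq {x y b : ℕ} (h : Nat.beq (x ||| y) y = true) (hx : x.testBit b = true) :
    y.testBit b = true := by
  rw [← Nat.eq_of_beq_eq_true h, Nat.testBit_or, hx, Bool.true_or]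

theorem testBit_of_leRow {s t : Five ℕ} (h : leRow s t = true) {i b : ℕ}
    (hs : (s.get i).testBit b = true) : (t.get i).testBit b = true := by
  simp only [leRow, Bool.and_eq_true] at h
  obtain ⟨⟨⟨⟨h0, h1⟩, h2⟩, h3⟩, h4⟩ := h
  rcases i with _ | _ | _ | _ | i
  exacts [testBit_of_beq h0 hs, testBit_of_beq h1 hs, testBit_of_beq h2 hs, testBit_of_beq h3 hs,
    testBit_of_beq h4 hs]

theorem testBit_of_leTable {s t : Table} (h : leTable s t = true) {i j b : ℕ}
    (hs : ((s.get i).get j).testBit b = true) : ((t.get i).get j).testBit b = true := by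
  simp only [leTable, Bool.and_eq_true] at h
  obtain ⟨⟨⟨⟨h0, h1⟩, h2⟩, h3⟩, h4⟩ := h
  rcases i with _ | _ | _ | _ | i
  exacts [testBit_of_leRow h0 hs, testBit_of_leRow h1 hs, testBit_of_leRow h2 hs,
    testBit_of_leRow h3 hs, testBit_of_leRow h4 hs]

theorem Table.HasTiles.mono {w w' : Table} {T t : ℕ} {σ : ℕ → Bool} (h : w.HasTiles T σ t)
    (hw : leTable w w' = true) : w'.HasTiles T σ t := by
  obtain ⟨x, y, h, h'⟩ := h
  refine ⟨x, y, h, fun hd => ?_⟩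
  obtain ⟨a, ha, hc⟩ := h' hd
  exact ⟨a, testBit_of_leTable hw ha, hc⟩

theorem sweepTable_append (l l' : List SweepStep) (w : Table) :
    sweepTable id (l ++ l') w = sweepTable id l' (sweepTable id l w) := by
  induction l generalizing w with
  | nil => rfl
  | cons s l ih => simp only [List.cons_append, sweepTable, forceTable_eq, ih]

theorem le_and_eq_zero_of_sweepTable {l l' l'' : List SweepStep} {w : Table}
    (h : sweepTable (fun t => sweepTable (fun s => leTable s t) l' t &&
      sweepTable (fun s => Nat.beq s.x₄.x₄ 0) l'' t) l w = true) :
    leTable (sweepTable id l' (sweepTable id l w)) (sweepTable id l w) = true ∧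
      (sweepTable id l'' (sweepTable id l w)).x₄.x₄ = 0 := by
  rw [sweepTable_eq, Bool.and_eq_true, sweepTable_eq, sweepTable_eq (l := l'')] at h
  exact ⟨h.1, Nat.eq_of_beq_eq_true h.2⟩

theorem exists_closed_table : ∃ w : Table,
    (∀ T σ, 3 ≤ T → w.HasTiles T σ 3) ∧ leTable (sweepTable id (tileSweep 0) w) w = true ∧
      (sweepTable id coreSweep w).x₄.x₄ = 0 := by
  refine ⟨_, fun T σ hT => ?_, le_and_eq_zero_of_sweepTable sweepTable_initSweep⟩
  rw [sweepTable_append, sweepTable_append]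
  exact ((hasTiles_initSweep T σ).succ (by omega) (by omega)).succ (by omega) (by omega)

/-- The ends of a labelled edge. -/
def labelEnds (e : ℕ) : ℕ × ℕ :=
  if e < 438 then coreEnds.getD e (0, 0)
  else if e < 441 then (leftAnchor (e - 438), e - 144)
  else (rightAnchor (e - 441), e - 144)

theorem coreSweep_valid : ∀ s ∈ coreSweep, s.Valid := by decide +kernel

theorem coreSweep_vertices : coreSweep.flatMap SweepStep.vertices = List.range 294 := by
  decide +kernel

theorem coreSweep_edges : ∀ p ∈ sweepEdges coreSweep
      [294, 295, 296, 297, 298, 299, 300, 301, 0, 0, 0, 0, 0],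
    p.1 < 444 ∧ (p.2 = labelEnds p.1 ∨ p.2.swap = labelEnds p.1) := by
  decide +kernel

theorem coreSweep_edges_perm : ((sweepEdges coreSweep
      [294, 295, 296, 297, 298, 299, 300, 301, 0, 0, 0, 0, 0]).map Prod.fst).isPerm
    (List.range 444) = true := by
  decide +kernel

theorem sum_map_range (n : ℕ) (f : ℕ → ℕ) : ((List.range n).map f).sum = ∑ i ∈ Finset.range n, f i :=
  rfl

theorem cross_edgeOfLabel {T e : ℕ} {σ τ : ℕ → Bool} (hT : 0 < T) (he : e < 444)
    (h : ∀ v < 297, τ v = σ v) (h' : ∀ k < 3, τ (297 + k) = σ (290 + 4 * T + k)) :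
    (τ (labelEnds e).1 ^^ τ (labelEnds e).2).toNat = cross T σ (edgeOfLabel T e) := by
  unfold labelEnds edgeOfLabel cross
  split_ifs with h1 h2 h2
  · rw [ends_core h1]
    have := coreEnds_lt e h1
    rw [h _ (by omega), h _ (by omega)]
  · omega
  · obtain ⟨k, rfl⟩ := Nat.exists_eq_add_of_le (not_lt.1 h1)
    have := ends_strand (T := T) (t := 0) (k := k) (by omega)
    rw [if_pos rfl, if_neg hT.ne] at this
    rw [show 438 + k = 438 + 6 * 0 + k by omega, this]
    have := anchor_lt k
    simp only [Nat.mul_zero, Nat.add_zero, Nat.add_sub_cancel_left]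
    rw [h _ (by omega), show 438 + k - 144 = 294 + k by omega, h _ (by omega)]
  · obtain ⟨k, rfl⟩ := Nat.exists_eq_add_of_le (not_lt.1 h2)
    have := ends_strand (T := T) (t := T) (k := k) (by omega)
    rw [if_pos rfl, if_neg hT.ne'] at this
    rw [show 441 + k + 6 * T - 3 = 438 + 6 * T + k by omega, this]
    have := anchor_lt k
    simp only [Nat.add_sub_cancel_left]
    rw [h _ (by omega), show 441 + k - 144 = 297 + k by omega, h' _ (by omega), Bool.xor_comm]

theorem sum_edgeOfLabel {T : ℕ} (hT : 0 < T) (f : ℕ → ℕ) :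
    (∑ e ∈ Finset.Ico 441 (438 + 6 * T), f e) + ∑ e ∈ Finset.range 444, f (edgeOfLabel T e) =
      ∑ e ∈ Finset.range (441 + 6 * T), f e := by
  have h : ∑ e ∈ Finset.range 441, f (edgeOfLabel T e) = ∑ e ∈ Finset.range 441, f e :=
    Finset.sum_congr rfl fun e he => by rw [edgeOfLabel, if_pos (Finset.mem_range.1 he)]
  have h' := Finset.sum_range_add_sum_Ico f (show 441 ≤ 438 + 6 * T by omega)
  have h₃ : ∀ (g : ℕ → ℕ) n, ∑ e ∈ Finset.range (n + 3), g e =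
      ∑ e ∈ Finset.range n, g e + g n + g (n + 1) + g (n + 2) := fun g n => by
    rw [Finset.sum_range_succ, Finset.sum_range_succ, Finset.sum_range_succ]
  rw [show 441 + 6 * T = 438 + 6 * T + 3 by omega, h₃ f, ← h', h₃ _ 441, h]
  rw [edgeOfLabel, edgeOfLabel, edgeOfLabel, if_neg (by omega), if_neg (by omega), if_neg (by omega)]
  rw [show 441 + 6 * T - 3 = 438 + 6 * T by omega,
    show 441 + 1 + 6 * T - 3 = 438 + 6 * T + 1 by omega,
    show 441 + 2 + 6 * T - 3 = 438 + 6 * T + 2 by omega]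
  omega

theorem Table.Has.congr {w : Table} {σ τ : ℕ → Bool} {m m' : List ℕ} {A B d : ℕ}
    (h : w.Has σ m A B d) (hm : m'.length = 13)
    (hτ : ∀ i < 13, τ (m'.getD i 0) = σ (m.getD i 0)) : w.Has τ m' A B d := by
  refine ⟨hm, fun hd => ?_⟩
  obtain ⟨a, ha, hc, hc'⟩ := h.2 hd
  exact ⟨a, ha, fun i hi => (hc i hi).trans (hτ i hi).symm, hc'⟩

theorem six_le_sum_cross {T : ℕ} (hT : 3 ≤ T) (σ : ℕ → Bool)
    (h : ∀ b, 4 ≤ ∑ v ∈ Finset.range (294 + 4 * T), (σ v == b).toNat) :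
    6 ≤ ∑ e ∈ Finset.range (441 + 6 * T), cross T σ e := by
  obtain ⟨w, hw, hle, hzero⟩ := exists_closed_table
  have hall : ∀ t, 3 ≤ t → t ≤ T → w.HasTiles T σ t := by
    intro t ht
    induction t, ht using Nat.le_induction with
    | base => exact fun _ => hw T σ hT
    | succ t ht ih => exact fun h => ((ih (by omega)).succ (by omega) (by omega)).mono hle
  obtain ⟨x, y, hT'⟩ := hall T hT le_rfl
  let τ : ℕ → Bool := fun v => σ (if v < 297 then v else if v < 300 then v + 4 * T - 7
    else if v = 300 then x else y)
  have hτ : ∀ v < 297, τ v = σ v := fun v hv => congrArg σ (if_pos hv)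
  have hτ' : ∀ k < 3, τ (297 + k) = σ (290 + 4 * T + k) := fun k hk =>
    congrArg σ (by rw [if_neg (by omega), if_pos (by omega)]; omega)
  have hcore := (hT'.congr (τ := τ) (m' := [294, 295, 296, 297, 298, 299, 300, 301, 0, 0, 0, 0, 0])
    rfl (fun i hi => by
      have e0 := hτ' 0 (by omega)
      have e1 := hτ' 1 (by omega)
      have e2 := hτ' 2 (by omega)
      simp only [Nat.add_zero, Nat.reduceAdd, Nat.add_right_comm _ (4 * T)] at e0 e1 e2
      interval_cases i
      exacts [hτ 294 (by omega), hτ 295 (by omega), hτ 296 (by omega), e0, e1, e2, rfl, rfl,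
        hτ 0 (by omega), hτ 0 (by omega), hτ 0 (by omega), hτ 0 (by omega), hτ 0 (by omega)])).sweep
    coreSweep coreSweep_valid
  have hside : ∀ b, (∑ v ∈ Finset.Ico 294 (294 + 4 * T), (σ v == b).toNat) +
      countSide τ b (coreSweep.flatMap SweepStep.vertices) =
        ∑ v ∈ Finset.range (294 + 4 * T), (σ v == b).toNat := by
    intro b
    have h1 : ∑ v ∈ Finset.range 294, (τ v == b).toNat = ∑ v ∈ Finset.range 294, (σ v == b).toNat :=
      Finset.sum_congr rfl fun v hv => by rw [hτ v (by have := Finset.mem_range.1 hv; omega)]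
    rw [coreSweep_vertices, countSide, sum_map_range, h1, add_comm, Finset.range_eq_Ico, Finset.range_eq_Ico,
      Finset.sum_Ico_consecutive _ (by omega) (by omega)]
  have hcross : (∑ e ∈ Finset.Ico 441 (438 + 6 * T), cross T σ e) + countCross τ
      (sweepEdges coreSweep [294, 295, 296, 297, 298, 299, 300, 301, 0, 0, 0, 0, 0]) =
        ∑ e ∈ Finset.range (441 + 6 * T), cross T σ e := by
    have h1 : countCross τ
        (sweepEdges coreSweep [294, 295, 296, 297, 298, 299, 300, 301, 0, 0, 0, 0, 0]) =
          ∑ e ∈ Finset.range 444, cross T σ (edgeOfLabel T e) := by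
      rw [← sum_map_range, ← ((List.isPerm_iff.1 coreSweep_edges_perm).map _).sum_eq, List.map_map,
        countCross]
      congr 1
      refine List.map_congr_left fun p hp => ?_
      obtain ⟨h1, h2⟩ := coreSweep_edges p hp
      rw [Function.comp, ← cross_edgeOfLabel (by omega) h1 hτ hτ']
      rcases h2 with h2 | h2 <;> rw [← h2]
      rw [Bool.xor_comm]
      rfl
    rw [h1, sum_edgeOfLabel (by omega)]
  rw [hside, hside, hcross] at hcore
  by_contra hlt
  obtain ⟨a, ha, -⟩ := hcore.2 (not_le.1 hlt)
  rw [Five.get_of_le _ (h _), Five.get_of_le _ (h _), hzero, Nat.zero_testBit] at ha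
  exact Bool.noConfusion ha

/-- The adjacency matrix of listed edges, as a number. -/
def edgeMask (l : List (ℕ × ℕ)) : ℕ := l.foldr (fun p M => M ||| 2 ^ (294 * p.1 + p.2)) 0

theorem testBit_edgeMask {l : List (ℕ × ℕ)} {u v : ℕ} (h : (u, v) ∈ l) :
    (edgeMask l).testBit (294 * u + v) = true := by
  induction l with
  | nil => simp at h
  | cons p l ih =>
    rw [edgeMask, List.foldr_cons, Nat.testBit_or, Bool.or_eq_true]
    rcases List.mem_cons.1 h with rfl | h
    · exact Or.inr (Nat.testBit_two_pow_self)
    · exact Or.inl (ih h)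

theorem coreEnds_all : (coreEnds.all fun p => Nat.beq
    ((edgeMask coreEnds >>> (294 * p.1)) &&& (edgeMask coreEnds >>> (294 * p.2)) &&& (2 ^ 294 - 1))
      0) = true := by
  decide +kernel

theorem coreEnds_triangleFree {u v w : ℕ} (hw : w < 294) (h1 : (u, v) ∈ coreEnds)
    (h2 : (v, w) ∈ coreEnds) : (u, w) ∉ coreEnds := by
  intro h3
  have h := congrArg (Nat.testBit · w) (Nat.eq_of_beq_eq_true (List.all_eq_true.1 coreEnds_all _ h1))
  simp only [Nat.testBit_and, Nat.testBit_shiftRight, testBit_edgeMask h2, testBit_edgeMask h3,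
    Nat.testBit_two_pow_sub_one, hw, Nat.zero_testBit] at h
  simp at h

theorem length_coreEnds : coreEnds.length = 438 := by decide +kernel

theorem mem_coreEnds {T e u v : ℕ} (huv : u < v) (hv : v < 294) (h1 : IsEnd T e u)
    (h2 : IsEnd T e v) (hT : 2 ≤ T) (he : e < 441 + 6 * T) : (u, v) ∈ coreEnds := by
  unfold IsEnd at h1 h2
  rcases lt_or_ge e 438 with h | h
  · have h3 := coreEnds_lt e h
    rw [ends_core h] at h1 h2
    have : coreEnds.getD e (0, 0) = (u, v) := Prod.ext (by omega) (by omega)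
    have h4 : e < coreEnds.length := by rw [length_coreEnds]; exact h
    rw [← this, List.getD_eq_getElem _ _ h4]
    exact List.getElem_mem h4
  · obtain ⟨t, k, hk, rfl | rfl⟩ := exists_chain_index h
    · rw [ends_strand hk] at h1 h2
      split_ifs at h1 h2 <;> simp only at h1 h2 <;> omega
    · rw [ends_centre hk] at h1 h2
      omega

/-- The neighbours of a vertex of the chain which have a smaller number. -/
theorem eq_of_isEnd_of_lt {T e u v : ℕ} (hT : 2 ≤ T) (huv : u < v) (hv : 294 ≤ v)
    (he : e < 441 + 6 * T) (h1 : IsEnd T e u) (h2 : IsEnd T e v) :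
    (∃ t k, k < 3 ∧ v = 297 + 4 * t ∧ u = 294 + 4 * t + k) ∨
    ∃ t k, k < 3 ∧ t < T ∧ v = 294 + 4 * t + k ∧ (t = 0 ∧ u = leftAnchor k ∨
      t + 1 = T ∧ u = rightAnchor k ∨ u + 4 = v ∧ 0 < t) := by
  unfold IsEnd at h1 h2
  rcases lt_or_ge e 438 with h | h
  · have h3 := coreEnds_lt e h
    rw [ends_core h] at h1 h2
    omega
  · obtain ⟨t, k, hk, rfl | rfl⟩ := exists_chain_index h
    · rw [ends_strand hk] at h1 h2
      have := anchor_lt k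
      right
      split_ifs at h1 h2 with h3 h4 h4 <;> simp only at h1 h2
      · omega
      · exact ⟨t, k, hk, by omega, by omega, Or.inl ⟨h3, by omega⟩⟩
      · exact ⟨t - 1, k, hk, by omega, by omega, Or.inr (Or.inl ⟨by omega, by omega⟩)⟩
      · exact ⟨t, k, hk, by omega, by omega, Or.inr (Or.inr ⟨by omega, by omega⟩)⟩
    · rw [ends_centre hk] at h1 h2
      exact Or.inl ⟨t, k, hk, by omega, by omega⟩

theorem not_triangle_of_lt {T d e f u v w : ℕ} (hT : 3 ≤ T) (huv : u < v) (hvw : v < w)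
    (hd : d < 441 + 6 * T) (he : e < 441 + 6 * T) (hf : f < 441 + 6 * T) (hdu : IsEnd T d u)
    (hdv : IsEnd T d v) (hev : IsEnd T e v) (hew : IsEnd T e w) (hfu : IsEnd T f u)
    (hfw : IsEnd T f w) : False := by
  rcases lt_or_ge w 294 with h | h
  · exact coreEnds_triangleFree h (mem_coreEnds huv (hvw.trans h) hdu hdv (by omega) hd)
      (mem_coreEnds hvw h hev hew (by omega) he)
      (mem_coreEnds (huv.trans hvw) h hfu hfw (by omega) hf)
  · have hl := anchor_lt
    have h1 := eq_of_isEnd_of_lt (by omega) hvw h he hev hew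
    have h2 := eq_of_isEnd_of_lt (by omega) (huv.trans hvw) h hf hfu hfw
    have h3 := fun hv => eq_of_isEnd_of_lt (by omega) huv hv hd hdu hdv
    rcases h1 with ⟨t, k, hk, rfl, rfl⟩ | ⟨t, k, hk, ht, rfl, h1⟩
    · rcases h2 with ⟨t', k', hk', h4, rfl⟩ | ⟨t', k', hk', ht', h4, h2⟩
      · obtain rfl : t = t' := by omega
        rcases h3 (by omega) with ⟨t₁, k₁, hk₁, h5, h6⟩ | ⟨t₁, k₁, hk₁, ht₁, h5, h6⟩
        · omega
        · have := hl k₁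
          omega
      · omega
    · rcases h2 with ⟨t', k', hk', h4, rfl⟩ | ⟨t', k', hk', ht', h4, h2⟩
      · omega
      · obtain rfl : t = t' := by omega
        obtain rfl : k = k' := by omega
        have := hl k
        have hv : 294 ≤ v := by omega
        rcases h3 hv with ⟨t₁, k₁, hk₁, h5, h6⟩ | ⟨t₁, k₁, hk₁, ht₁, h5, h6⟩
        · omega
        · have := hl k₁
          omega

theorem cliqueFree_graph {T : ℕ} (hT : 3 ≤ T) : (graph T).CliqueFree 3 := by
  have key : ∀ u v w, u < v → v < w → (graph T).Adj u v → (graph T).Adj v w →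
      ¬(graph T).Adj u w := by
    intro u v w huv hvw h1 h2 h3
    obtain ⟨-, d, hd, hdu, hdv⟩ := (adj_iff u v).1 h1
    obtain ⟨-, e, he, hev, hew⟩ := (adj_iff v w).1 h2
    obtain ⟨-, f, hf, hfu, hfw⟩ := (adj_iff u w).1 h3
    exact not_triangle_of_lt hT huv hvw hd he hf hdu hdv hev hew hfu hfw
  intro s hs
  obtain ⟨u, v, w, h1, h2, h3, -⟩ := SimpleGraph.is3Clique_iff.1 hs
  rcases lt_or_gt_of_ne h1.ne with a | a <;> rcases lt_or_gt_of_ne h2.ne with b | b <;>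
    rcases lt_or_gt_of_ne h3.ne with c | c
  · exact key u v w a c h1 h3 h2
  · exact key u w v b c h2 h3.symm h1
  · omega
  · exact key w u v b a h2.symm h1 h3.symm
  · exact key v u w a b h1.symm h2 h3
  · omega
  · exact key v w u c b h3 h2.symm h1.symm
  · exact key w v u c a h3.symm h1.symm h2.symm

/-- An edge cut with at least four vertices on both sides has at least six edges. -/
theorem six_le_ncard {T : ℕ} (hT : 3 ≤ T) {F : Set (Sym2 (Fin (294 + 4 * T)))}
    {S : Set (Fin (294 + 4 * T))} (hF : ∀ u v, (graph T).Adj u v → u ∈ S → v ∉ S → s(u, v) ∈ F)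
    (h : 4 ≤ S.ncard) (h' : 4 ≤ Sᶜ.ncard) : 6 ≤ F.ncard := by
  classical
  let σ : ℕ → Bool := fun v => decide (∃ h : v < 294 + 4 * T, ⟨v, h⟩ ∈ S)
  have hσ : ∀ v : Fin (294 + 4 * T), σ v = decide (v ∈ S) := fun v => by simp [σ]
  have hside : ∀ b, 4 ≤ ∑ v ∈ Finset.range (294 + 4 * T), (σ v == b).toNat := by
    intro b
    rw [Finset.sum_range]
    simp only [hσ, Bool.toNat, Bool.cond_eq_ite, ← Finset.card_filter]
    cases b with
    | true => rw [Set.ncard_eq_toFinset_card'] at h; convert h using 2; ext; simp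
    | false => rw [Set.ncard_eq_toFinset_card'] at h'; convert h' using 2; ext; simp
  refine (six_le_sum_cross hT σ hside).trans ?_
  simp only [cross, Bool.toNat, Bool.cond_eq_ite, ← Finset.card_filter]
  rw [← Set.ncard_coe_finset]
  refine (Set.ncard_le_ncard ?_ (Set.toFinite (edgeIndex T '' F))).trans
    (Set.ncard_image_le (Set.toFinite F))
  intro e he
  simp only [Finset.coe_filter, Finset.mem_range, Set.mem_ofPred_eq] at he
  obtain ⟨he, hx⟩ := he
  have hu := (exists_inc_eq he (Or.inl rfl)).1
  have hv := (exists_inc_eq he (Or.inr rfl)).1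
  have huv := ends_fst_ne_snd (by omega) he
  have key : ∀ u v : Fin (294 + 4 * T), u ≠ v → IsEnd T e u → IsEnd T e v → u ∈ S → v ∉ S →
      e ∈ edgeIndex T '' F := by
    intro u v huv h1 h2 h3 h4
    have hadj : (graph T).Adj u v := (adj_iff u v).2 ⟨huv, e, he, h1, h2⟩
    have hs := edgeIndex_spec ((SimpleGraph.mem_edgeSet _).2 hadj)
    exact ⟨s(u, v), hF u v hadj h3 h4, eq_of_isEnd (by omega) hs.1 he (Fin.val_ne_of_ne huv)
      (hs.2 u (by simp)) (hs.2 v (by simp)) h1 h2⟩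
  have hne : (⟨_, hu⟩ : Fin (294 + 4 * T)) ≠ ⟨_, hv⟩ := fun h => huv (Fin.ext_iff.1 h)
  have hu' := hσ ⟨_, hu⟩
  have hv' := hσ ⟨_, hv⟩
  simp only at hu' hv'
  rw [hu', hv'] at hx
  by_cases h1 : (⟨_, hu⟩ : Fin (294 + 4 * T)) ∈ S <;> by_cases h2 : ⟨_, hv⟩ ∈ S
  · simp [h1, h2] at hx
  · exact key _ _ hne (Or.inl rfl) (Or.inr rfl) h1 h2
  · exact key _ _ hne.symm (Or.inr rfl) (Or.inl rfl) h2 h1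
  · simp [h1, h2] at hx

theorem mem_of_not_reachable {V : Type*} {G : SimpleGraph V} {F : Set (Sym2 V)} {a u v : V}
    (h : G.Adj u v) (hu : (G.deleteEdges F).Reachable a u)
    (hv : ¬(G.deleteEdges F).Reachable a v) : s(u, v) ∈ F := by
  by_contra hF
  exact hv (hu.trans (SimpleGraph.Adj.reachable (SimpleGraph.deleteEdges_adj.2 ⟨h, hF⟩)))

theorem connected_graph {T : ℕ} (hT : 3 ≤ T) : (graph T).Connected := by
  have hcard : ∀ (S : Set (Fin (294 + 4 * T))) v, v ∈ S → (∀ w, (graph T).Adj v w → w ∈ S) →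
      4 ≤ S.ncard := by
    intro S v hv h
    have h3 : ((graph T).neighborSet v).ncard = 3 := isCubic_graph (by omega) v
    have h4 : (insert v ((graph T).neighborSet v)).ncard = 4 := by
      rw [Set.ncard_insert_of_notMem (by simp) (Set.toFinite _), h3]
    exact h4.symm.trans_le (Set.ncard_le_ncard (Set.insert_subset hv h) (Set.toFinite _))
  have : Nonempty (Fin (294 + 4 * T)) := ⟨⟨0, by omega⟩⟩
  refine ⟨fun a b => ?_⟩
  by_contra hab
  have := six_le_ncard hT (F := ∅) (S := {v | (graph T).Reachable a v})
    (fun u v h hu hv => hv (SimpleGraph.Reachable.trans hu h.reachable))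
    (hcard _ a (SimpleGraph.Reachable.refl a) fun w h => h.reachable)
    (hcard _ b hab fun w h hw => hab (SimpleGraph.Reachable.trans hw h.symm.reachable))
  simp at this

theorem four_le_ncard_of_isCycle {V : Type*} [Finite V] {G : SimpleGraph V}
    (hG : G.CliqueFree 3) {a : V} {w : G.Walk a a} (hw : w.IsCycle) {S : Set V}
    (hS : ∀ v, G.Reachable a v → v ∈ S) : 4 ≤ S.ncard := by
  classical
  have h3 := hw.three_le_length
  have hne : w.length ≠ 3 := fun h => by
    obtain ⟨s, hs⟩ := SimpleGraph.is3Clique_iff_exists_cycle_length_three.2 ⟨a, w, hw, h⟩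
    exact hG s hs
  have hcard : w.support.tail.toFinset.card = w.length := by
    rw [List.toFinset_card_of_nodup hw.support_nodup]
    simp
  have hle : (w.support.tail.toFinset : Set V).ncard ≤ S.ncard :=
    Set.ncard_le_ncard (fun v hv => hS v ⟨w.takeUntil v
      (List.mem_of_mem_tail (List.mem_toFinset.1 hv))⟩) (Set.toFinite _)
  rw [Set.ncard_coe_finset] at hle
  omega

theorem cyclicallyConnected_graph {T : ℕ} (hT : 3 ≤ T) : CyclicallyConnected (graph T) 6 := by
  rintro ⟨F, -, hF6, a, b, ⟨w, hw⟩, ⟨w', hw'⟩, hab⟩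
  have hfree : ((graph T).deleteEdges F).CliqueFree 3 :=
    (cliqueFree_graph hT).anti (SimpleGraph.deleteEdges_le F)
  refine hF6.not_ge (six_le_ncard hT (S := {v | ((graph T).deleteEdges F).Reachable a v})
    (fun u v => mem_of_not_reachable) (four_le_ncard_of_isCycle hfree hw fun v h => h)
    (four_le_ncard_of_isCycle hfree hw' fun v h h' => ?_))
  exact hab (SimpleGraph.Reachable.trans h' h.symm)

end ChainSnark

/-- For every integer `n ≡ 2 (mod 8)` with `n ≥ 306` there exists a
cyclically 6-connected strictly critical snark of order `n`. -/
theorem exists_cyclically6Connected_strictlyCritical_snark_mod8_eq_2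
    (n : ℕ) (hn : n % 8 = 2) (hn306 : 306 ≤ n) :
    ∃ G : SimpleGraph (Fin n),
      IsSnark G ∧ CyclicallyConnected G 6 ∧ StrictlyCritical G := by
  obtain ⟨m, rfl⟩ : ∃ m, n = 306 + 8 * m := ⟨(n - 306) / 8, by omega⟩
  rw [show 306 + 8 * m = 294 + 4 * (3 + 2 * m) by omega]
  have hT : 3 ≤ 3 + 2 * m := by omega
  have hodd : 3 + 2 * m = 2 * (m + 1) + 1 := by omega
  refine ⟨ChainSnark.graph (3 + 2 * m), ⟨ChainSnark.connected_graph hT,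
    ChainSnark.isCubic_graph (by omega), ?_⟩, ChainSnark.cyclicallyConnected_graph hT,
    ChainSnark.critical_graph m, ?_⟩
  · rw [hodd]
    exact ChainSnark.not_threeEdgeColorable_graph (m + 1)
  · rw [hodd]
    exact ChainSnark.not_bicritical_graph (m + 1)
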